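/- arXiv:math/9701219 — 3 statements merged into one kernel-verified Lean document; each statement's English description precedes it below -/
import Mathlib

section
/- Composition theorem for binary sums: if C, C', D, D' are chains and Ā ⊆ C, Ā' ⊆ C', B̄ ⊆ D, B̄' ⊆ D' are tuples of subsets all of the same length, and Th^m(C;Ā) = Th^m(C';Ā') and Th^m(D;B̄) = Th^m(D';B̄'), then Th^m(C+D; Ā∪B̄) = Th^m(C'+D'; Ā'∪B̄'). -/
open FirstOrder

universe u v w u' v'

/-! ### The monadic language of order and partial theories -/

/-- The relations of the monadic language of order: `SING`, `EM` (unary),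
`⊆` and `<*` (binary). -/
inductive MonRel : ℕ → Type
  | sing : MonRel 1
  | empt : MonRel 1
  | subset : MonRel 2
  | sless : MonRel 2

/-- The first-order language `L(mon)` of the monadic theory of order. -/
def monLang : FirstOrder.Language :=
  { Functions := fun _ => Empty, Relations := MonRel }

/-- For a chain `C`, the structure `C^mon` on the power set of `C`. -/
instance monStructure (C : Type u) [LinearOrder C] : monLang.Structure (Set C) where
  funMap := fun f _ => f.elim
  RelMap := fun {n} r args =>
    match r with
    | .sing => ∃ x : C, args 0 = {x}
    | .empt => args 0 = ∅
    | .subset => args 0 ⊆ args 1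
    | .sless => ∃ x y : C, args 0 = {x} ∧ args 1 = {y} ∧ x < y

/-- The type in which the partial theory `Th^n(C; Ā)` of a tuple `Ā` indexed by `α`
takes its value: at level `0` a set of formulas, at level `n+1` a set of level-`n`
theories of tuples extended by one more set. -/
def TheoryType : ℕ → Type → Type
  | 0, α => Set (monLang.Formula α)
  | (n+1), α => Set (TheoryType n (Option α))

/-- The partial theory `Th^n(C; Ā)`:  `Th^0` is the set of quantifier-free monadic
formulas satisfied by `Ā` in `C^mon`, and `Th^{n+1}(C;Ā) = { Th^n(C;Ā⌢B) : B ⊆ C }`. -/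
def Th {C : Type u} [LinearOrder C] : (n : ℕ) → {α : Type} → (α → Set C) → TheoryType n α
  | 0, _, A => { φ | φ.IsQF ∧ φ.Realize A }
  | (n+1), _, A => { t | ∃ B : Set C, t = Th n (fun o => Option.elim o B A) }

/-- `Th^n(D; Ā)` for a sub-chain `D ⊆ C`: the partial theory of the restricted tuple
`Ā ∩ D` computed in the chain `D`. -/
def ThOn {C : Type u} [LinearOrder C] (n : ℕ) {α : Type} (D : Set C) (A : α → Set C) :
    TheoryType n α :=
  Th n (fun i => {x : D | (x : C) ∈ A i})

/-- The set `T_{n,α}` of formally possible theories: all values `Th^n(C;Ā)` as `C`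
ranges over chains (in universe `u`) and `Ā` over `α`-tuples of subsets of `C`. -/
def FormallyPossible (n : ℕ) (α : Type) : Set (TheoryType n α) :=
  { t | ∃ (C : Type u) (_ : LinearOrder C) (A : α → Set C), t = Th n A }

/-- `|T_{n,l}|`, the (finite) number of formally possible `(n,l)`-theories. -/
noncomputable def Tcard (n l : ℕ) : ℕ :=
  Nat.card (FormallyPossible.{0} n (Fin l))

/-- `Th^n` determines the truth of `φ`:  for any two chains and `α`-tuples with the same
level-`n` partial theory, `φ` holds in one iff it holds in the other.  `dp(φ) ≤ n`. -/
def DeterminedBy (n : ℕ) {α : Type} (φ : monLang.Formula α) : Prop :=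
  ∀ (C : Type u) (D : Type v) [LinearOrder C] [LinearOrder D]
    (A : α → Set C) (B : α → Set D),
    Th n A = Th n B → (φ.Realize A ↔ φ.Realize B)

/-! ### Sums of chains -/

/-- The coordinatewise union `Ā ∪ B̄` of tuples along the sum chain `C + D`. -/
def sumTuple {C : Type u} {D : Type v} {α : Type} (A : α → Set C) (B : α → Set D) :
    α → Set (C ⊕ₗ D) :=
  fun i => {x | Sum.elim (fun c => c ∈ A i) (fun d => d ∈ B i) (ofLex x)}

/-- The coordinatewise union `∪_i Ā^i` of tuples along an indexed sum `Σ_{i∈I} C_i`. -/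
def sigmaTuple {ι : Type u} {Cc : ι → Type v} {α : Type} (A : (i : ι) → α → Set (Cc i)) :
    α → Set (Σₗ i, Cc i) :=
  fun j => {x | (ofLex x).2 ∈ A (ofLex x).1 j}

/-! ### Random graphs -/

/-- A graph is `K`-random (`K < ω`) if any two disjoint sets of vertices of size `< K`
can be separated by a vertex. -/
def IsKRandom {V : Type v} (G : SimpleGraph V) (K : ℕ) : Prop :=
  ∀ A₀ A₁ : Finset V, Disjoint A₀ A₁ → A₀.card < K → A₁.card < K →
    ∃ x, (∀ a ∈ A₀, G.Adj x a) ∧ (∀ b ∈ A₁, ¬ G.Adj x b)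

/-- A graph is `ω`-random if any two disjoint finite sets of vertices can be
separated by a vertex. -/
def IsOmegaRandom {V : Type v} (G : SimpleGraph V) : Prop :=
  ∀ A₀ A₁ : Finset V, Disjoint A₀ A₁ →
    ∃ x, (∀ a ∈ A₀, G.Adj x a) ∧ (∀ b ∈ A₁, ¬ G.Adj x b)

/-- `A` is big for `(K₁,K₂)` in the graph `G`: some `B` with `|B| ≤ K₁` witnesses that
any disjoint `A₁,A₂ ⊆ G∖B` with `|A₁∪A₂| ≤ K₂` are separated by some `x ∈ A∖(A₁∪A₂)`. -/
def BigFor {V : Type v} (G : SimpleGraph V) (A : Set V) (K₁ K₂ : ℕ) : Prop :=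
  ∃ B : Finset V, B.card ≤ K₁ ∧
    ∀ A₁ A₂ : Finset V, Disjoint A₁ A₂ →
      (∀ y ∈ A₁, y ∉ B) → (∀ y ∈ A₂, y ∉ B) → A₁.card + A₂.card ≤ K₂ →
        ∃ x ∈ A, x ∉ A₁ ∧ x ∉ A₂ ∧ (∀ y ∈ A₁, G.Adj x y) ∧ (∀ y ∈ A₂, ¬ G.Adj x y)

/-! ### Interpretations of graphs in chains -/

/-- The data of a (candidate) interpretation of dimension `d`: monadic formulas
`U(X̄,W̄)`, `E(X̄,Ȳ,W̄)` and `R(X̄,Ȳ,W̄)`. -/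
structure InterpData (d : ℕ) where
  U : monLang.Formula (Fin d ⊕ Fin d)
  E : monLang.Formula (Fin d ⊕ (Fin d ⊕ Fin d))
  R : monLang.Formula (Fin d ⊕ (Fin d ⊕ Fin d))

variable {C : Type u} [LinearOrder C] {V : Type v} {d : ℕ}

/-- `C ⊨ U(X̄,W̄)`:  `X̄` is a representative. -/
def SatU (I : InterpData d) (W X : Fin d → Set C) : Prop :=
  I.U.Realize (Sum.elim X W)

/-- `C ⊨ E(X̄,Ȳ,W̄)`:  `X̄ ∼ Ȳ`. -/
def SatE (I : InterpData d) (W X Y : Fin d → Set C) : Prop :=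
  I.E.Realize (Sum.elim X (Sum.elim Y W))

/-- `C ⊨ R(X̄,Ȳ,W̄)`. -/
def SatR (I : InterpData d) (W X Y : Fin d → Set C) : Prop :=
  I.R.Realize (Sum.elim X (Sum.elim Y W))

/-- `g` exhibits `I` (with parameters `W̄`) as an interpretation of the graph `G` in the
chain `C`:  `g` identifies the quotient of `C^U = {X̄ : C ⊨ U(X̄,W̄)}` by `∼` with `G`,
carrying the interpreted relation `R` to adjacency.  In particular `E` defines an
equivalence relation on `C^U` and `R` respects it. -/
def InterpretsVia (G : SimpleGraph V) (I : InterpData d) (W : Fin d → Set C)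
    (g : {X : Fin d → Set C // SatU I W X} → V) : Prop :=
  Function.Surjective g ∧
    (∀ X Y, g X = g Y ↔ SatE I W X.val Y.val) ∧
    (∀ X Y, G.Adj (g X) (g Y) ↔ SatR I W X.val Y.val)

/-- `I` (with parameters `W̄`) is an interpretation of the graph `G` in the chain `C`. -/
def IsInterpretation (G : SimpleGraph V) (I : InterpData d) (W : Fin d → Set C) : Prop :=
  ∃ g : {X : Fin d → Set C // SatU I W X} → V, InterpretsVia G I W g

/-- The interpretation `I` has depth (at most) `n`: each of its three formulas is
determined by level-`n` partial theories. -/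
def HasDepth (I : InterpData d) (n : ℕ) : Prop :=
  DeterminedBy.{u,v} n I.U ∧ DeterminedBy.{u,v} n I.E ∧ DeterminedBy.{u,v} n I.R

/-! ### Segments, cuts, fatness and majorness -/

/-- Two tuples coincide outside the segment `D`. -/
def CoincideOutside (D : Set C) (X Y : Fin d → Set C) : Prop :=
  ∀ k, ∀ x ∉ D, (x ∈ X k ↔ x ∈ Y k)

/-- `(L,R)` is a Dedekind cut of the chain `C`. -/
def IsDedekindCut (L R : Set C) : Prop :=
  IsLowerSet L ∧ IsUpperSet R ∧ L ∩ R = ∅ ∧ L ∪ R = Set.univ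

/-- The segment `D` is `k`-fat: `#(D) ≥ k`, i.e. there are `k` pairwise nonequivalent
representatives coinciding outside `D`. -/
def Fat (I : InterpData d) (W : Fin d → Set C) (D : Set C) (k : ℕ) : Prop :=
  ∃ Us : Fin k → (Fin d → Set C),
    (∀ i, SatU I W (Us i)) ∧
    (∀ i j, i ≠ j → ¬ SatE I W (Us i) (Us j)) ∧
    (∀ i j, CoincideOutside D (Us i) (Us j))

/-- The segment `D` is `(K₁,K₂)`-major (relative to the isomorphism `g` of the
interpreted graph with `G`): some family of representatives coinciding outside `D`
represents a subset of `G` that is big for `(K₁,K₂)`. -/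
def IsMajor (G : SimpleGraph V) {I : InterpData d} {W : Fin d → Set C}
    (g : {X : Fin d → Set C // SatU I W X} → V) (D : Set C) (K₁ K₂ : ℕ) : Prop :=
  ∃ S : Set {X : Fin d → Set C // SatU I W X},
    (∀ X ∈ S, ∀ Y ∈ S, CoincideOutside D X.val Y.val) ∧
    BigFor G (g '' S) K₁ K₂

/-! ### Short chains -/

/-- A chain is short if it embeds neither `(ω₁,<)` nor `(ω₁,>)`. -/
def ShortChain (C : Type u) [LinearOrder C] : Prop :=
  (¬ ∃ f : (Set.Iio (Cardinal.aleph.{0} 1).ord) → C, StrictMono f) ∧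
  (¬ ∃ f : (Set.Iio (Cardinal.aleph.{0} 1).ord) → C, StrictAnti f)

/-! ### Clubs, semi-clubs and shufflings on a regular cardinal -/

/-- `J` is a club (closed unbounded) subset of the ordinal `lam`. -/
def IsClubIn (J : Set Ordinal.{0}) (lam : Ordinal.{0}) : Prop :=
  J ⊆ Set.Iio lam ∧ (∀ α < lam, ∃ β ∈ J, α ≤ β) ∧
    ∀ α < lam, α ≠ 0 → (∀ β < α, ∃ γ ∈ J, β < γ ∧ γ < α) → α ∈ J

/-- `a` is a semi-club subset of `lam`: for every `α < lam` of uncountable cofinality,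
if `α ∈ a` then some club of `α` is contained in `a`, and if `α ∉ a` then some club
of `α` is disjoint from `a`. -/
def IsSemiClub (a : Set Ordinal.{0}) (lam : Ordinal.{0}) : Prop :=
  a ⊆ Set.Iio lam ∧
    ∀ α < lam, Cardinal.aleph0 < α.cof →
      (α ∈ a → ∃ c, IsClubIn c α ∧ c ⊆ a) ∧
      (α ∉ a → ∃ c, IsClubIn c α ∧ Disjoint c a)

/-- The shuffling `[X,Y]^J_a` of `X,Y ⊆ lam` with respect to the club `J`
(with increasing enumeration `⟨α_i : i < lam⟩`) and the semi-club `a`. -/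
noncomputable def shuffleSet (lam : Ordinal.{0}) (J a X Y : Set Ordinal.{0}) :
    Set Ordinal.{0} :=
  (⋃ i ∈ a, X ∩ Set.Ico (Ordinal.enumOrd J i) (Ordinal.enumOrd J (i+1))) ∪
  (⋃ i ∈ Set.Iio lam \ a, Y ∩ Set.Ico (Ordinal.enumOrd J i) (Ordinal.enumOrd J (i+1)))

section SumTuple

variable {C : Type u} {D : Type v} {α : Type} {A : α → Set C} {B : α → Set D}

theorem inlₗ_mem_sumTuple {i : α} {c : C} : Sum.inlₗ c ∈ sumTuple A B i ↔ c ∈ A i := Iff.rfl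

theorem inrₗ_mem_sumTuple {i : α} {d : D} : Sum.inrₗ d ∈ sumTuple A B i ↔ d ∈ B i := Iff.rfl

theorem sumTuple_subset_iff {i j : α} :
    sumTuple A B i ⊆ sumTuple A B j ↔ A i ⊆ A j ∧ B i ⊆ B j :=
  ⟨fun h => ⟨fun _ hc => h (inlₗ_mem_sumTuple.2 hc), fun _ hd => h (inrₗ_mem_sumTuple.2 hd)⟩,
    fun h x => match x with
      | Sum.inlₗ _ => fun hc => h.1 hc
      | Sum.inrₗ _ => fun hd => h.2 hd⟩

theorem sumTuple_eq_empty_iff {i : α} : sumTuple A B i = ∅ ↔ A i = ∅ ∧ B i = ∅ := by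
  simp only [Set.eq_empty_iff_forall_notMem]
  exact ⟨fun h => ⟨fun c => h (Sum.inlₗ c), fun d => h (Sum.inrₗ d)⟩,
    fun h x => match x with
      | Sum.inlₗ c => h.1 c
      | Sum.inrₗ d => h.2 d⟩

theorem sumTuple_eq_singleton_inlₗ_iff {i : α} {c : C} :
    sumTuple A B i = {Sum.inlₗ c} ↔ A i = {c} ∧ B i = ∅ := by
  simp [Set.ext_iff, Lex.forall, sumTuple]

theorem sumTuple_eq_singleton_inrₗ_iff {i : α} {d : D} :
    sumTuple A B i = {Sum.inrₗ d} ↔ A i = ∅ ∧ B i = {d} := by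
  simp [Set.ext_iff, Lex.forall, sumTuple]

theorem exists_sumTuple_eq_singleton_iff {i : α} :
    (∃ x, sumTuple A B i = {x}) ↔
      ((∃ c, A i = {c}) ∧ B i = ∅) ∨ (A i = ∅ ∧ ∃ d, B i = {d}) := by
  have : (∃ x, sumTuple A B i = {x}) ↔
      (∃ c, sumTuple A B i = {Sum.inlₗ c}) ∨ ∃ d, sumTuple A B i = {Sum.inrₗ d} := by
    simp [Lex.exists]
  simp only [this, sumTuple_eq_singleton_inlₗ_iff, sumTuple_eq_singleton_inrₗ_iff,
    exists_and_left, exists_and_right]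

theorem sumTuple_option_elim (X : Set C) (Y : Set D) (A : α → Set C) (B : α → Set D) :
    sumTuple (fun o => Option.elim o X A) (fun o => Option.elim o Y B) =
      fun o => Option.elim o {x | Sum.elim (· ∈ X) (· ∈ Y) (ofLex x)} (sumTuple A B) := by
  funext o
  cases o <;> rfl

theorem option_elim_sumTuple (Z : Set (C ⊕ₗ D)) (A : α → Set C) (B : α → Set D) :
    (fun o => Option.elim o Z (sumTuple A B)) =
      sumTuple (fun o => Option.elim o (Sum.inlₗ ⁻¹' Z) A)
        (fun o => Option.elim o (Sum.inrₗ ⁻¹' Z) B) := by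
  rw [sumTuple_option_elim]
  congr! 3
  ext x
  match x with
  | Sum.inlₗ _ => rfl
  | Sum.inrₗ _ => rfl

end SumTuple

/-- The tuples `A` and `A'` satisfy the same relations of the monadic language of order. -/
structure SameRelations {C : Type u} {C' : Type v} [LinearOrder C] [LinearOrder C'] {α : Type}
    (A : α → Set C) (A' : α → Set C') : Prop where
  sing : ∀ i, (∃ x, A i = {x}) ↔ ∃ x, A' i = {x}
  empt : ∀ i, A i = ∅ ↔ A' i = ∅
  subset : ∀ i j, A i ⊆ A j ↔ A' i ⊆ A' j
  sless : ∀ i j, (∃ x y, A i = {x} ∧ A j = {y} ∧ x < y) ↔ ∃ x y, A' i = {x} ∧ A' j = {y} ∧ x < y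

section SameRelations

variable {C : Type u} {C' : Type v} {D : Type u'} {D' : Type v'}
  [LinearOrder C] [LinearOrder C'] [LinearOrder D] [LinearOrder D'] {α : Type}
  {A : α → Set C} {A' : α → Set C'} {B : α → Set D} {B' : α → Set D'}

theorem SameRelations.of_Th_zero_eq (h : Th 0 A = Th 0 A') : SameRelations A A' := by
  have key (n : ℕ) (r : monLang.Relations n) (v : Fin n → α) :
      Language.Structure.RelMap r (A ∘ v) ↔ Language.Structure.RelMap r (A' ∘ v) := by
    have hφ : (r.formula fun k => Language.Term.var (v k)).IsQF :=
      (Language.BoundedFormula.IsAtomic.rel _ _).isQF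
    have hmem := Set.ext_iff.mp h (r.formula fun k => Language.Term.var (v k))
    simpa [Th, hφ, Language.Formula.realize_rel, Function.comp_def] using hmem
  exact ⟨fun i => key 1 MonRel.sing ![i], fun i => key 1 MonRel.empt ![i],
    fun i j => key 2 MonRel.subset ![i, j], fun i j => key 2 MonRel.sless ![i, j]⟩

theorem SameRelations.relMap_iff (h : SameRelations A A') {n : ℕ} (r : MonRel n)
    (v : Fin n → α) :
    Language.Structure.RelMap (L := monLang) r (A ∘ v) ↔
      Language.Structure.RelMap (L := monLang) r (A' ∘ v) := by
  cases r with
  | sing => exact h.sing (v 0)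
  | empt => exact h.empt (v 0)
  | subset => exact h.subset (v 0) (v 1)
  | sless => exact h.sless (v 0) (v 1)

theorem monLang_term_eq_var {β : Type} (t : monLang.Term β) : ∃ b, t = Language.Term.var b := by
  cases t with
  | var b => exact ⟨b, rfl⟩
  | func f => exact f.elim

theorem SameRelations.realize_iff {β : Type} {A : β → Set C} {A' : β → Set C'} {k : ℕ}
    {xs : Fin k → Set C} {xs' : Fin k → Set C'}
    (h : SameRelations (Sum.elim A xs) (Sum.elim A' xs'))
    {φ : monLang.BoundedFormula β k} (hφ : φ.IsQF) :
    φ.Realize A xs ↔ φ.Realize A' xs' := by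
  induction hφ with
  | falsum => rfl
  | of_isAtomic hat =>
    cases hat with
    | equal t₁ t₂ =>
      obtain ⟨a, rfl⟩ := monLang_term_eq_var t₁
      obtain ⟨b, rfl⟩ := monLang_term_eq_var t₂
      simp only [Language.BoundedFormula.realize_bdEqual, Language.Term.realize_var,
        Set.Subset.antisymm_iff, h.subset]
    | rel r ts =>
      choose v hv using fun j => monLang_term_eq_var (ts j)
      simpa [Language.BoundedFormula.realize_rel, hv, Function.comp_def] using h.relMap_iff r v
  | imp _ _ ih₁ ih₂ => simp only [Language.BoundedFormula.realize_imp, ih₁, ih₂]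

theorem SameRelations.Th_zero_eq (h : SameRelations A A') : Th 0 A = Th 0 A' := by
  have h' : SameRelations (Sum.elim A (default : Fin 0 → Set C))
      (Sum.elim A' (default : Fin 0 → Set C')) := by
    refine ⟨?_, ?_, ?_, ?_⟩ <;> simp only [Sum.forall, IsEmpty.forall_iff, and_true, Sum.elim_inl]
    exacts [h.sing, h.empt, h.subset, h.sless]
  refine Set.ext fun φ => ?_
  exact and_congr_right fun hφ => by
    simpa only [Language.Formula.Realize, Unique.eq_default] using h'.realize_iff hφ

theorem Th_zero_eq_iff : Th 0 A = Th 0 A' ↔ SameRelations A A' :=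
  ⟨SameRelations.of_Th_zero_eq, SameRelations.Th_zero_eq⟩

theorem exists_sumTuple_lt_iff {i j : α} :
    (∃ x y, sumTuple A B i = {x} ∧ sumTuple A B j = {y} ∧ x < y) ↔
      ((∃ c c', A i = {c} ∧ A j = {c'} ∧ c < c') ∧ B i = ∅ ∧ B j = ∅) ∨
      (((∃ c, A i = {c}) ∧ B i = ∅) ∧ A j = ∅ ∧ ∃ d, B j = {d}) ∨
      ((∃ d d', B i = {d} ∧ B j = {d'} ∧ d < d') ∧ A i = ∅ ∧ A j = ∅) := by
  constructor
  · rintro ⟨x, y, hx, hy, hxy⟩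
    match x, y with
    | Sum.inlₗ c, Sum.inlₗ c' =>
      rw [sumTuple_eq_singleton_inlₗ_iff] at hx hy
      exact .inl ⟨⟨c, c', hx.1, hy.1, Sum.Lex.inl_lt_inl_iff.1 hxy⟩, hx.2, hy.2⟩
    | Sum.inlₗ c, Sum.inrₗ d =>
      rw [sumTuple_eq_singleton_inlₗ_iff] at hx
      rw [sumTuple_eq_singleton_inrₗ_iff] at hy
      exact .inr (.inl ⟨⟨⟨c, hx.1⟩, hx.2⟩, hy.1, d, hy.2⟩)
    | Sum.inrₗ d, Sum.inlₗ c => exact absurd hxy Sum.Lex.not_inr_lt_inl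
    | Sum.inrₗ d, Sum.inrₗ d' =>
      rw [sumTuple_eq_singleton_inrₗ_iff] at hx hy
      exact .inr (.inr ⟨⟨d, d', hx.2, hy.2, Sum.Lex.inr_lt_inr_iff.1 hxy⟩, hx.1, hy.1⟩)
  · rintro (⟨⟨c, c', hc, hc', hlt⟩, hi, hj⟩ | ⟨⟨⟨c, hc⟩, hi⟩, hj, d, hd⟩ |
      ⟨⟨d, d', hd, hd', hlt⟩, hi, hj⟩)
    · exact ⟨_, _, sumTuple_eq_singleton_inlₗ_iff.2 ⟨hc, hi⟩,
        sumTuple_eq_singleton_inlₗ_iff.2 ⟨hc', hj⟩, Sum.Lex.inl_lt_inl_iff.2 hlt⟩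
    · exact ⟨_, _, sumTuple_eq_singleton_inlₗ_iff.2 ⟨hc, hi⟩,
        sumTuple_eq_singleton_inrₗ_iff.2 ⟨hj, hd⟩, Sum.Lex.inl_lt_inr _ _⟩
    · exact ⟨_, _, sumTuple_eq_singleton_inrₗ_iff.2 ⟨hi, hd⟩,
        sumTuple_eq_singleton_inrₗ_iff.2 ⟨hj, hd'⟩, Sum.Lex.inr_lt_inr_iff.2 hlt⟩

theorem SameRelations.sumTuple (h₁ : SameRelations A A') (h₂ : SameRelations B B') :
    SameRelations (sumTuple A B) (sumTuple A' B') where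
  sing i := by simp only [exists_sumTuple_eq_singleton_iff, h₁.sing, h₁.empt, h₂.sing, h₂.empt]
  empt i := by simp only [sumTuple_eq_empty_iff, h₁.empt, h₂.empt]
  subset i j := by simp only [sumTuple_subset_iff, h₁.subset, h₂.subset]
  sless i j := by
    simp only [exists_sumTuple_lt_iff, h₁.sing, h₁.empt, h₁.sless, h₂.sing, h₂.empt, h₂.sless]

end SameRelations

/-- The composition theorem for binary sums, for tuples with an arbitrary index type. -/
theorem Th_sumTuple_eq {C : Type u} {C' : Type v} {D : Type u'} {D' : Type v'}
    [LinearOrder C] [LinearOrder C'] [LinearOrder D] [LinearOrder D'] (m : ℕ) {α : Type}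
    {A : α → Set C} {A' : α → Set C'} {B : α → Set D} {B' : α → Set D'}
    (h₁ : Th m A = Th m A') (h₂ : Th m B = Th m B') :
    Th m (sumTuple A B) = Th m (sumTuple A' B') := by
  induction m generalizing α with
  | zero => exact ((Th_zero_eq_iff.1 h₁).sumTuple (Th_zero_eq_iff.1 h₂)).Th_zero_eq
  | succ m ih =>
    apply Set.Subset.antisymm
    · rintro _ ⟨Z, rfl⟩
      obtain ⟨X, hX⟩ := (Set.Subset.antisymm_iff.1 h₁).1 ⟨Sum.inlₗ ⁻¹' Z, rfl⟩
      obtain ⟨Y, hY⟩ := (Set.Subset.antisymm_iff.1 h₂).1 ⟨Sum.inrₗ ⁻¹' Z, rfl⟩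
      exact ⟨_, by rw [option_elim_sumTuple, ih hX hY, sumTuple_option_elim]⟩
    · rintro _ ⟨Z, rfl⟩
      obtain ⟨X, hX⟩ := (Set.Subset.antisymm_iff.1 h₁).2 ⟨Sum.inlₗ ⁻¹' Z, rfl⟩
      obtain ⟨Y, hY⟩ := (Set.Subset.antisymm_iff.1 h₂).2 ⟨Sum.inrₗ ⁻¹' Z, rfl⟩
      exact ⟨_, by rw [option_elim_sumTuple, ← ih hX.symm hY.symm, sumTuple_option_elim]⟩

/-- **Composition theorem for binary sums**: equality of the level-`m` partial theories
of the summands (with tuples) implies equality of the level-`m` partial theories of the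
sums with the coordinatewise-union tuples. -/
theorem composition_theorem_binary {C : Type u} {C' : Type v} {D : Type u'} {D' : Type v'}
    [LinearOrder C] [LinearOrder C'] [LinearOrder D] [LinearOrder D'] (m l : ℕ)
    (A : Fin l → Set C) (A' : Fin l → Set C') (B : Fin l → Set D) (B' : Fin l → Set D')
    (h₁ : Th m A = Th m A') (h₂ : Th m B = Th m B') :
    Th m (sumTuple A B) = Th m (sumTuple A' B') := by
  exact Th_sumTuple_eq m h₁ h₂
end

section
/- Composition theorem for indexed sums: if I is a chain and for each i ∈ I, C_i and D_i are chains with tuples Ā^i ⊆ C_i and B̄^i ⊆ D_i (all tuples of subsets of the same length) satisfying Th^m(C_i;Ā^i) = Th^m(D_i;B̄^i), then Th^m(Σ_{i∈I} C_i; ∪_i Ā^i) = Th^m(Σ_{i∈I} D_i; ∪_i B̄^i). -/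
open FirstOrder

universe u v w u' v'

variable {C : Type u} [LinearOrder C] {V : Type v} {d : ℕ}

open FirstOrder.Language in
/-- Terms of the (relational) monadic language without bound variables are variables. -/
theorem exists_eq_var_of_monLang_term {α : Type} (t : monLang.Term (α ⊕ Fin 0)) :
    ∃ a : α, t = Term.var (Sum.inl a) := by
  cases t with
  | var x =>
    rcases x with a | i
    · exact ⟨a, rfl⟩
    · exact i.elim0
  | func f _ => exact Empty.elim f

/-- Two tuples satisfy the same atomic monadic relations. -/
structure SameMonAtoms {C : Type u} {D : Type v} [LinearOrder C] [LinearOrder D] {α : Type}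
    (A : α → Set C) (B : α → Set D) : Prop where
  sing : ∀ a, (∃ x, A a = {x}) ↔ ∃ x, B a = {x}
  empt : ∀ a, A a = ∅ ↔ B a = ∅
  subset : ∀ a b, A a ⊆ A b ↔ B a ⊆ B b
  sless : ∀ a b, (∃ x y, A a = {x} ∧ A b = {y} ∧ x < y) ↔ ∃ x y, B a = {x} ∧ B b = {y} ∧ x < y

open FirstOrder.Language in
/-- Tuples have the same level-`0` theory iff they satisfy the same atomic relations. -/
theorem th_zero_eq_iff {C : Type u} {D : Type v} [LinearOrder C] [LinearOrder D] {α : Type}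
    (A : α → Set C) (B : α → Set D) :
    Th 0 A = Th 0 B ↔ SameMonAtoms A B := by
  constructor
  · intro h
    have key : ∀ {n : ℕ} (R : MonRel n) (a : Fin n → α),
        Structure.RelMap (L := monLang) R (fun i => A (a i)) ↔
          Structure.RelMap (L := monLang) R (fun i => B (a i)) := by
      intro n R a
      have hφ := Set.ext_iff.1 h (Relations.formula (L := monLang) R fun i => Term.var (a i))
      have hq : (Relations.formula (L := monLang) R fun i => Term.var (a i)).IsQF :=
        (BoundedFormula.IsAtomic.rel _ _).isQF
      have hA := Formula.realize_rel (L := monLang) (R := R) (ts := fun i => Term.var (a i)) (v := A)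
      have hB := Formula.realize_rel (L := monLang) (R := R) (ts := fun i => Term.var (a i)) (v := B)
      exact hA.symm.trans <| Iff.trans
        ⟨fun h' => (hφ.1 ⟨hq, h'⟩).2, fun h' => (hφ.2 ⟨hq, h'⟩).2⟩ hB
    exact ⟨fun a => key .sing ![a], fun a => key .empt ![a], fun a b => key .subset ![a, b],
      fun a b => key .sless ![a, b]⟩
  · intro h
    refine Set.ext fun φ => and_congr_right fun hφ => ?_
    unfold Formula.Realize
    induction hφ with
    | falsum => exact Iff.rfl
    | of_isAtomic ha =>
      cases ha with
      | equal t₁ t₂ =>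
        obtain ⟨a, rfl⟩ := exists_eq_var_of_monLang_term t₁
        obtain ⟨b, rfl⟩ := exists_eq_var_of_monLang_term t₂
        simp only [BoundedFormula.realize_bdEqual, Term.realize_var, Sum.elim_inl,
          Set.Subset.antisymm_iff, h.subset]
      | rel R ts =>
        choose a ha using fun i => exists_eq_var_of_monLang_term (ts i)
        simp only [BoundedFormula.realize_rel, ha, Term.realize_var, Sum.elim_inl]
        cases R with
        | sing => exact h.sing _
        | empt => exact h.empt _
        | subset => exact h.subset _ _
        | sless => exact h.sless _ _
    | imp _ _ ih₁ ih₂ =>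
      rw [BoundedFormula.realize_imp, BoundedFormula.realize_imp, ih₁, ih₂]

section SigmaTuple

variable {ι : Type w} {Cc : ι → Type u} {α : Type}

theorem sigmaTuple_eq_empty_iff (A : (i : ι) → α → Set (Cc i)) (a : α) :
    sigmaTuple A a = ∅ ↔ ∀ i, A i a = ∅ := by
  simp only [Set.eq_empty_iff_forall_notMem]
  exact ⟨fun h i x => h (toLex ⟨i, x⟩), fun h x => h _ _⟩

theorem sigmaTuple_subset_iff (A : (i : ι) → α → Set (Cc i)) (a b : α) :
    sigmaTuple A a ⊆ sigmaTuple A b ↔ ∀ i, A i a ⊆ A i b :=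
  ⟨fun h i x hx => @h (toLex ⟨i, x⟩) hx, fun h _ hx => h _ hx⟩

theorem sigmaTuple_eq_singleton_iff (A : (i : ι) → α → Set (Cc i)) (a : α) (i : ι) (x : Cc i) :
    sigmaTuple A a = {toLex ⟨i, x⟩} ↔ A i a = {x} ∧ ∀ j, j ≠ i → A j a = ∅ := by
  constructor
  · intro h
    have h' : ∀ (j : ι) (y : Cc j), y ∈ A j a ↔ (⟨j, y⟩ : Σ i, Cc i) = ⟨i, x⟩ := fun j y =>
      Set.ext_iff.1 h (toLex ⟨j, y⟩)
    refine ⟨Set.ext fun y => (h' i y).trans (by simp), fun j hj => ?_⟩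
    refine Set.eq_empty_of_forall_notMem fun y hy => hj ?_
    exact congrArg Sigma.fst ((h' j y).1 hy)
  · rintro ⟨hi, hj⟩
    refine Set.ext fun ⟨j, y⟩ => ?_
    change y ∈ A j a ↔ (⟨j, y⟩ : Σ i, Cc i) = ⟨i, x⟩
    by_cases hji : j = i
    · subst hji
      simp [hi]
    · simp [hj j hji, hji]

theorem exists_sigmaTuple_eq_singleton_iff (A : (i : ι) → α → Set (Cc i)) (a : α) :
    (∃ p, sigmaTuple A a = {p}) ↔ ∃ i, (∃ x, A i a = {x}) ∧ ∀ j, j ≠ i → A j a = ∅ := by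
  constructor
  · rintro ⟨⟨i, x⟩, h⟩
    obtain ⟨h₁, h₂⟩ := (sigmaTuple_eq_singleton_iff A a i x).1 h
    exact ⟨i, ⟨x, h₁⟩, h₂⟩
  · rintro ⟨i, ⟨x, h₁⟩, h₂⟩
    exact ⟨_, (sigmaTuple_eq_singleton_iff A a i x).2 ⟨h₁, h₂⟩⟩

theorem exists_sigmaTuple_eq_singleton_lt_iff [LinearOrder ι] [∀ i, LinearOrder (Cc i)]
    (A : (i : ι) → α → Set (Cc i)) (a b : α) :
    (∃ p q, sigmaTuple A a = {p} ∧ sigmaTuple A b = {q} ∧ p < q) ↔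
      ∃ i j, (∀ k, k ≠ i → A k a = ∅) ∧ (∀ k, k ≠ j → A k b = ∅) ∧
        ((i < j ∧ (∃ x, A i a = {x}) ∧ ∃ y, A j b = {y}) ∨
          (i = j ∧ ∃ x y, A i a = {x} ∧ A i b = {y} ∧ x < y)) := by
  constructor
  · rintro ⟨⟨i, x⟩, ⟨j, y⟩, hp, hq, hlt⟩
    obtain ⟨hx, hi⟩ := (sigmaTuple_eq_singleton_iff A a i x).1 hp
    obtain ⟨hy, hj⟩ := (sigmaTuple_eq_singleton_iff A b j y).1 hq
    refine ⟨i, j, hi, hj, ?_⟩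
    rcases Sigma.Lex.lt_def.1 hlt with hij | ⟨hij, hxy⟩
    · exact Or.inl ⟨hij, ⟨x, hx⟩, ⟨y, hy⟩⟩
    · change i = j at hij
      subst hij
      exact Or.inr ⟨rfl, x, y, hx, hy, hxy⟩
  · rintro ⟨i, j, hi, hj, ⟨hij, ⟨x, hx⟩, ⟨y, hy⟩⟩ | ⟨rfl, x, y, hx, hy, hxy⟩⟩
    · exact ⟨_, _, (sigmaTuple_eq_singleton_iff A a i x).2 ⟨hx, hi⟩,
        (sigmaTuple_eq_singleton_iff A b j y).2 ⟨hy, hj⟩, Sigma.Lex.lt_def.2 (Or.inl hij)⟩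
    · exact ⟨_, _, (sigmaTuple_eq_singleton_iff A a i x).2 ⟨hx, hi⟩,
        (sigmaTuple_eq_singleton_iff A b i y).2 ⟨hy, hj⟩,
        Sigma.Lex.lt_def.2 (Or.inr ⟨rfl, hxy⟩)⟩

/-- Extending the union tuple by a set `X` amounts to extending each tuple by the trace
of `X` on the corresponding summand. -/
theorem elim_sigmaTuple (A : (i : ι) → α → Set (Cc i)) (X : Set (Σₗ i, Cc i)) :
    (fun o : Option α => o.elim X (sigmaTuple A)) =
      sigmaTuple fun i (o : Option α) => o.elim {x | toLex ⟨i, x⟩ ∈ X} (A i) := by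
  funext o
  cases o <;> rfl

end SigmaTuple

section Composition

variable {ι : Type w} [LinearOrder ι] {Cc : ι → Type u} {Dd : ι → Type v}
  [∀ i, LinearOrder (Cc i)] [∀ i, LinearOrder (Dd i)] {α : Type}

theorem SameMonAtoms.sigmaTuple {A : (i : ι) → α → Set (Cc i)} {B : (i : ι) → α → Set (Dd i)}
    (h : ∀ i, SameMonAtoms (A i) (B i)) : SameMonAtoms (sigmaTuple A) (sigmaTuple B) where
  sing a := by
    simp only [exists_sigmaTuple_eq_singleton_iff, (h _).sing, (h _).empt]
  empt a := by
    simp only [sigmaTuple_eq_empty_iff, (h _).empt]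
  subset a b := by
    simp only [sigmaTuple_subset_iff, (h _).subset]
  sless a b := by
    simp only [exists_sigmaTuple_eq_singleton_lt_iff, (h _).sing, (h _).empt, (h _).sless]

/-- Every level-`(m+1)` type of a sum is realized in any sum with equivalent summands,
provided level-`m` theories of sums are determined by those of the summands. -/
theorem th_succ_sigmaTuple_subset {m : ℕ} {A : (i : ι) → α → Set (Cc i)}
    {B : (i : ι) → α → Set (Dd i)}
    (ih : ∀ (A' : (i : ι) → Option α → Set (Cc i)) (B' : (i : ι) → Option α → Set (Dd i)),
      (∀ i, Th m (A' i) = Th m (B' i)) → Th m (sigmaTuple A') = Th m (sigmaTuple B'))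
    (h : ∀ i, Th (m + 1) (A i) = Th (m + 1) (B i)) (X : Set (Σₗ i, Cc i)) :
    ∃ Y : Set (Σₗ i, Dd i), Th m (fun o : Option α => o.elim X (sigmaTuple A)) =
      Th m (fun o : Option α => o.elim Y (sigmaTuple B)) := by
  have hY : ∀ i, ∃ Y : Set (Dd i),
      Th m (fun o : Option α => o.elim {x | toLex ⟨i, x⟩ ∈ X} (A i)) =
        Th m (fun o : Option α => o.elim Y (B i)) := fun i =>
    (Set.ext_iff.1 (h i) _).1 ⟨_, rfl⟩
  choose Y hY using hY
  refine ⟨{p | (ofLex p).2 ∈ Y (ofLex p).1}, ?_⟩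
  rw [elim_sigmaTuple, elim_sigmaTuple]
  exact ih _ _ hY

/-- The composition theorem for tuples indexed by an arbitrary type. -/
theorem th_sigmaTuple_congr (m : ℕ) {α : Type} (A : (i : ι) → α → Set (Cc i))
    (B : (i : ι) → α → Set (Dd i)) (h : ∀ i, Th m (A i) = Th m (B i)) :
    Th m (sigmaTuple A) = Th m (sigmaTuple B) := by
  induction m generalizing α with
  | zero =>
    exact (th_zero_eq_iff _ _).2 (.sigmaTuple fun i => (th_zero_eq_iff _ _).1 (h i))
  | succ m ih =>
    refine Set.ext fun t => ⟨?_, ?_⟩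
    · rintro ⟨X, rfl⟩
      exact th_succ_sigmaTuple_subset ih h X
    · rintro ⟨Y, rfl⟩
      exact th_succ_sigmaTuple_subset (fun A' B' h' => (ih B' A' fun i => (h' i).symm).symm)
        (fun i => (h i).symm) Y

end Composition

/-- **Composition theorem for indexed sums**: if `Th^m(C_i;Ā^i) = Th^m(D_i;B̄^i)` for all
`i` in the index chain `I`, then the concatenations `Σ_{i∈I} C_i` and `Σ_{i∈I} D_i` with
the union tuples have the same level-`m` partial theory. -/
theorem composition_theorem_indexed {ι : Type w} [LinearOrder ι]
    {Cc : ι → Type u} {Dd : ι → Type v}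
    [∀ i, LinearOrder (Cc i)] [∀ i, LinearOrder (Dd i)] (m l : ℕ)
    (A : (i : ι) → Fin l → Set (Cc i)) (B : (i : ι) → Fin l → Set (Dd i))
    (h : ∀ i, Th m (A i) = Th m (B i)) :
    Th m (sigmaTuple A) = Th m (sigmaTuple B) := by
  exact th_sigmaTuple_congr m A B h
end

section
/- Preservation theorem: let λ > ℵ₀ be a regular cardinal, let P̄₀, P̄₁ be length-l tuples of subsets of λ, and let n < ω. Then there are m = m(n,l) < ω, depending only on n and l, and a club J ⊆ λ, depending on n, P̄₀, P̄₁, such that for every semi-club a ⊆ λ, setting X̄ := [P̄₀,P̄₁]^J_a: (*) if a-Th^m(λ;P̄₀) = a-Th^m(λ;P̄₁) then Th^n(λ;P̄₀) = Th^n(λ;P̄₁) = Th^n(λ;X̄); moreover there is t* ∈ T_{n,l}, depending only on P̄₀ and P̄₁, such that for every γ ∈ J with cf(γ) = ℵ₀: (**) if a-Th^m(λ;P̄₀) = a-Th^m(λ;P̄₁) then Th^n(λ;P̄₀)↾[0,γ) = Th^n(λ;P̄₁)↾[0,γ) = Th^n(λ;X̄)↾[0,γ) = t*. -/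
open FirstOrder

universe u v w u' v'

variable {C : Type u} [LinearOrder C] {V : Type v} {d : ℕ}

namespace MonadicShuffle

/-! ### Combinatorial types -/

/-- Combinatorial counterpart of `TheoryType`: at level `0`, the profiles of points together with
the profiles of increasing pairs of points. -/
def Ty : ℕ → Type → Type
  | 0, ι => Set (Set ι) × Set (Set ι × Set ι)
  | n + 1, ι => Set (Ty n (Option ι))

instance Ty.instFinite : ∀ (n : ℕ) (ι : Type) [Finite ι], Finite (Ty n ι)
  | 0, ι, _ => inferInstanceAs (Finite (Set (Set ι) × Set (Set ι × Set ι)))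
  | n + 1, ι, _ => by
    have := Ty.instFinite n (Option ι)
    exact inferInstanceAs (Finite (Set (Ty n (Option ι))))

section Types

variable {X : Type*} {ι κ : Type}

/-- The set of indices `i` with `x ∈ A i`. -/
def prof (A : ι → Set X) (x : X) : Set ι := {i | x ∈ A i}

/-- The tuple `A` extended by the set `B`. -/
def extend (A : ι → Set X) (B : Set X) : Option ι → Set X := fun o => o.elim B A

/-- The tuple of sets defined from `A` by the conditions `φ` on profiles. -/
def pull (φ : κ → Set (Set ι)) (A : ι → Set X) : κ → Set X := fun j => {x | prof A x ∈ φ j}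

/-- The tuple of colour classes inside `b` of the colouring `c`. -/
def col (c : X → κ) (b : Set X) : κ → Set X := fun k => {x | x ∈ b ∧ c x = k}

/-- The combinatorial `n`-type of the tuple `A` restricted to the subset `D` of a chain. -/
def ty [LinearOrder X] : (n : ℕ) → {ι : Type} → Set X → (ι → Set X) → Ty n ι
  | 0, _, D, A => (prof A '' D, {p | ∃ x ∈ D, ∃ y ∈ D, x < y ∧ p = (prof A x, prof A y)})
  | n + 1, _, D, A => {t | ∃ B : Set X, t = ty n D (extend A B)}

lemma prof_eq_iff {A A' : ι → Set X} {x x' : X} :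
    prof A x = prof A' x' ↔ ∀ i, x ∈ A i ↔ x' ∈ A' i := Set.ext_iff

lemma mem_iff_of_prof {A A' : ι → Set X} {x x' : X} (h : prof A x = prof A' x') (i : ι) :
    x ∈ A i ↔ x' ∈ A' i := prof_eq_iff.1 h i

@[simp] lemma extend_none (A : ι → Set X) (B : Set X) : extend A B none = B := rfl

@[simp] lemma extend_some (A : ι → Set X) (B : Set X) (i : ι) : extend A B (some i) = A i := rfl

lemma extend_pull (φ : κ → Set (Set ι)) (A : ι → Set X) (B : Set X) :
    extend (pull φ A) B =
      pull (fun o => o.elim {s | none ∈ s} (fun j => {s | some ⁻¹' s ∈ φ j})) (extend A B) := by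
  funext o
  cases o <;> rfl

variable [LinearOrder X] {D D' : Set X} {A A' : ι → Set X} {n : ℕ}

lemma ty_zero_eq_iff : ty 0 D A = ty 0 D' A' ↔
    ((∀ x ∈ D, ∃ x' ∈ D', prof A x = prof A' x') ∧
      (∀ x ∈ D, ∀ y ∈ D, x < y → ∃ x' ∈ D', ∃ y' ∈ D', x' < y' ∧
        prof A x = prof A' x' ∧ prof A y = prof A' y')) ∧
    ((∀ x' ∈ D', ∃ x ∈ D, prof A' x' = prof A x) ∧
      (∀ x' ∈ D', ∀ y' ∈ D', x' < y' → ∃ x ∈ D, ∃ y ∈ D, x < y ∧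
        prof A' x' = prof A x ∧ prof A' y' = prof A y)) := by
  constructor
  · intro h
    have h1 : prof A '' D = prof A' '' D' := congrArg Prod.fst h
    have h2 := congrArg Prod.snd h
    simp only [ty] at h2
    refine ⟨⟨fun x hx => ?_, fun x hx y hy hxy => ?_⟩, fun x hx => ?_, fun x hx y hy hxy => ?_⟩
    · obtain ⟨x', h, h'⟩ := h1 ▸ Set.mem_image_of_mem (prof A) hx
      exact ⟨x', h, h'.symm⟩
    · have : (prof A x, prof A y) ∈ {p | ∃ x ∈ D, ∃ y ∈ D, x < y ∧ p = (prof A x, prof A y)} :=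
        ⟨x, hx, y, hy, hxy, rfl⟩
      rw [h2] at this
      obtain ⟨x', hx', y', hy', h, e⟩ := this
      simp only [Prod.mk.injEq] at e
      exact ⟨x', hx', y', hy', h, e⟩
    · obtain ⟨x', h, h'⟩ := h1.symm ▸ Set.mem_image_of_mem (prof A') hx
      exact ⟨x', h, h'.symm⟩
    · have : (prof A' x, prof A' y) ∈
          {p | ∃ x ∈ D', ∃ y ∈ D', x < y ∧ p = (prof A' x, prof A' y)} :=
        ⟨x, hx, y, hy, hxy, rfl⟩
      rw [← h2] at this
      obtain ⟨x', hx', y', hy', h, e⟩ := this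
      simp only [Prod.mk.injEq] at e
      exact ⟨x', hx', y', hy', h, e⟩
  · rintro ⟨⟨h1, h2⟩, h3, h4⟩
    refine Prod.ext (Set.Subset.antisymm ?_ ?_) (Set.Subset.antisymm ?_ ?_)
    · rintro _ ⟨x, hx, rfl⟩
      obtain ⟨x', hx', e⟩ := h1 x hx
      exact ⟨x', hx', e.symm⟩
    · rintro _ ⟨x, hx, rfl⟩
      obtain ⟨x', hx', e⟩ := h3 x hx
      exact ⟨x', hx', e.symm⟩
    · rintro _ ⟨x, hx, y, hy, hxy, rfl⟩
      obtain ⟨x', hx', y', hy', h, e, e'⟩ := h2 x hx y hy hxy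
      exact ⟨x', hx', y', hy', h, Prod.ext e e'⟩
    · rintro _ ⟨x, hx, y, hy, hxy, rfl⟩
      obtain ⟨x', hx', y', hy', h, e, e'⟩ := h4 x hx y hy hxy
      exact ⟨x', hx', y', hy', h, Prod.ext e e'⟩

lemma ty_succ_eq_iff : ty (n + 1) D A = ty (n + 1) D' A' ↔
    (∀ B, ∃ B', ty n D (extend A B) = ty n D' (extend A' B')) ∧
    (∀ B', ∃ B, ty n D' (extend A' B') = ty n D (extend A B)) := by
  constructor
  · intro h
    have h : {t | ∃ B : Set X, t = ty n D (extend A B)} =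
      {t | ∃ B : Set X, t = ty n D' (extend A' B)} := h
    constructor
    · intro B
      exact (h ▸ ⟨B, rfl⟩ : ty n D (extend A B) ∈ {t | ∃ B : Set X, t = ty n D' (extend A' B)})
    · intro B
      exact (h ▸ ⟨B, rfl⟩ : ty n D' (extend A' B) ∈ {t | ∃ B : Set X, t = ty n D (extend A B)})
  · rintro ⟨h1, h2⟩
    apply Set.Subset.antisymm
    · rintro _ ⟨B, rfl⟩
      exact h1 B
    · rintro _ ⟨B, rfl⟩
      exact h2 B

lemma ty_congr (h : ∀ i, ∀ x ∈ D, x ∈ A i ↔ x ∈ A' i) : ty n D A = ty n D A' := by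
  induction n generalizing ι with
  | zero =>
    have h' : ∀ x ∈ D, prof A x = prof A' x := fun x hx => prof_eq_iff.2 fun i => h i x hx
    have h'' : ∀ x ∈ D, prof A' x = prof A x := fun x hx => (h' x hx).symm
    exact ty_zero_eq_iff.2 ⟨⟨fun x hx => ⟨x, hx, h' x hx⟩,
      fun x hx y hy hxy => ⟨x, hx, y, hy, hxy, h' x hx, h' y hy⟩⟩, fun x hx => ⟨x, hx, h'' x hx⟩,
      fun x hx y hy hxy => ⟨x, hx, y, hy, hxy, h'' x hx, h'' y hy⟩⟩
  | succ n ih =>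
    have key : ∀ B : Set X, ∀ i, ∀ x ∈ D, x ∈ extend A B i ↔ x ∈ extend A' B i := by
      rintro B (_ | i) x hx
      · rfl
      · exact h i x hx
    exact ty_succ_eq_iff.2 ⟨fun B => ⟨B, ih (key B)⟩, fun B => ⟨B, (ih (key B)).symm⟩⟩

lemma ty_pull (φ : κ → Set (Set ι)) (h : ty n D A = ty n D' A') :
    ty n D (pull φ A) = ty n D' (pull φ A') := by
  induction n generalizing ι κ with
  | zero =>
    have key : ∀ {A A' : ι → Set X} {x x' : X}, prof A x = prof A' x' →
        prof (pull φ A) x = prof (pull φ A') x' := by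
      intro A A' x x' e
      simp [prof_eq_iff, pull, e]
    rw [ty_zero_eq_iff] at h ⊢
    obtain ⟨⟨h1, h2⟩, h3, h4⟩ := h
    refine ⟨⟨fun x hx => ?_, fun x hx y hy hxy => ?_⟩, fun x hx => ?_, fun x hx y hy hxy => ?_⟩
    · obtain ⟨x', hx', e⟩ := h1 x hx
      exact ⟨x', hx', key e⟩
    · obtain ⟨x', hx', y', hy', h, e, e'⟩ := h2 x hx y hy hxy
      exact ⟨x', hx', y', hy', h, key e, key e'⟩
    · obtain ⟨x', hx', e⟩ := h3 x hx
      exact ⟨x', hx', key e⟩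
    · obtain ⟨x', hx', y', hy', h, e, e'⟩ := h4 x hx y hy hxy
      exact ⟨x', hx', y', hy', h, key e, key e'⟩
  | succ n ih =>
    rw [ty_succ_eq_iff] at h ⊢
    refine ⟨fun B => ?_, fun B => ?_⟩
    · obtain ⟨B', e⟩ := h.1 B
      refine ⟨B', ?_⟩
      rw [extend_pull, extend_pull]
      exact ih _ e
    · obtain ⟨B', e⟩ := h.2 B
      refine ⟨B', ?_⟩
      rw [extend_pull, extend_pull]
      exact (ih _ e.symm).symm

lemma ty_reindex (e : κ → ι) (h : ty n D A = ty n D' A') :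
    ty n D (A ∘ e) = ty n D' (A' ∘ e) :=
  ty_pull (fun j => {s | e j ∈ s}) h

lemma ty_restrict (ψ : Set (Set ι)) (h : ty n D A = ty n D' A') :
    ty n {x ∈ D | prof A x ∈ ψ} A = ty n {x ∈ D' | prof A' x ∈ ψ} A' := by
  induction n generalizing ι with
  | zero =>
    rw [ty_zero_eq_iff] at h ⊢
    obtain ⟨⟨h1, h2⟩, h3, h4⟩ := h
    refine ⟨⟨?_, ?_⟩, ?_, ?_⟩
    · rintro x ⟨hx, px⟩
      obtain ⟨x', hx', e⟩ := h1 x hx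
      exact ⟨x', ⟨hx', e ▸ px⟩, e⟩
    · rintro x ⟨hx, px⟩ y ⟨hy, py⟩ hxy
      obtain ⟨x', hx', y', hy', h, e, e'⟩ := h2 x hx y hy hxy
      exact ⟨x', ⟨hx', e ▸ px⟩, y', ⟨hy', e' ▸ py⟩, h, e, e'⟩
    · rintro x ⟨hx, px⟩
      obtain ⟨x', hx', e⟩ := h3 x hx
      exact ⟨x', ⟨hx', e ▸ px⟩, e⟩
    · rintro x ⟨hx, px⟩ y ⟨hy, py⟩ hxy
      obtain ⟨x', hx', y', hy', h, e, e'⟩ := h4 x hx y hy hxy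
      exact ⟨x', ⟨hx', e ▸ px⟩, y', ⟨hy', e' ▸ py⟩, h, e, e'⟩
  | succ n ih =>
    rw [ty_succ_eq_iff] at h ⊢
    refine ⟨fun B => ?_, fun B => ?_⟩
    · obtain ⟨B', e⟩ := h.1 B
      exact ⟨B', ih {s | some ⁻¹' s ∈ ψ} e⟩
    · obtain ⟨B', e⟩ := h.2 B
      exact ⟨B', (ih {s | some ⁻¹' s ∈ ψ} e.symm).symm⟩

lemma ty_of_succ (h : ty (n + 1) D A = ty (n + 1) D' A') : ty n D A = ty n D' A' := by
  obtain ⟨B', e⟩ := (ty_succ_eq_iff.1 h).1 ∅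
  exact ty_reindex some e

lemma ty_of_le {m : ℕ} (hm : n ≤ m) (h : ty m D A = ty m D' A') : ty n D A = ty n D' A' := by
  induction m, hm using Nat.le_induction with
  | base => exact h
  | succ m _ ih => exact ih (ty_of_succ h)

lemma exists_prof_eq (h : ty n D A = ty n D' A') {x : X} (hx : x ∈ D) :
    ∃ x' ∈ D', prof A x = prof A' x' :=
  (ty_zero_eq_iff.1 (ty_of_le n.zero_le h)).1.1 x hx

lemma exists_prof_pair_eq (h : ty n D A = ty n D' A') {x y : X} (hx : x ∈ D) (hy : y ∈ D)
    (hxy : x < y) :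
    ∃ x' ∈ D', ∃ y' ∈ D', x' < y' ∧ prof A x = prof A' x' ∧ prof A y = prof A' y' :=
  (ty_zero_eq_iff.1 (ty_of_le n.zero_le h)).1.2 x hx y hy hxy

lemma exists_set (h : ty (n + 1) D A = ty (n + 1) D' A') (B : Set X) :
    ∃ B' ⊆ D', ty n D (extend A B) = ty n D' (extend A' B') := by
  obtain ⟨B', e⟩ := (ty_succ_eq_iff.1 h).1 B
  refine ⟨B' ∩ D', Set.inter_subset_right, e.trans (ty_congr ?_)⟩
  rintro (_ | i) x hx <;> simp [hx]

lemma exists_point (h : ty (n + 1) D A = ty (n + 1) D' A') {x : X} (hx : x ∈ D) :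
    ∃ x' ∈ D', ty n D (extend A {x}) = ty n D' (extend A' {x'}) := by
  obtain ⟨B', hB', e⟩ := exists_set h {x}
  obtain ⟨x', hx', p⟩ := exists_prof_eq e hx
  have hx'B : x' ∈ B' := (mem_iff_of_prof p none).1 rfl
  suffices B' = {x'} from ⟨x', hx', this ▸ e⟩
  have lt : ∀ y ∈ B', ∀ z ∈ B', ¬ y < z := by
    intro y hy z hz hyz
    obtain ⟨u, _, v, _, huv, pu, pv⟩ := exists_prof_pair_eq e.symm (hB' hy) (hB' hz) hyz
    have hu : u = x := (mem_iff_of_prof pu none).1 hy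
    have hv : v = x := (mem_iff_of_prof pv none).1 hz
    exact absurd huv (by simp [hu, hv])
  ext y
  constructor
  · intro hy
    exact le_antisymm (not_lt.1 (lt _ hx'B _ hy)) (not_lt.1 (lt _ hy _ hx'B))
  · rintro rfl
    exact hx'B

lemma prof_eq_of_point (h : ty n D A = ty n D' A') {i : ι} {x x' : X} (hx : x ∈ D)
    (hi : A i = {x}) (hi' : A' i = {x'}) : prof A x = prof A' x' := by
  obtain ⟨y, _, e⟩ := exists_prof_eq h hx
  have : y = x' := by
    have := (mem_iff_of_prof e i).1 (by simp [hi])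
    simpa [hi'] using this
  exact this ▸ e

lemma lt_of_points (h : ty n D A = ty n D' A') {i j : ι} {x x' y y' : X} (hx : x ∈ D) (hy : y ∈ D)
    (hi : A i = {x}) (hi' : A' i = {x'}) (hj : A j = {y}) (hj' : A' j = {y'}) (hxy : x < y) :
    x' < y' := by
  obtain ⟨u, _, v, _, huv, e, e'⟩ := exists_prof_pair_eq h hx hy hxy
  have hu := (mem_iff_of_prof e i).1 (by simp [hi])
  have hv := (mem_iff_of_prof e' j).1 (by simp [hj])
  simp only [hi', hj', Set.mem_singleton_iff] at hu hv
  exact hu ▸ hv ▸ huv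

lemma ty_cut (h : ty (n + 1) D A = ty (n + 1) D' A') {i : ι} {x x' : X}
    (hx' : x' ∈ D') (hi : A i = {x}) (hi' : A' i = {x'}) :
    ty n (D ∩ Set.Iio x) A = ty n (D' ∩ Set.Iio x') A' ∧
      ty n (D ∩ Set.Ici x) A = ty n (D' ∩ Set.Ici x') A' := by
  obtain ⟨B', hB', e⟩ := exists_set h (D ∩ Set.Iio x)
  have key : ∀ y ∈ D', y ∈ B' ↔ y < x' := by
    intro y hy
    constructor
    · intro hyB
      by_contra hlt
      rcases (not_lt.1 hlt).eq_or_lt with rfl | hlt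
      · obtain ⟨u, _, p⟩ := exists_prof_eq e.symm hy
        have h1 := (mem_iff_of_prof p none).1 hyB
        have h2 := (mem_iff_of_prof p (some i)).1 (by simp [hi'])
        simp only [extend_some, hi, Set.mem_singleton_iff] at h2
        exact absurd h1.2 (by simp [h2])
      · obtain ⟨u, _, v, _, huv, p, q⟩ := exists_prof_pair_eq e.symm hx' hy hlt
        have h1 := (mem_iff_of_prof q none).1 hyB
        have h2 := (mem_iff_of_prof p (some i)).1 (by simp [hi'])
        simp only [extend_some, hi, Set.mem_singleton_iff] at h2
        exact absurd (huv.trans h1.2) (by simp [h2])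
    · intro hlt
      by_contra hyB
      obtain ⟨u, hu, v, _, huv, p, q⟩ := exists_prof_pair_eq e.symm hy hx' hlt
      have h2 := (mem_iff_of_prof q (some i)).1 (by simp [hi'])
      simp only [extend_some, hi, Set.mem_singleton_iff] at h2
      exact hyB ((mem_iff_of_prof p none).2 ⟨hu, h2 ▸ huv⟩)
  constructor
  · have h1 : {y ∈ D | prof (extend A (D ∩ Set.Iio x)) y ∈ {s | none ∈ s}} = D ∩ Set.Iio x := by
      ext y
      exact ⟨fun h => h.2, fun h => ⟨h.1, h⟩⟩
    have h2 : {y ∈ D' | prof (extend A' B') y ∈ {s | none ∈ s}} = D' ∩ Set.Iio x' := by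
      ext y
      exact and_congr_right fun hy => key y hy
    have := ty_reindex some (ty_restrict {s | none ∈ s} e)
    rwa [h1, h2] at this
  · have h1 : {y ∈ D | prof (extend A (D ∩ Set.Iio x)) y ∈ {s | none ∉ s}} = D ∩ Set.Ici x := by
      ext y
      refine and_congr_right fun hy => ?_
      change ¬ (y ∈ D ∧ y < x) ↔ x ≤ y
      simp [hy]
    have h2 : {y ∈ D' | prof (extend A' B') y ∈ {s | none ∉ s}} = D' ∩ Set.Ici x' := by
      ext y
      exact and_congr_right fun hy => (not_congr (key y hy)).trans not_lt
    have := ty_reindex some (ty_restrict {s | none ∉ s} e)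
    rwa [h1, h2] at this

lemma exists_tuple [Finite κ] (h : ty (n + Nat.card κ) D A = ty (n + Nat.card κ) D' A')
    (B : κ → Set X) :
    ∃ B' : κ → Set X, ty n D (Sum.elim A B) = ty n D' (Sum.elim A' B') := by
  revert ι
  induction κ using Finite.induction_empty_option with
  | of_equiv e ih =>
    intro ι A A' h
    rw [← Nat.card_congr e] at h
    obtain ⟨B', hB'⟩ := ih (B ∘ e) h
    refine ⟨B' ∘ e.symm, ?_⟩
    have := ty_reindex (Sum.map id e.symm) hB'
    convert this using 2
    · ext (i | k) <;> simp
    · ext (i | k) <;> simp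
  | h_empty =>
    intro ι A A' h
    have := ty_reindex (Sum.elim id PEmpty.elim) (ty_of_le (Nat.le_add_right n _) h)
    refine ⟨fun k => k.elim, ?_⟩
    convert this using 2
    · ext (i | k) x
      · rfl
      · exact k.elim
    · ext (i | k) x
      · rfl
      · exact k.elim
  | @h_option κ _ ih =>
    intro ι A A' h
    rw [Finite.card_option, ← Nat.add_assoc] at h
    obtain ⟨B₀, _, e⟩ := exists_set h (B none)
    obtain ⟨B', hB'⟩ := ih (B ∘ some) e
    refine ⟨fun o => o.elim B₀ B', ?_⟩
    have := ty_reindex (Sum.elim (fun i => Sum.inl (some i))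
      (fun o : Option κ => o.elim (Sum.inl none) Sum.inr)) hB'
    convert this using 2
    · ext (i | _ | k) x <;> rfl
    · ext (i | _ | k) x <;> rfl

lemma exists_coloring [Finite κ] (h : ty (n + Nat.card κ) D A = ty (n + Nat.card κ) D' A')
    (c : X → κ) :
    ∃ c' : X → κ, ty n D (Sum.elim A (col c Set.univ)) = ty n D' (Sum.elim A' (col c' Set.univ)) := by
  obtain ⟨B, hB⟩ := exists_tuple h (col c Set.univ)
  have key : ∀ x ∈ D', ∃ k, ∀ k', x ∈ B k' ↔ k = k' := by
    intro x hx
    obtain ⟨y, _, e⟩ := exists_prof_eq hB.symm hx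
    refine ⟨c y, fun k' => (mem_iff_of_prof e (Sum.inr k')).trans ?_⟩
    simp [col]
  classical
  have key' : ∀ x, ∃ k, x ∈ D' → ∀ k', x ∈ B k' ↔ k = k' := fun x =>
    if hx : x ∈ D' then (key x hx).imp fun _ hk _ => hk else ⟨c x, fun h => absurd h hx⟩
  choose d hd using key'
  refine ⟨d, hB.trans (ty_congr ?_)⟩
  rintro (i | k) x hx
  · rfl
  · simp [col, hd x hx k]

end Types

section Colourings

variable {X : Type*} [LinearOrder X] {κ κ' : Type} {D D' b b' : Set X} {c d : X → κ} {n : ℕ}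

lemma exists_col [Finite κ']
    (h : ty (n + Nat.card κ') D (col c b) = ty (n + Nat.card κ') D' (col d b')) (c' : X → κ') :
    ∃ d' : X → κ', ty n D (col (fun x => (c x, c' x)) b) = ty n D' (col (fun x => (d x, d' x)) b') := by
  obtain ⟨d', hd'⟩ := exists_coloring h c'
  refine ⟨d', ?_⟩
  have := ty_pull (fun k : κ × κ' => {s | Sum.inl k.1 ∈ s ∧ Sum.inr k.2 ∈ s}) hd'
  convert this using 2
  · ext ⟨k, k'⟩ x
    simp [pull, col, prof, and_assoc]
  · ext ⟨k, k'⟩ x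
    simp [pull, col, prof, and_assoc]

lemma ty_col_map (φ : κ → κ') (h : ty n D (col c b) = ty n D' (col d b')) :
    ty n D (col (φ ∘ c) b) = ty n D' (col (φ ∘ d) b') := by
  have := ty_pull (fun k' : κ' => {s | ∃ k ∈ s, φ k = k'}) h
  convert this using 2
  · ext k x
    simp [pull, col, prof, and_assoc]
  · ext k x
    simp [pull, col, prof, and_assoc]

lemma exists_same_col (h : ty n D (col c b) = ty n D' (col d b')) {x : X} (hx : x ∈ D)
    (hb : x ∈ b) : ∃ x' ∈ D', x' ∈ b' ∧ d x' = c x := by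
  obtain ⟨x', hx', e⟩ := exists_prof_eq h hx
  exact ⟨x', hx', (mem_iff_of_prof e (c x)).1 ⟨hb, rfl⟩⟩

end Colourings

section Sums

variable {I : Type*} [LinearOrder I] {X : Type*} [LinearOrder X] {ι : Type} {n : ℕ}

/-- The sum of the types `f i` along the chain `E`. -/
def lsum {I : Type*} [LinearOrder I] : (n : ℕ) → {ι : Type} → Set I → (I → Ty n ι) → Ty n ι
  | 0, _, E, f => ({s | ∃ i ∈ E, s ∈ (f i).1},
      {p | (∃ i ∈ E, p ∈ (f i).2) ∨
        ∃ i ∈ E, ∃ j ∈ E, i < j ∧ p.1 ∈ (f i).1 ∧ p.2 ∈ (f j).1})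
  | n + 1, ι, E, f => {t | ∃ g : I → Ty n (Option ι),
      (∀ i ∈ E, g i ∈ (show Set (Ty n (Option ι)) from f i)) ∧ t = lsum n E g}

lemma lsum_congr {E : Set I} {f g : I → Ty n ι} (h : ∀ i ∈ E, f i = g i) :
    lsum n E f = lsum n E g := by
  cases n with
  | zero =>
    refine Prod.ext ?_ ?_
    · ext s
      exact exists_congr fun i => and_congr_right fun hi => by rw [h i hi]
    · ext s
      exact or_congr (exists_congr fun i => and_congr_right fun hi => by rw [h i hi])
        (exists_congr fun i => and_congr_right fun hi => exists_congr fun j =>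
          and_congr_right fun hj => by rw [h i hi, h j hj])
  | succ n =>
    refine Set.ext fun t => exists_congr fun k => and_congr_left fun _ => forall_congr' fun i =>
      forall_congr' fun hi => ?_
    rw [h i hi]

lemma ty_biUnion {E : Set I} {D : I → Set X} (A : ι → Set X)
    (hD : ∀ i ∈ E, ∀ j ∈ E, i < j → ∀ x ∈ D i, ∀ y ∈ D j, x < y) :
    ty n (⋃ i ∈ E, D i) A = lsum n E (fun i => ty n (D i) A) := by
  induction n generalizing ι with
  | zero =>
    refine Prod.ext ?_ (Set.Subset.antisymm ?_ ?_)
    · ext s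
      simp only [ty, lsum, Set.mem_image, Set.mem_iUnion]
      constructor
      · rintro ⟨x, ⟨i, hi, hx⟩, rfl⟩
        exact ⟨i, hi, x, hx, rfl⟩
      · rintro ⟨i, hi, x, hx, rfl⟩
        exact ⟨x, ⟨i, hi, hx⟩, rfl⟩
    · rintro _ ⟨x, hx, y, hy, hxy, rfl⟩
      simp only [Set.mem_iUnion] at hx hy
      obtain ⟨i, hi, hx⟩ := hx
      obtain ⟨j, hj, hy⟩ := hy
      rcases lt_trichotomy i j with hij | rfl | hij
      · exact Or.inr ⟨i, hi, j, hj, hij, ⟨x, hx, rfl⟩, y, hy, rfl⟩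
      · exact Or.inl ⟨i, hi, x, hx, y, hy, hxy, rfl⟩
      · exact absurd hxy (hD j hj i hi hij y hy x hx).asymm
    · rintro ⟨p, q⟩ (⟨i, hi, x, hx, y, hy, hxy, e⟩ | ⟨i, hi, j, hj, hij, ⟨x, hx, rfl⟩, y, hy, rfl⟩)
      · exact ⟨x, Set.mem_biUnion hi hx, y, Set.mem_biUnion hi hy, hxy, e⟩
      · exact ⟨x, Set.mem_biUnion hi hx, y, Set.mem_biUnion hj hy, hD i hi j hj hij x hx y hy, rfl⟩
  | succ n ih =>
    apply Set.Subset.antisymm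
    · rintro _ ⟨B, rfl⟩
      exact ⟨fun i => ty n (D i) (extend A B), fun i _ => ⟨B, rfl⟩, ih _⟩
    · rintro _ ⟨g, hg, rfl⟩
      choose! B hB using hg
      refine ⟨⋃ i ∈ E, D i ∩ B i, ?_⟩
      rw [ih]
      refine lsum_congr fun i hi => (hB i hi).trans (ty_congr ?_)
      rintro (_ | k) x hx
      · simp only [extend_none, Set.mem_iUnion]
        refine ⟨fun h => ⟨i, hi, hx, h⟩, ?_⟩
        rintro ⟨j, hj, hx', h⟩
        rcases lt_trichotomy i j with hij | rfl | hij
        · exact absurd (hD i hi j hj hij x hx x hx') (lt_irrefl _)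
        · exact h
        · exact absurd (hD j hj i hi hij x hx' x hx) (lt_irrefl _)
      · rfl

/-- The sum of two types. -/
def add (s t : Ty n ι) : Ty n ι := lsum n Set.univ (fun b : Bool => cond b t s)

lemma ty_union {D D' : Set X} (A : ι → Set X) (h : ∀ x ∈ D, ∀ y ∈ D', x < y) :
    ty n (D ∪ D') A = add (ty n D A) (ty n D' A) := by
  have := ty_biUnion (n := n) (E := (Set.univ : Set Bool)) (D := fun b => cond b D' D) A (by
    rintro (_ | _) _ (_ | _) _ hij <;> first | exact absurd hij (by decide) | exact h)
  have e : (⋃ b ∈ (Set.univ : Set Bool), cond b D' D) = D ∪ D' := by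
    ext x
    simp
  rw [e] at this
  rw [this]
  exact lsum_congr fun b _ => by cases b <;> rfl

/-- Sums of types are determined by types of colourings. -/
lemma exists_lsum_eq (n : ℕ) : ∀ (ι : Type) [Finite ι], ∃ M : ℕ,
    ∀ {X : Type*} [LinearOrder X] (E E' : Set X) (f f' : X → Ty n ι),
      ty M E (col f Set.univ) = ty M E' (col f' Set.univ) → lsum n E f = lsum n E' f' := by
  induction n with
  | zero =>
    refine fun ι _ => ⟨0, fun {X} _ E E' f f' h => ?_⟩
    have key : ∀ {E E' : Set X} {f f' : X → Ty 0 ι},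
        ty 0 E (col f Set.univ) = ty 0 E' (col f' Set.univ) →
        (lsum 0 E f).1 ⊆ (lsum 0 E' f').1 ∧ (lsum 0 E f).2 ⊆ (lsum 0 E' f').2 := by
      intro E E' f f' h
      have h' : ∀ {x y : X}, prof (col f Set.univ) x = prof (col f' Set.univ) y → f x = f' y :=
        fun {x y} e => ((mem_iff_of_prof e (f x)).1 ⟨trivial, rfl⟩).2.symm
      refine ⟨?_, ?_⟩
      · rintro s ⟨i, hi, hs⟩
        obtain ⟨j, hj, e⟩ := exists_prof_eq h hi
        exact ⟨j, hj, h' e ▸ hs⟩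
      · rintro s (⟨i, hi, hs⟩ | ⟨i, hi, j, hj, hij, hs, hs'⟩)
        · obtain ⟨j, hj, e⟩ := exists_prof_eq h hi
          exact Or.inl ⟨j, hj, h' e ▸ hs⟩
        · obtain ⟨i', hi', j', hj', hij', e, e'⟩ := exists_prof_pair_eq h hi hj hij
          exact Or.inr ⟨i', hi', j', hj', hij', h' e ▸ hs, h' e' ▸ hs'⟩
    exact Prod.ext ((key h).1.antisymm (key h.symm).1) ((key h).2.antisymm (key h.symm).2)
  | succ n ih =>
    intro ι _
    obtain ⟨M, hM⟩ := ih (Option ι)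
    refine ⟨M + Nat.card (Ty n (Option ι)), fun {X} _ E E' f f' h => ?_⟩
    have key : ∀ {E E' : Set X} {f f' : X → Ty (n + 1) ι},
        ty (M + Nat.card (Ty n (Option ι))) E (col f Set.univ) =
          ty (M + Nat.card (Ty n (Option ι))) E' (col f' Set.univ) →
        ∀ g : X → Ty n (Option ι), (∀ i ∈ E, g i ∈ (show Set (Ty n (Option ι)) from f i)) →
          ∃ g' : X → Ty n (Option ι),
            (∀ i ∈ E', g' i ∈ (show Set (Ty n (Option ι)) from f' i)) ∧
              lsum n E g = lsum n E' g' := by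
      intro E E' f f' h g hg
      obtain ⟨g', hg'⟩ := exists_col h g
      refine ⟨g', fun i' hi' => ?_, hM E E' g g' (ty_col_map Prod.snd hg')⟩
      obtain ⟨i, hi, -, e⟩ := exists_same_col hg'.symm hi' trivial
      simp only [Prod.mk.injEq] at e
      rw [← e.1, ← e.2]
      exact hg i hi
    apply Set.Subset.antisymm
    · rintro _ ⟨g, hg, rfl⟩
      exact key h g hg
    · rintro _ ⟨g, hg, rfl⟩
      exact key h.symm g hg

end Sums

section Bridge

variable {X : Type*} {ι : Type} {D D' : Set X} {A A' : ι → Set X} {n : ℕ}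

/-- The trace of a tuple on a subset. -/
abbrev trace (D : Set X) (A : ι → Set X) : ι → Set D := fun i => {x : D | (x : X) ∈ A i}

lemma trace_extend (D : Set X) (A : ι → Set X) (B : Set X) :
    trace D (extend A B) = fun o => Option.elim o {x : D | (x : X) ∈ B} (trace D A) := by
  funext o
  cases o <;> rfl

variable [LinearOrder X]

lemma ThOn_succ_eq_iff : ThOn (n + 1) D A = ThOn (n + 1) D' A' ↔
    (∀ B, ∃ B', ThOn n D (extend A B) = ThOn n D' (extend A' B')) ∧
    (∀ B', ∃ B, ThOn n D' (extend A' B') = ThOn n D (extend A B)) := by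
  have key : ∀ (D : Set X) (A : ι → Set X) (t : TheoryType n (Option ι)),
      t ∈ (show Set (TheoryType n (Option ι)) from ThOn (n + 1) D A) ↔
        ∃ B, t = ThOn n D (extend A B) := by
    intro D A t
    constructor
    · rintro ⟨B, rfl⟩
      refine ⟨Subtype.val '' B, ?_⟩
      change _ = Th n (trace D (extend A _))
      rw [trace_extend]
      congr 1
      funext o
      cases o
      · ext x
        simp
      · rfl
    · rintro ⟨B, rfl⟩
      exact ⟨{x : D | (x : X) ∈ B}, congrArg (Th n) (trace_extend D A B)⟩
  constructor
  · intro h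
    exact ⟨fun B => (key _ _ _).1 (h ▸ (key _ _ _).2 ⟨B, rfl⟩),
      fun B => (key _ _ _).1 (h ▸ (key _ _ _).2 ⟨B, rfl⟩)⟩
  · rintro ⟨h1, h2⟩
    refine Set.ext fun t => (key D A t).trans (Iff.trans ⟨?_, ?_⟩ (key D' A' t).symm)
    · rintro ⟨B, rfl⟩
      exact h1 B
    · rintro ⟨B, rfl⟩
      exact h2 B

lemma term_eq_var (t : monLang.Term (ι ⊕ Fin 0)) : ∃ i, t = Language.Term.var (Sum.inl i) := by
  cases t with
  | var v =>
    rcases v with i | i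
    · exact ⟨i, rfl⟩
    · exact i.elim0
  | func f ts => exact f.elim

lemma realize_of_isAtomic (h : ty 0 D A = ty 0 D' A') {φ : monLang.BoundedFormula ι 0}
    (hφ : φ.IsAtomic) (v : Fin 0 → Set D) (v' : Fin 0 → Set D')
    (hr : φ.Realize (trace D A) v) : φ.Realize (trace D' A') v' := by
  have sub : ∀ i j, trace D A i ⊆ trace D A j → trace D' A' i ⊆ trace D' A' j := by
    rintro i j hs ⟨x', hx'⟩ hxi
    obtain ⟨x, hx, e⟩ := exists_prof_eq h.symm hx'
    exact (mem_iff_of_prof e j).2 (@hs ⟨x, hx⟩ ((mem_iff_of_prof e i).1 hxi))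
  have sg : ∀ i, ∀ x : D, trace D A i = {x} →
      ∃ x' : D', trace D' A' i = {x'} ∧ prof A x = prof A' x' := by
    rintro i ⟨x, hx⟩ hi
    obtain ⟨x', hx', e⟩ := exists_prof_eq h hx
    have hxi : x ∈ A i := (Set.ext_iff.1 hi ⟨x, hx⟩).2 rfl
    have hxi' : x' ∈ A' i := (mem_iff_of_prof e i).1 hxi
    have eq : ∀ z ∈ D, z ∈ A i → z = x := fun z hz hzi =>
      congrArg Subtype.val ((Set.ext_iff.1 hi ⟨z, hz⟩).1 hzi)
    have lt : ∀ z ∈ D', z ∈ A' i → ∀ w ∈ D', w ∈ A' i → ¬ z < w := by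
      intro z hz hzi w hw hwi hzw
      obtain ⟨u, hu, v, hv, huv, p, q⟩ := exists_prof_pair_eq h.symm hz hw hzw
      have h1 := eq u hu ((mem_iff_of_prof p i).1 hzi)
      have h2 := eq v hv ((mem_iff_of_prof q i).1 hwi)
      exact absurd huv (by simp [h1, h2])
    refine ⟨⟨x', hx'⟩, ?_, e⟩
    ext ⟨z, hz⟩
    constructor
    · intro hzi
      exact Subtype.ext (le_antisymm (not_lt.1 (lt _ hx' hxi' _ hz hzi))
        (not_lt.1 (lt _ hz hzi _ hx' hxi')))
    · rintro e
      cases e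
      exact hxi'
  cases hφ with
  | equal t₁ t₂ =>
    obtain ⟨i, rfl⟩ := term_eq_var t₁
    obtain ⟨j, rfl⟩ := term_eq_var t₂
    have hr : trace D A i = trace D A j := hr
    exact (sub i j hr.subset).antisymm (sub j i hr.symm.subset)
  | @rel k R ts =>
    choose i hi using fun k => term_eq_var (ts k)
    have hA : (fun k => (ts k).realize (Sum.elim (trace D A) v)) = fun k => trace D A (i k) := by
      funext k
      rw [hi k]
      rfl
    have hA' : (fun k => (ts k).realize (Sum.elim (trace D' A') v')) =
        fun k => trace D' A' (i k) := by
      funext k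
      rw [hi k]
      rfl
    rw [Language.BoundedFormula.realize_rel] at hr ⊢
    rw [hA] at hr
    rw [hA']
    change MonRel k at R
    cases R with
    | sing =>
      obtain ⟨x, hx⟩ : ∃ x : D, trace D A (i 0) = {x} := hr
      obtain ⟨x', hx', -⟩ := sg _ x hx
      exact ⟨x', hx'⟩
    | empt =>
      have hr : trace D A (i 0) = ∅ := hr
      change trace D' A' (i 0) = ∅
      rw [Set.eq_empty_iff_forall_notMem] at hr ⊢
      rintro ⟨x', hx'⟩ hxi
      obtain ⟨x, hx, e⟩ := exists_prof_eq h.symm hx'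
      exact hr ⟨x, hx⟩ ((mem_iff_of_prof e _).1 hxi)
    | subset => exact sub (i 0) (i 1) hr
    | sless =>
      obtain ⟨x, y, hx, hy, hxy⟩ : ∃ x y : D, trace D A (i 0) = {x} ∧
        trace D A (i 1) = {y} ∧ x < y := hr
      obtain ⟨x', hx', e⟩ := sg _ x hx
      obtain ⟨y', hy', e'⟩ := sg _ y hy
      refine ⟨x', y', hx', hy', ?_⟩
      obtain ⟨u, hu, w, hw, huw, p, q⟩ := exists_prof_pair_eq h x.2 y.2 hxy
      have h1 := (mem_iff_of_prof p (i 0)).1 ((Set.ext_iff.1 hx x).2 rfl)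
      have h2 := (mem_iff_of_prof q (i 1)).1 ((Set.ext_iff.1 hy y).2 rfl)
      have h3 : (⟨u, hu⟩ : D') = x' := (Set.ext_iff.1 hx' ⟨u, hu⟩).1 h1
      have h4 : (⟨w, hw⟩ : D') = y' := (Set.ext_iff.1 hy' ⟨w, hw⟩).1 h2
      rw [← h3, ← h4]
      exact huw

lemma realize_iff_of_isQF (h : ty 0 D A = ty 0 D' A') {φ : monLang.BoundedFormula ι 0}
    (hφ : φ.IsQF) (v : Fin 0 → Set D) (v' : Fin 0 → Set D') :
    φ.Realize (trace D A) v ↔ φ.Realize (trace D' A') v' := by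
  induction hφ with
  | falsum => rfl
  | of_isAtomic ha => exact ⟨realize_of_isAtomic h ha v v', realize_of_isAtomic h.symm ha v' v⟩
  | imp _ _ h1 h2 => exact imp_congr h1 h2

lemma ThOn_eq_of_ty_eq (h : ty n D A = ty n D' A') : ThOn n D A = ThOn n D' A' := by
  induction n generalizing ι with
  | zero =>
    refine Set.ext fun φ => and_congr_right fun hφ => ?_
    exact realize_iff_of_isQF h hφ _ _
  | succ n ih =>
    rw [ty_succ_eq_iff] at h
    exact ThOn_succ_eq_iff.2 ⟨fun B => (h.1 B).imp fun B' => ih, fun B => (h.2 B).imp fun B' e => (ih e.symm).symm⟩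

lemma realize_rel₂_of_ThOn_zero (h : ThOn 0 D A = ThOn 0 D' A') (R : MonRel 2) {i j : ι}
    (hR : Language.Structure.RelMap (L := monLang) (M := Set D) R ![trace D A i, trace D A j]) :
    Language.Structure.RelMap (L := monLang) (M := Set D') R
      ![trace D' A' i, trace D' A' j] := by
  let φ : monLang.Formula ι :=
    Language.Relations.formula₂ (L := monLang) R (Language.Term.var i) (Language.Term.var j)
  have hφ : φ.IsQF := (Language.BoundedFormula.IsAtomic.rel _ _).isQF
  have h1 : φ ∈ (show Set (monLang.Formula ι) from ThOn 0 D A) :=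
    ⟨hφ, Language.Formula.realize_rel₂.2 hR⟩
  rw [h] at h1
  exact Language.Formula.realize_rel₂.1 h1.2

lemma ty_zero_le_of_ThOn (h : ThOn 2 D A = ThOn 2 D' A') :
    (∀ x ∈ D, ∃ x' ∈ D', prof A x = prof A' x') ∧
      (∀ x ∈ D, ∀ y ∈ D, x < y → ∃ x' ∈ D', ∃ y' ∈ D', x' < y' ∧
        prof A x = prof A' x' ∧ prof A y = prof A' y') := by
  have pf : ∀ {ι : Type} {A A' : ι → Set X} (_ : ThOn 0 D A = ThOn 0 D' A') (i j : ι)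
      (x : D) (x' : D'), trace D A i = {x} → trace D' A' i = {x'} →
      ((x : X) ∈ A j ↔ (x' : X) ∈ A' j) := by
    intro ι A A' h i j x x' hi hi'
    have h1 : trace D A i ⊆ trace D A j ↔ trace D' A' i ⊆ trace D' A' j :=
      ⟨fun hr => realize_rel₂_of_ThOn_zero h .subset hr,
        fun hr => realize_rel₂_of_ThOn_zero h.symm .subset hr⟩
    rw [hi, hi', Set.singleton_subset_iff, Set.singleton_subset_iff] at h1
    exact h1
  have tr : ∀ x : D, {z : D | (z : X) ∈ ({(x : X)} : Set X)} = {x} := by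
    intro x
    ext z
    exact Subtype.ext_iff.symm
  have pair : ∀ x ∈ D, ∀ y ∈ D, x < y → ∃ x' ∈ D', ∃ y' ∈ D', x' < y' ∧
        prof A x = prof A' x' ∧ prof A y = prof A' y' := by
    intro x hx y hy hxy
    obtain ⟨S, hS⟩ := (ThOn_succ_eq_iff.1 h).1 {x}
    obtain ⟨T, hT⟩ := (ThOn_succ_eq_iff.1 hS).1 {y}
    obtain ⟨x', y', hx', hy', hxy'⟩ := realize_rel₂_of_ThOn_zero hT .sless
      (i := some none) (j := none) ⟨⟨x, hx⟩, ⟨y, hy⟩, tr ⟨x, hx⟩, tr ⟨y, hy⟩, hxy⟩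
    exact ⟨x', x'.2, y', y'.2, hxy',
      prof_eq_iff.2 fun i => pf hT (some none) (some (some i)) ⟨x, hx⟩ x' (tr ⟨x, hx⟩) hx',
      prof_eq_iff.2 fun i => pf hT none (some (some i)) ⟨y, hy⟩ y' (tr ⟨y, hy⟩) hy'⟩
  refine ⟨fun x hx => ?_, pair⟩
  obtain ⟨S, hS⟩ := (ThOn_succ_eq_iff.1 h).1 {x}
  obtain ⟨T, hT⟩ := (ThOn_succ_eq_iff.1 hS).1 {x}
  let φ : monLang.Formula (Option (Option ι)) :=
    Language.Relations.formula₁ (L := monLang) MonRel.sing (Language.Term.var none)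
  have hφ : φ.IsQF := (Language.BoundedFormula.IsAtomic.rel _ _).isQF
  have h1 : φ ∈ (show Set (monLang.Formula _) from ThOn 0 D (extend (extend A {x}) {x})) :=
    ⟨hφ, Language.Formula.realize_rel₁.2 ⟨⟨x, hx⟩, tr ⟨x, hx⟩⟩⟩
  rw [hT] at h1
  obtain ⟨x', hx'⟩ := Language.Formula.realize_rel₁.1 h1.2
  exact ⟨x', x'.2, prof_eq_iff.2 fun i =>
    pf hT none (some (some i)) ⟨x, hx⟩ x' (tr ⟨x, hx⟩) hx'⟩

lemma ty_eq_of_ThOn_eq (h : ThOn (n + 2) D A = ThOn (n + 2) D' A') : ty n D A = ty n D' A' := by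
  induction n generalizing ι with
  | zero => exact ty_zero_eq_iff.2 ⟨ty_zero_le_of_ThOn h, ty_zero_le_of_ThOn h.symm⟩
  | succ n ih =>
    rw [ThOn_succ_eq_iff] at h
    exact ty_succ_eq_iff.2 ⟨fun B => (h.1 B).imp fun B' => ih, fun B => (h.2 B).imp fun B' e => (ih e.symm).symm⟩

end Bridge

section Clubs

open Cardinal

/-- `β` is an accumulation point of `J`. -/
def Acc (J : Set Ordinal.{0}) (β : Ordinal.{0}) : Prop :=
  β ≠ 0 ∧ ∀ α < β, ∃ γ ∈ J, α < γ ∧ γ < β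

/-- The increasing sequence `s` converges to `β`. -/
def Approaches (s : ℕ → Ordinal.{0}) (β : Ordinal.{0}) : Prop :=
  StrictMono s ∧ (∀ n, s n < β) ∧ ∀ α < β, ∃ n, α < s n

/-- The points of `J` whose cofinality is not countable are accumulation points of `J`. -/
def Thin (J : Set Ordinal.{0}) : Prop :=
  ∀ β ∈ J, β.cof ≠ ℵ₀ → ∀ α < β, ∃ γ ∈ J, α < γ ∧ γ < β

/-- The least element of `J` above `α`. -/
noncomputable def next (J : Set Ordinal.{0}) (α : Ordinal.{0}) : Ordinal.{0} :=
  sInf {β | β ∈ J ∧ α < β}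

variable {J J' : Set Ordinal.{0}} {s : ℕ → Ordinal.{0}} {α β γ δ : Ordinal.{0}}

lemma limit_iff : ℵ₀ ≤ β.cof ↔ β ≠ 0 ∧ ∀ α < β, α + 1 < β := by
  rw [Ordinal.aleph0_le_cof_iff, Ordinal.one_lt_cof_iff, Ordinal.isSuccLimit_iff,
    Order.isSuccPrelimit_iff_succ_lt]
  rfl

lemma Acc.limit (h : Acc J β) : ℵ₀ ≤ β.cof := by
  refine limit_iff.2 ⟨h.1, fun α hα => ?_⟩
  obtain ⟨γ, -, h1, h2⟩ := h.2 α hα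
  exact (Order.add_one_le_of_lt h1).trans_lt h2

lemma Acc.mono (h : Acc J β) (hJ : J ⊆ J') : Acc J' β :=
  ⟨h.1, fun α hα => let ⟨γ, hγ, h⟩ := h.2 α hα; ⟨γ, hJ hγ, h⟩⟩

lemma Approaches.acc (h : Approaches s β) (hJ : ∀ n, s (n + 1) ∈ J) : Acc J β := by
  refine ⟨(pos_of_gt (h.2.1 0)).ne', fun α hα => ?_⟩
  obtain ⟨n, hn⟩ := h.2.2 α hα
  exact ⟨s (n + 1), hJ n, hn.trans (h.1 n.lt_succ_self), h.2.1 _⟩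

lemma Approaches.cof_eq (h : Approaches s β) : β.cof = ℵ₀ := by
  have : β = ⨆ n, s n := by
    apply le_antisymm
    · by_contra hlt
      obtain ⟨n, hn⟩ := h.2.2 _ (not_le.1 hlt)
      exact absurd (Ordinal.le_iSup s n) (not_le.2 hn)
    · exact Ordinal.iSup_le fun n => (h.2.1 n).le
  rw [this, Ordinal.cof_iSup h.1]
  simp

lemma countable_sup_lt (hδ : ℵ₀ < δ.cof) (hs : ∀ n, s n < δ) : ⨆ n, s n < δ :=
  Ordinal.iSup_lt_of_lt_cof (by simpa using hδ) hs

lemma approaches_iSup (hs : StrictMono s) : Approaches s (⨆ n, s n) := by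
  refine ⟨hs, fun n => (hs n.lt_succ_self).trans_le (Ordinal.le_iSup s _), fun α hα => ?_⟩
  exact (Ordinal.lt_iSup_iff).1 hα

lemma exists_approaches_of_lt_cof (hδ : ℵ₀ < δ.cof) {R : ℕ → Ordinal.{0} → Ordinal.{0} → Prop}
    (hR : ∀ n, ∀ α < δ, ∃ γ, α < γ ∧ γ < δ ∧ R n α γ) (hα : α < δ) :
    ∃ s β, s 0 = α ∧ β < δ ∧ Approaches s β ∧ ∀ n, R n (s n) (s (n + 1)) := by
  choose! g h1 h2 h3 using hR
  let s : ℕ → Ordinal.{0} := fun n => Nat.rec α (fun n x => g n x) n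
  have hs : ∀ n, s n < δ := fun n => by
    induction n with
    | zero => exact hα
    | succ n ih => exact h2 n _ ih
  have hm : StrictMono s := strictMono_nat_of_lt_succ fun n => h1 n _ (hs n)
  exact ⟨s, ⨆ n, s n, rfl, countable_sup_lt hδ hs, approaches_iSup hm, fun n => h3 n _ (hs n)⟩

lemma exists_approaches_of_cof_eq (hβ : β.cof = ℵ₀) {R : Ordinal.{0} → Ordinal.{0} → Prop}
    (hR : ∀ α < β, ∀ b < β, ∃ γ, α < γ ∧ b ≤ γ ∧ γ < β ∧ R α γ) (hα : α < β) :
    ∃ s, s 0 = α ∧ Approaches s β ∧ ∀ n, R (s n) (s (n + 1)) := by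
  obtain ⟨t, ht, hc⟩ := Order.exists_cof_eq β.ToType
  rw [Ordinal.cof_toType, hβ] at hc
  have : Nonempty t := by
    rw [← Cardinal.mk_ne_zero_iff, hc]
    exact aleph0_ne_zero
  have : Countable t := by rw [← Cardinal.mk_le_aleph0_iff, hc]
  obtain ⟨e, he⟩ := exists_surjective_nat t
  let b : ℕ → Ordinal.{0} := fun n => Ordinal.ToType.mk.symm (e n : β.ToType)
  have hb : ∀ n, b n < β := fun n => (Ordinal.ToType.mk.symm (e n : β.ToType)).2
  have hbc : ∀ α < β, ∃ n, α ≤ b n := by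
    intro α hα
    obtain ⟨x, hx, h⟩ := ht (Ordinal.ToType.mk ⟨α, hα⟩)
    obtain ⟨n, hn⟩ := he ⟨x, hx⟩
    refine ⟨n, ?_⟩
    have hle : (⟨α, hα⟩ : Set.Iio β) ≤ Ordinal.ToType.mk.symm x := by
      simpa using Ordinal.ToType.mk.symm.monotone h
    simpa only [b, hn] using Subtype.coe_le_coe.2 hle
  choose! g h1 h2 h3 h4 using hR
  let s : ℕ → Ordinal.{0} := fun n => Nat.rec α (fun n x => g x (b n)) n
  have hs : ∀ n, s n < β := fun n => by
    induction n with
    | zero => exact hα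
    | succ n ih => exact h3 _ ih _ (hb n)
  have hm : StrictMono s := strictMono_nat_of_lt_succ fun n => h1 _ (hs n) _ (hb n)
  refine ⟨s, rfl, ⟨hm, hs, fun α hα => ?_⟩, fun n => h4 _ (hs n) _ (hb n)⟩
  obtain ⟨n, hn⟩ := hbc α hα
  exact ⟨n + 2, (hn.trans (h2 _ (hs n) _ (hb n))).trans_lt (hm (n + 1).lt_succ_self)⟩

lemma _root_.IsClubIn.lt (h : IsClubIn J δ) (hβ : β ∈ J) : β < δ := h.1 hβ

lemma _root_.IsClubIn.mem_of_acc (h : IsClubIn J δ) (hβ : β < δ) (ha : Acc J β) : β ∈ J :=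
  h.2.2 β hβ ha.1 ha.2

lemma _root_.IsClubIn.exists_gt (h : IsClubIn J δ) (hδ : ℵ₀ ≤ δ.cof) (hα : α < δ) :
    ∃ β ∈ J, α < β ∧ β < δ := by
  obtain ⟨β, hβ, hle⟩ := h.2.1 (α + 1) ((limit_iff.1 hδ).2 α hα)
  exact ⟨β, hβ, (Order.lt_add_one_iff.2 le_rfl).trans_le hle, h.1 hβ⟩

lemma _root_.IsClubIn.acc (h : IsClubIn J δ) (hδ : ℵ₀ ≤ δ.cof) : Acc J δ :=
  ⟨(limit_iff.1 hδ).1, fun _ hα => h.exists_gt hδ hα⟩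

lemma _root_.IsClubIn.inter (h : IsClubIn J δ) (h' : IsClubIn J' δ) (hδ : ℵ₀ < δ.cof) :
    IsClubIn (J ∩ J') δ := by
  refine ⟨fun x hx => h.1 hx.1, fun α hα => ?_, fun α hα h0 ha =>
    ⟨h.mem_of_acc hα (Acc.mono ⟨h0, ha⟩ Set.inter_subset_left),
      h'.mem_of_acc hα (Acc.mono ⟨h0, ha⟩ Set.inter_subset_right)⟩⟩
  obtain ⟨s, β, hs, hβ, happ, hR⟩ := exists_approaches_of_lt_cof hδ
    (R := fun _ α γ => γ ∈ J' ∧ ∃ x ∈ J, α < x ∧ x < γ) (fun _ α hα => by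
      obtain ⟨x, hx, h1, h2⟩ := h.exists_gt hδ.le hα
      obtain ⟨y, hy, h3, h4⟩ := h'.exists_gt hδ.le h2
      exact ⟨y, h1.trans h3, h4, hy, x, hx, h1, h3⟩) hα
  refine ⟨β, ⟨h.mem_of_acc hβ ⟨(pos_of_gt (happ.2.1 0)).ne', fun a ha => ?_⟩,
    h'.mem_of_acc hβ (happ.acc fun n => (hR n).1)⟩, hs ▸ (happ.2.1 0).le⟩
  obtain ⟨n, hn⟩ := happ.2.2 a ha
  obtain ⟨-, x, hx, h1, h2⟩ := hR n
  exact ⟨x, hx, hn.trans h1, h2.trans (happ.2.1 _)⟩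

lemma isClubIn_acc (h : IsClubIn J δ) (hδ : ℵ₀ < δ.cof) : IsClubIn {β | β < δ ∧ Acc J β} δ := by
  refine ⟨fun x hx => hx.1, fun α hα => ?_, fun α hα h0 ha => ⟨hα, h0, fun a ha' => ?_⟩⟩
  · obtain ⟨s, β, hs, hβ, happ, hR⟩ := exists_approaches_of_lt_cof hδ (R := fun _ α γ => γ ∈ J)
      (fun _ α hα => by
        obtain ⟨x, hx, h1, h2⟩ := h.exists_gt hδ.le hα
        exact ⟨x, h1, h2, hx⟩) hα
    exact ⟨β, ⟨hβ, happ.acc hR⟩, hs ▸ (happ.2.1 0).le⟩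
  · obtain ⟨γ, ⟨-, -, hγ⟩, h1, h2⟩ := ha a ha'
    obtain ⟨x, hx, h3, h4⟩ := hγ a h1
    exact ⟨x, hx, h3, h4.trans h2⟩

lemma cof_eq_or_lt (h : ℵ₀ ≤ β.cof) : β.cof = ℵ₀ ∨ ℵ₀ < β.cof := by
  rcases h.eq_or_lt with h | h
  · exact Or.inl h.symm
  · exact Or.inr h

/-- Every club contains a thin club of limit ordinals. -/
lemma exists_thin (h : IsClubIn J δ) (hδ : ℵ₀ < δ.cof) :
    ∃ J' ⊆ J, IsClubIn J' δ ∧ Thin J' ∧ ∀ β ∈ J', ℵ₀ ≤ β.cof := by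
  refine ⟨{β | β < δ ∧ Acc J β}, fun β hβ => h.mem_of_acc hβ.1 hβ.2, isClubIn_acc h hδ,
    ?_, fun β hβ => hβ.2.limit⟩
  rintro β ⟨hβ, ha⟩ hc α hαβ
  obtain ⟨s, γ, hs, hγ, happ, hR⟩ := exists_approaches_of_lt_cof
    ((cof_eq_or_lt ha.limit).resolve_left hc) (R := fun _ α γ => γ ∈ J) (fun _ α hα => by
      obtain ⟨x, hx, h1, h2⟩ := ha.2 α hα
      exact ⟨x, h1, h2, hx⟩) hαβ
  exact ⟨γ, ⟨hγ.trans hβ, happ.acc hR⟩, hs ▸ happ.2.1 0, hγ⟩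

lemma _root_.IsClubIn.exists_cof_eq (h : IsClubIn J δ) (hδ : ℵ₀ < δ.cof) (hα : α < δ) :
    ∃ β ∈ J, α < β ∧ β < δ ∧ β.cof = ℵ₀ := by
  obtain ⟨s, β, hs, hβ, happ, hR⟩ := exists_approaches_of_lt_cof hδ (R := fun _ α γ => γ ∈ J)
    (fun _ α hα => by
      obtain ⟨x, hx, h1, h2⟩ := h.exists_gt hδ.le hα
      exact ⟨x, h1, h2, hx⟩) hα
  exact ⟨β, h.mem_of_acc hβ (happ.acc hR), hs ▸ happ.2.1 0, hβ, happ.cof_eq⟩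

lemma next_mem (h : ∃ β ∈ J, α < β) : next J α ∈ J ∧ α < next J α :=
  csInf_mem (s := {β | β ∈ J ∧ α < β}) h

lemma next_le (hβ : β ∈ J) (h : α < β) : next J α ≤ β := csInf_le' ⟨hβ, h⟩

/-- A bounded set closed under suprema below `δ` has a greatest element below each point. -/
lemma exists_greatest (h : ∀ β < δ, Acc J β → β ∈ J) (hα : α ∈ J) (hαβ : α ≤ β) (hβ : β < δ) :
    ∃ γ ∈ J, α ≤ γ ∧ γ ≤ β ∧ ∀ x ∈ J, x ≤ β → x ≤ γ := by
  set T := {x | x ∈ J ∧ x ≤ β} with hT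
  have hb : BddAbove T := ⟨β, fun x hx => hx.2⟩
  have hle : ∀ x ∈ J, x ≤ β → x ≤ sSup T := fun x hx hxβ => le_csSup hb ⟨hx, hxβ⟩
  have hsβ : sSup T ≤ β := csSup_le' fun x hx => hx.2
  refine ⟨sSup T, ?_, hle α hα hαβ, hsβ, hle⟩
  by_contra hn
  refine hn (h _ (hsβ.trans_lt hβ) ⟨?_, fun a ha => ?_⟩)
  · intro h0
    have : α = 0 := by simpa [h0] using hle α hα hαβ
    exact hn (h0 ▸ this ▸ hα)
  · obtain ⟨x, hx, hax⟩ := exists_lt_of_lt_csSup (s := T) ⟨α, hα, hαβ⟩ ha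
    exact ⟨x, hx.1, hax, (hle x hx.1 hx.2).lt_of_ne fun e => hn (e ▸ hx.1)⟩

lemma next_cof (hJ : Thin J) (h : ∃ β ∈ J, α < β) : (next J α).cof = ℵ₀ := by
  by_contra hc
  obtain ⟨γ, hγ, h1, h2⟩ := hJ _ (next_mem h).1 hc α (next_mem h).2
  exact absurd (next_le hγ h1) (not_le.2 h2)

lemma biUnion_Ico_next (h : IsClubIn J δ) (hδ : ℵ₀ ≤ δ.cof) (hα : α ∈ J) :
    ⋃ β ∈ J ∩ Set.Ici α, Set.Ico β (next J β) = Set.Ico α δ := by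
  ext x
  simp only [Set.mem_iUnion, Set.mem_Ico, Set.mem_inter_iff, Set.mem_Ici, exists_prop]
  constructor
  · rintro ⟨β, ⟨hβ, hle⟩, h1, h2⟩
    obtain ⟨γ, hγ, h3, h4⟩ := h.exists_gt hδ (h.1 hβ)
    exact ⟨hle.trans h1, h2.trans_le ((next_le hγ h3).trans h4.le)⟩
  · rintro ⟨h1, h2⟩
    obtain ⟨γ, hγ, h3, h4, h5⟩ := exists_greatest (fun x hx hxa => h.mem_of_acc hx hxa) hα h1 h2
    obtain ⟨y, hy, h6, -⟩ := h.exists_gt hδ (h.1 hγ)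
    refine ⟨γ, ⟨hγ, h3⟩, h4, lt_of_not_ge fun hle => ?_⟩
    have := next_mem ⟨y, hy, h6⟩
    exact absurd (h5 _ this.1 hle) (not_le.2 this.2)

lemma iUnion_Ico_approaches (h : Approaches s β) :
    ⋃ n ∈ (Set.univ : Set ℕ), Set.Ico (s n) (s (n + 1)) = Set.Ico (s 0) β := by
  ext x
  simp only [Set.mem_iUnion, Set.mem_Ico, Set.mem_univ, exists_true_left]
  constructor
  · rintro ⟨n, h1, h2⟩
    exact ⟨(h.1.monotone n.zero_le).trans h1, h2.trans (h.2.1 _)⟩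
  · rintro ⟨h1, h2⟩
    classical
    have hex := h.2.2 x h2
    have hn := Nat.find_spec hex
    have hm := fun m => Nat.find_min hex (m := m)
    generalize Nat.find hex = n at hn hm
    cases n with
    | zero => exact absurd h1 (not_le.2 hn)
    | succ n => exact ⟨n, not_lt.1 (hm n n.lt_succ_self), hn⟩

lemma _root_.IsClubIn.sub_Ioi (h : IsClubIn J δ) (hδ : ℵ₀ ≤ δ.cof) (hα : α < δ) :
    IsClubIn (J ∩ Set.Ioi α) δ := by
  refine ⟨fun x hx => h.1 hx.1, fun β hβ => ?_, fun β hβ h0 ha =>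
    ⟨h.mem_of_acc hβ (Acc.mono ⟨h0, ha⟩ Set.inter_subset_left), ?_⟩⟩
  · obtain ⟨γ, hγ, h1, h2⟩ := h.exists_gt hδ (max_lt hα hβ)
    exact ⟨γ, ⟨hγ, (le_max_left _ _).trans_lt h1⟩, (le_max_right _ _).trans h1.le⟩
  · obtain ⟨γ, ⟨-, hγ⟩, -, h2⟩ := ha 0 (pos_of_ne_zero h0)
    exact lt_trans hγ h2

lemma _root_.IsClubIn.insert_zero (h : IsClubIn J δ) (hδ : 0 < δ) : IsClubIn (insert 0 J) δ := by
  refine ⟨Set.insert_subset hδ h.1, fun β hβ => ?_, fun β hβ h0 ha => Or.inr ?_⟩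
  · obtain ⟨γ, hγ, h1⟩ := h.2.1 β hβ
    exact ⟨γ, Or.inr hγ, h1⟩
  · refine h.mem_of_acc hβ ⟨h0, fun a ha' => ?_⟩
    obtain ⟨γ, rfl | hγ, h1, h2⟩ := ha a ha'
    · exact absurd h1 not_lt_zero
    · exact ⟨γ, hγ, h1, h2⟩

lemma Thin.insert_zero (hJ : Thin J) : Thin (insert 0 J) := by
  rintro β (rfl | hβ) hc α hαβ
  · exact absurd hαβ not_lt_zero
  · obtain ⟨γ, hγ, h⟩ := hJ β hβ hc α hαβ
    exact ⟨γ, Or.inr hγ, h⟩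

/-- The ordinal `δ` is regular and uncountable, expressed through its cofinality. -/
def Reg (δ : Ordinal.{0}) : Prop := ℵ₀ < δ.cof ∧ ∀ γ < δ, γ.card < δ.cof

lemma Reg.exists_bound (hδ : Reg δ) (hγ : γ < δ) {f : Ordinal.{0} → Ordinal.{0}}
    (hf : ∀ x < γ, f x < δ) : ∃ β < δ, ∀ x < γ, f x < β := by
  refine ⟨⨆ x : γ.ToType, (f (Ordinal.ToType.mk.symm x) + 1), ?_, fun x hx => ?_⟩
  · refine Ordinal.iSup_lt_of_lt_cof (by simpa using hδ.2 γ hγ) fun x => ?_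
    exact (limit_iff.1 hδ.1.le).2 _ (hf _ (Ordinal.ToType.mk.symm x).2)
  · have := Ordinal.le_iSup (fun x : γ.ToType => f (Ordinal.ToType.mk.symm x) + 1)
      (Ordinal.ToType.mk ⟨x, hx⟩)
    simp only [OrderIso.symm_apply_apply] at this
    exact (Order.lt_add_one_iff.2 le_rfl).trans_le this

/-- Closure points of a binary function form a club. -/
lemma Reg.exists_closure (hδ : Reg δ) {f : Ordinal.{0} → Ordinal.{0} → Ordinal.{0}}
    (hf : ∀ x < δ, ∀ y < δ, f x y < δ) :
    ∃ J, IsClubIn J δ ∧ ∀ β ∈ J, ∀ x < β, ∀ y < β, f x y < β := by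
  have hb : ∀ α < δ, ∃ γ, α < γ ∧ γ < δ ∧ ∀ x ≤ α, ∀ y ≤ α, f x y < γ := by
    intro α hα
    have hα' := (limit_iff.1 hδ.1.le).2 α hα
    have h1 : ∀ x < α + 1, ∃ γ < δ, ∀ y < α + 1, f x y < γ := fun x hx =>
      hδ.exists_bound hα' fun y hy => hf x (hx.trans hα') y (hy.trans hα')
    choose! g hg hg' using h1
    obtain ⟨γ, hγ, h⟩ := hδ.exists_bound hα' hg
    refine ⟨max γ (α + 1), (Order.lt_add_one_iff.2 le_rfl).trans_le (le_max_right _ _),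
      max_lt hγ hα', fun x hx y hy => ?_⟩
    have hx := Order.lt_add_one_iff.2 hx
    exact ((hg' x hx y (Order.lt_add_one_iff.2 hy)).trans (h x hx)).trans_le (le_max_left _ _)
  refine ⟨{β | β < δ ∧ ∀ x < β, ∀ y < β, f x y < β}, ⟨fun x hx => hx.1, fun α hα => ?_,
    fun α hα h0 ha => ⟨hα, fun x hx y hy => ?_⟩⟩, fun β hβ => hβ.2⟩
  · obtain ⟨s, β, hs, hβ, happ, hR⟩ := exists_approaches_of_lt_cof hδ.1 (fun _ => hb) hα
    refine ⟨β, ⟨hβ, fun x hx y hy => ?_⟩, hs ▸ (happ.2.1 0).le⟩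
    obtain ⟨n, hn⟩ := happ.2.2 _ (max_lt hx hy)
    exact (hR n x ((le_max_left _ _).trans hn.le) y ((le_max_right _ _).trans hn.le)).trans
      (happ.2.1 _)
  · obtain ⟨γ, hγ, h1, h2⟩ := ha _ (max_lt hx hy)
    exact (hγ.2 x ((le_max_left _ _).trans_lt h1) y ((le_max_right _ _).trans_lt h1)).trans h2

lemma isClubIn_Iio : IsClubIn (Set.Iio δ) δ :=
  ⟨subset_rfl, fun α hα => ⟨α, hα, le_rfl⟩, fun _ hα _ _ => hα⟩

lemma exists_club_subset (hδ : ℵ₀ < δ.cof) {T : Type*} [Finite T] {C : T → Set Ordinal.{0}}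
    (hC : ∀ t, IsClubIn (C t) δ) : ∃ C', IsClubIn C' δ ∧ ∀ t, C' ⊆ C t := by
  have : ∀ s : Set T, s.Finite → ∃ C', IsClubIn C' δ ∧ ∀ t ∈ s, C' ⊆ C t := by
    intro s hs
    induction s, hs using Set.Finite.induction_on with
    | empty => exact ⟨_, isClubIn_Iio, fun t ht => ht.elim⟩
    | @insert u s _ _ ih =>
      obtain ⟨C', h, h'⟩ := ih
      refine ⟨_, (hC u).inter h hδ, ?_⟩
      rintro t (rfl | ht)
      · exact Set.inter_subset_left
      · exact Set.inter_subset_right.trans (h' t ht)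
  obtain ⟨C', h, h'⟩ := this Set.univ Set.finite_univ
  exact ⟨C', h, fun t => h' t trivial⟩

end Clubs

section Transfer

open Cardinal Set

variable {ι : Type} {A A' : ι → Set Ordinal.{0}} {α α' β δ δ' : Ordinal.{0}} {n : ℕ}

lemma Iio_inter_Iio' (h : α < δ) : Iio δ ∩ Iio α = Iio α :=
  inter_eq_right.2 (Iio_subset_Iio h.le)

lemma ty_Iio_cut (h : ty (n + 1) (Iio δ) A = ty (n + 1) (Iio δ') A') {i : ι} (hα : α < δ)
    (hα' : α' < δ') (hi : A i = {α}) (hi' : A' i = {α'}) :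
    ty n (Iio α) A = ty n (Iio α') A' := by
  have := (ty_cut h hα' hi hi').1
  rwa [Iio_inter_Iio' hα, Iio_inter_Iio' hα'] at this

lemma zero_transfer (h : ty n (Iio (0 : Ordinal.{0})) A = ty n (Iio δ') A') : δ' = 0 := by
  by_contra h0
  obtain ⟨x, hx, -⟩ := exists_prof_eq h.symm (x := 0) (pos_of_ne_zero h0)
  exact absurd (mem_Iio.1 hx) not_lt_zero

lemma acc_transfer (h : ty (n + 1) (Iio δ) A = ty (n + 1) (Iio δ') A') {i : ι}
    (ha : Acc (A i) δ) : Acc (A' i) δ' := by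
  refine ⟨?_, fun x' hx' => ?_⟩
  · rintro rfl
    exact ha.1 (zero_transfer h.symm)
  · obtain ⟨x, hx, e⟩ := exists_point h.symm hx'
    obtain ⟨γ, hγ, h1, h2⟩ := ha.2 x hx
    obtain ⟨y', hy', γ', hγ', hlt, p, p'⟩ := exists_prof_pair_eq e.symm hx h2 h1
    have hy : y' = x' := (mem_iff_of_prof p none).1 rfl
    exact ⟨γ', (mem_iff_of_prof p' (some i)).1 hγ, hy ▸ hlt, hγ'⟩

lemma club_transfer (h : ty (n + 3) (Iio δ) A = ty (n + 3) (Iio δ') A') {i : ι}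
    (hc : IsClubIn (A i ∩ Iio δ) δ) : IsClubIn (A' i ∩ Iio δ') δ' := by
  refine ⟨inter_subset_right, fun x' hx' => ?_, fun x' hx' h0 ha => ⟨?_, hx'⟩⟩
  · obtain ⟨x, hx, e⟩ := exists_point h.symm hx'
    obtain ⟨γ, hγ, h1⟩ := hc.2.1 x hx
    rcases h1.eq_or_lt with rfl | h1
    · have p := prof_eq_of_point e.symm (i := none) hx rfl rfl
      exact ⟨x', ⟨(mem_iff_of_prof p (some i)).1 hγ.1, hx'⟩, le_rfl⟩
    · obtain ⟨y', hy', γ', hγ', hlt, p, p'⟩ := exists_prof_pair_eq e.symm hx hγ.2 h1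
      have hy : y' = x' := (mem_iff_of_prof p none).1 rfl
      exact ⟨γ', ⟨(mem_iff_of_prof p' (some i)).1 hγ.1, hγ'⟩, (hy ▸ hlt).le⟩
  · obtain ⟨x, hx, e⟩ := exists_point h.symm hx'
    have p := prof_eq_of_point e (i := none) hx' rfl rfl
    refine (mem_iff_of_prof p (some i)).2 (hc.mem_of_acc hx ?_).1
    have := acc_transfer (i := some i) (ty_Iio_cut (i := none) e hx' hx rfl rfl)
      (Acc.mono ⟨h0, ha⟩ inter_subset_left)
    exact ⟨this.1, fun a ha =>
      let ⟨γ, h1, h2, h3⟩ := this.2 a ha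
      ⟨γ, ⟨h1, h3.trans hx⟩, h2, h3⟩⟩

lemma cof_transfer (h : ty (n + 4) (Iio δ) A = ty (n + 4) (Iio δ') A') (hδ : δ.cof = ℵ₀) :
    δ'.cof = ℵ₀ := by
  obtain ⟨s, -, hs, -⟩ := exists_approaches_of_cof_eq hδ (R := fun _ _ => True) (fun α hα b hb => by
    obtain ⟨h1, h2⟩ := limit_iff.1 hδ.ge
    exact ⟨max α b + 1, (le_max_left α b).trans_lt (Order.lt_add_one_iff.2 le_rfl),
      (le_max_right α b).trans (Order.lt_add_one_iff.2 le_rfl).le, h2 _ (max_lt hα hb), trivial⟩)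
    (pos_of_ne_zero (limit_iff.1 hδ.ge).1)
  obtain ⟨W', hW', e⟩ := exists_set h (range s)
  have hacc : Acc W' δ' := acc_transfer (i := none) e (hs.acc fun n => ⟨_, rfl⟩)
  refine (cof_eq_or_lt hacc.limit).resolve_right fun hlt => ?_
  obtain ⟨t, β', -, hβ', ht, hR⟩ := exists_approaches_of_lt_cof hlt (R := fun _ α γ => γ ∈ W')
    (fun _ α hα => by
      obtain ⟨x, hx, h1, h2⟩ := hacc.2 α hα
      exact ⟨x, h1, h2, hx⟩) (pos_of_ne_zero hacc.1)
  obtain ⟨β, hβ, e'⟩ := exists_point e.symm hβ'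
  have := acc_transfer (i := some none) (ty_Iio_cut (i := none) e' hβ' hβ rfl rfl) (ht.acc hR)
  obtain ⟨m, hm⟩ := hs.2.2 β hβ
  classical
  have hex : ∃ m, β ≤ s m := ⟨m, hm.le⟩
  have hmin := fun k => Nat.find_min hex (m := k)
  have hle := Nat.find_spec hex
  generalize Nat.find hex = k at hmin hle
  cases k with
  | zero =>
    obtain ⟨_, ⟨j, rfl⟩, -, h2⟩ := this.2 0 (pos_of_ne_zero this.1)
    exact absurd (h2.trans_le hle) (not_lt.2 (hs.1.monotone j.zero_le))
  | succ k =>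
    obtain ⟨_, ⟨j, rfl⟩, h1, h2⟩ := this.2 _ (not_le.1 (hmin k k.lt_succ_self))
    have h3 := hs.1.lt_iff_lt.1 h1
    have h4 := hs.1.lt_iff_lt.1 (h2.trans_le hle)
    omega

lemma thin_transfer (h : ty (n + 6) (Iio δ) A = ty (n + 6) (Iio δ') A') {i : ι}
    (ht : Thin (A i ∩ Iio δ)) : Thin (A' i ∩ Iio δ') := by
  rintro β' ⟨hβ', hβδ'⟩ hc x' hx'
  obtain ⟨β, hβ, e⟩ := exists_point h.symm hβδ'
  have p := prof_eq_of_point e (i := none) hβδ' rfl rfl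
  have e' := ty_Iio_cut (i := none) e hβδ' hβ rfl rfl
  have hacc : Acc (A i) β := by
    refine ⟨fun h0 => ?_, fun x hx => ?_⟩
    · rw [h0] at e'
      exact absurd (zero_transfer e'.symm) (pos_of_gt hx').ne'
    · obtain ⟨γ, hγ, h1⟩ := ht β ⟨(mem_iff_of_prof p (some i)).1 hβ', hβ⟩
        (fun h => hc (cof_transfer e'.symm h)) x hx
      exact ⟨γ, hγ.1, h1⟩
  obtain ⟨γ, hγ, h1, h2⟩ := (acc_transfer (i := some i) e'.symm hacc).2 x' hx'
  exact ⟨γ, ⟨hγ, h2.trans hβδ'⟩, h1, h2⟩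

end Transfer

section Homogeneous

open Cardinal Set Filter

variable {ι : Type} {A A' : ι → Set Ordinal.{0}} {α β γ δ lam : Ordinal.{0}} {n : ℕ}
  {J K : Set Ordinal.{0}} {s : ℕ → Ordinal.{0}}

instance : Nonempty (Ty n ι) := ⟨ty n (∅ : Set ℕ) fun _ => ∅⟩

lemma ty_Ico_add (h : α ≤ β) (h' : β ≤ γ) :
    ty n (Ico α γ) A = add (ty n (Ico α β) A) (ty n (Ico β γ) A) := by
  rw [← ty_union A fun x hx y hy => hx.2.trans_le hy.1, Ico_union_Ico_eq_Ico h h']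

lemma ty_Ico_approaches (h : Approaches s β) :
    ty n (Ico (s 0) β) A = lsum n univ fun k => ty n (Ico (s k) (s (k + 1))) A := by
  rw [← iUnion_Ico_approaches h, ty_biUnion A]
  intro i _ j _ hij x hx y hy
  exact hx.2.trans_le ((h.1.monotone (Nat.succ_le_of_lt hij)).trans hy.1)

lemma ty_Ico_club (h : IsClubIn J δ) (hδ : ℵ₀ ≤ δ.cof) (hα : α ∈ J) :
    ty n (Ico α δ) A = lsum n (J ∩ Ici α) fun x => ty n (Ico x (next J x)) A := by
  rw [← biUnion_Ico_next h hδ hα, ty_biUnion A]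
  intro i hi j hj hij x hx y hy
  exact hx.2.trans_le ((next_le hj.1 hij).trans hy.1)

/-- The types of the intervals `[α, β)` with `β` of countable cofinality in `J` are given
by `r`. -/
def Homogeneous (n : ℕ) (A : ι → Set Ordinal.{0}) (J : Set Ordinal.{0})
    (r : Ordinal.{0} → Ty n ι) : Prop :=
  ∀ β ∈ J, β.cof = ℵ₀ → ∀ α < β, ty n (Ico α β) A = r α

lemma Homogeneous.mono {r : Ordinal.{0} → Ty n ι} (h : Homogeneous n A J r) (hK : K ⊆ J) :
    Homogeneous n A K r := fun β hβ => h β (hK hβ)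

lemma exists_eventually_eq {T I : Type*} [Finite T] (U : Ultrafilter I) (f : I → T) :
    ∃ t, ∀ᶠ x in U, f x = t := by
  obtain ⟨t, ht⟩ := Ultrafilter.eq_pure_of_finite (U.map f)
  refine ⟨t, ?_⟩
  have : {t} ∈ U.map f := ht ▸ rfl
  exact this

lemma exists_homogeneous [Finite ι] (hlam : Reg lam) (n : ℕ) (A : ι → Set Ordinal.{0}) :
    ∃ r J, IsClubIn J lam ∧ Homogeneous n A J r := by
  have hl := limit_iff.1 hlam.1.le
  have : Nonempty (Iio lam) := ⟨⟨0, pos_of_ne_zero hl.1⟩⟩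
  let U : Ultrafilter (Iio lam) := Ultrafilter.of atTop
  have hU : ∀ a < lam, ∀ᶠ x : Iio lam in U, a < x := fun a ha =>
    Ultrafilter.of_le _ ((eventually_ge_atTop (⟨a + 1, hl.2 a ha⟩ : Iio lam)).mono fun x hx =>
      (Order.lt_add_one_iff.2 le_rfl).trans_le hx)
  choose g hg using fun a => exists_eventually_eq U fun x : Iio lam => ty n (Ico a (x : Ordinal)) A
  obtain ⟨t, ht⟩ := exists_eventually_eq U fun x : Iio lam => g x
  have hs : ∀ a < lam, ∀ b < lam, ∃ c < lam, a < c ∧ b < c ∧ g c = t ∧ ty n (Ico a c) A = g a := by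
    intro a ha b hb
    obtain ⟨c, h1, h2, h3, h4⟩ := ((hU a ha).and ((hU b hb).and (ht.and (hg a)))).exists
    exact ⟨c, c.2, h1, h2, h3, h4⟩
  choose! f hf h1 h2 h3 h4 using hs
  obtain ⟨J, hJ, hcl⟩ := hlam.exists_closure hf
  refine ⟨fun a => lsum n univ fun k : ℕ => if k = 0 then g a else t, J, hJ, ?_⟩
  intro β hβ hc α hα
  have hβl := hJ.1 hβ
  obtain ⟨s, rfl, happ, hR⟩ := exists_approaches_of_cof_eq hc
    (R := fun a c => g c = t ∧ ty n (Ico a c) A = g a) (fun a ha b hb =>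
      have ha' := ha.trans hβl
      have hb' := hb.trans hβl
      ⟨f a b, h1 a ha' b hb', (h2 a ha' b hb').le, hcl β hβ a ha b hb, h3 a ha' b hb',
        h4 a ha' b hb'⟩) hα
  rw [ty_Ico_approaches happ]
  refine lsum_congr fun k _ => (hR k).2.trans ?_
  cases k with
  | zero => rfl
  | succ k => exact (hR k).1

/-- The eventual type of the intervals starting at a given ordinal below `lam`. -/
noncomputable def rt (lam : Ordinal.{0}) (n : ℕ) (A : ι → Set Ordinal.{0}) :
    Ordinal.{0} → Ty n ι :=
  Classical.epsilon fun r => ∃ J, IsClubIn J lam ∧ Homogeneous n A J r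

lemma exists_homogeneous_rt [Finite ι] (hlam : Reg lam) (n : ℕ) (A : ι → Set Ordinal.{0}) :
    ∃ J, IsClubIn J lam ∧ Homogeneous n A J (rt lam n A) :=
  Classical.epsilon_spec (exists_homogeneous hlam n A)

lemma eq_rt [Finite ι] (hlam : Reg lam) {t : Ty n ι} (hJ : IsClubIn J lam) (hα : α < lam)
    (h : ∀ β ∈ J, β.cof = ℵ₀ → α < β → ty n (Ico α β) A = t) : t = rt lam n A α := by
  obtain ⟨K, hK, hom⟩ := exists_homogeneous_rt hlam n A
  obtain ⟨β, hβ, h1, h2, h3⟩ := (hJ.inter hK hlam.1).exists_cof_eq hlam.1 hα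
  rw [← h β hβ.1 h3 h1, hom β hβ.2 h3 α h1]

/-- The set of eventual types at points of countable cofinality in `K`. -/
def types (n : ℕ) (K : Set Ordinal.{0}) (r : Ordinal.{0} → Ty n ι) : Set (Ty n ι) :=
  {t | ∃ k ∈ K, k.cof = ℵ₀ ∧ r k = t}

/-- A set `K` of limit ordinals is nice if the eventual types are attained along `K` and those
occurring at points of `K` of countable cofinality occur at a stationary set of such points. -/
structure Nice (lam : Ordinal.{0}) (n : ℕ) (A : ι → Set Ordinal.{0}) (K : Set Ordinal.{0}) :
    Prop where
  club : IsClubIn K lam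
  limit : ∀ k ∈ K, ℵ₀ ≤ k.cof
  hom : Homogeneous n A K (rt lam n A)
  stat : ∀ t ∈ types n K (rt lam n A), ∀ C, IsClubIn C lam → t ∈ types n C (rt lam n A)

lemma Nice.mono (h : Nice lam n A K) (hJ : IsClubIn J lam) (hJK : J ⊆ K) : Nice lam n A J where
  club := hJ
  limit k hk := h.limit k (hJK hk)
  hom := h.hom.mono hJK
  stat t := fun ⟨k, hk, hc⟩ => h.stat t ⟨k, hJK hk, hc⟩

lemma exists_nice [Finite ι] (hlam : Reg lam) (n : ℕ) (A : ι → Set Ordinal.{0}) :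
    ∃ K, Nice lam n A K := by
  obtain ⟨J, hJ, hom⟩ := exists_homogeneous_rt hlam n A
  have : ∀ t : Ty n ι, ∃ C, IsClubIn C lam ∧
      (t ∈ types n C (rt lam n A) → ∀ D, IsClubIn D lam → t ∈ types n D (rt lam n A)) := by
    intro t
    by_cases h : ∀ D, IsClubIn D lam → t ∈ types n D (rt lam n A)
    · exact ⟨J, hJ, fun _ => h⟩
    · push Not at h
      obtain ⟨D, hD, hn⟩ := h
      exact ⟨D, hD, fun h => absurd h hn⟩
  choose C hC hCt using this
  obtain ⟨C', hC', hsub⟩ := exists_club_subset hlam.1 hC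
  obtain ⟨K, hK, hKc, -, hl⟩ := exists_thin (hJ.inter hC' hlam.1) hlam.1
  refine ⟨K, hKc, hl, hom.mono fun x hx => (hK hx).1, fun t ⟨k, hk, hc⟩ => hCt t ?_⟩
  exact ⟨k, hsub t (hK hk).2, hc⟩

lemma Nice.add_eq (hK : Nice lam n A K) (hlam : ℵ₀ < lam.cof)
    {i : Ordinal.{0}} (hi : i < lam) {t : Ty n ι} (ht : t ∈ types n K (rt lam n A)) :
    add (rt lam n A i) t = rt lam n A i := by
  obtain ⟨k, ⟨hk, hik⟩, hc, rfl⟩ := hK.stat t ht _ (hK.club.sub_Ioi hlam.le hi)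
  obtain ⟨β, hβ, h1, h2, h3⟩ := hK.club.exists_cof_eq hlam (hK.club.1 hk)
  rw [← hK.hom β hβ h3 k h1, ← hK.hom k hk hc i hik, ← ty_Ico_add (le_of_lt hik) h1.le,
    hK.hom k hk hc i hik, hK.hom β hβ h3 i (lt_trans hik h1)]

lemma Nice.lsum_nat_eq (hK : Nice lam n A K) (hlam : ℵ₀ < lam.cof)
    {i : Ordinal.{0}} (hi : i < lam) {f : ℕ → Ty n ι} (h0 : f 0 = rt lam n A i)
    (hf : ∀ k, f (k + 1) ∈ types n K (rt lam n A)) : lsum n univ f = f 0 := by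
  obtain ⟨s, β, rfl, hβ, happ, hR⟩ := exists_approaches_of_lt_cof hlam
    (R := fun k _ γ => γ ∈ K ∧ γ.cof = ℵ₀ ∧ rt lam n A γ = f (k + 1)) (fun k α hα => by
      obtain ⟨γ, ⟨hγ, h1⟩, hc, e⟩ := hK.stat _ (hf k) _ (hK.club.sub_Ioi hlam.le hα)
      exact ⟨γ, h1, hK.club.1 hγ, hγ, hc, e⟩) hi
  have hβK := hK.club.mem_of_acc hβ (happ.acc fun k => (hR k).1)
  rw [h0, ← hK.hom β hβK happ.cof_eq _ (happ.2.1 0), ty_Ico_approaches happ]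
  refine lsum_congr fun k _ => ?_
  rw [hK.hom _ (hR k).1 (hR k).2.1 _ (happ.1 k.lt_succ_self)]
  cases k with
  | zero => exact h0
  | succ k => exact (hR k).2.2.symm

lemma Nice.add_lsum_eq (hK : Nice lam n A K) (hlam : ℵ₀ < lam.cof)
    (hδ : δ < lam) (hδc : ℵ₀ < δ.cof) {D : Set Ordinal.{0}} (hD : D ⊆ K)
    (hDc : IsClubIn D δ) (hDt : Thin D) {c : Ordinal.{0}} (hc : c ∈ D) :
    add (lsum n (D ∩ Ici c) (rt lam n A)) (rt lam n A δ) = rt lam n A c := by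
  obtain ⟨β, hβ, h1, h2, h3⟩ := hK.club.exists_cof_eq hlam hδ
  have hcδ := hDc.1 hc
  rw [← hK.hom β hβ h3 δ h1, ← hK.hom β hβ h3 c (lt_trans hcδ h1),
    ty_Ico_add (le_of_lt hcδ) h1.le, ty_Ico_club hDc hδc.le hc]
  congr 1
  refine lsum_congr fun x hx => ?_
  obtain ⟨y, hy, hxy, -⟩ := hDc.exists_gt hδc.le (hDc.1 hx.1)
  have hn := next_mem ⟨y, hy, hxy⟩
  exact (hK.hom _ (hD hn.1) (next_cof hDt ⟨y, hy, hxy⟩) x hn.2).symm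

end Homogeneous

section Propagation

open Cardinal Set

variable {ι : Type} {Y : ι → Set Ordinal.{0}} {lam : Ordinal.{0}} {n : ℕ}
  {J : Set Ordinal.{0}} {h : Ordinal.{0} → Ty n ι} {S : Set (Ty n ι)}

/-- If the types of the intervals between consecutive points of a thin club are prescribed by a
function `h` obeying suitable absorption laws, then so are the types of all intervals ending at a
point of countable cofinality. -/
lemma homogeneous_of_next (hlam : ℵ₀ < lam.cof) (hJ : IsClubIn J lam) (hthin : Thin J)
    (hlim : ∀ β ∈ J, β ≠ 0 → ℵ₀ ≤ β.cof)
    (hnext : ∀ α ∈ J, ty n (Ico α (next J α)) Y = h α)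
    (hS : ∀ k ∈ J, k.cof = ℵ₀ → h k ∈ S)
    (hadd : ∀ i ∈ J, ∀ t ∈ S, add (h i) t = h i)
    (hsum : ∀ f : ℕ → Ty n ι, (∃ i ∈ J, f 0 = h i) → (∀ k, f (k + 1) ∈ S) → lsum n univ f = f 0)
    (hcol : ∀ δ ∈ J, ℵ₀ < δ.cof → ∀ α < δ, ∃ D ⊆ J, IsClubIn D δ ∧ Thin D ∧
      ∃ c ∈ D, α < c ∧ c.cof = ℵ₀ ∧ add (lsum n (D ∩ Ici c) h) (h δ) = h c) :
    ∀ β ∈ J, β.cof = ℵ₀ → ∀ α ∈ J, α < β → ty n (Ico α β) Y = h α := by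
  intro β
  induction β using WellFoundedLT.induction with
  | ind β ih =>
  intro hβ hβc α hα hαβ
  have hgt : ∀ x ∈ J, ∃ y ∈ J, x < y := fun x hx =>
    let ⟨y, hy, hxy, _⟩ := hJ.exists_gt hlam.le (hJ.1 hx)
    ⟨y, hy, hxy⟩
  by_cases hacc : Acc J β
  · obtain ⟨s, rfl, happ, hR⟩ := exists_approaches_of_cof_eq hβc
      (R := fun _ γ => γ ∈ J ∧ γ.cof = ℵ₀) (fun a ha b hb => by
        obtain ⟨x, hx, h1, h2⟩ := hacc.2 _ (max_lt ha hb)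
        obtain ⟨y, hy, h3, h4⟩ := hacc.2 x h2
        have hn := next_mem ⟨y, hy, h3⟩
        exact ⟨next J x, ((le_max_left _ _).trans_lt h1).trans hn.2,
          ((le_max_right _ _).trans_lt h1).le.trans hn.2.le, (next_le hy h3).trans_lt h4, hn.1,
          next_cof hthin ⟨y, hy, h3⟩⟩) hαβ
    have hs : ∀ k, s k ∈ J := fun k => by
      cases k with
      | zero => exact hα
      | succ k => exact (hR k).1
    rw [ty_Ico_approaches happ, ← hsum (fun k => h (s k)) ⟨_, hα, rfl⟩
      fun k => hS _ (hs _) (hR k).2]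
    exact lsum_congr fun k _ =>
      ih _ (happ.2.1 (k + 1)) (hs _) (hR k).2 _ (hs k) (happ.1 k.lt_succ_self)
  · have : ∃ a < β, ∀ γ ∈ J, γ < β → γ ≤ a := by
      by_contra! hcon
      exact hacc ⟨(pos_of_gt hαβ).ne', fun a ha =>
        let ⟨γ, hγ, h1, h2⟩ := hcon a ha
        ⟨γ, hγ, h2, h1⟩⟩
    obtain ⟨a, ha, hbd⟩ := this
    obtain ⟨p, hp, hαp, hpa, hmax⟩ := exists_greatest (fun x hx hxa => hJ.mem_of_acc hx hxa) hα
      (hbd α hα hαβ) (ha.trans (hJ.1 hβ))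
    have hpβ : p < β := hpa.trans_lt ha
    have hnp : next J p = β := by
      refine le_antisymm (next_le hβ hpβ) (not_lt.1 fun hlt => ?_)
      have hn := next_mem (hgt p hp)
      exact absurd (hmax _ hn.1 (hbd _ hn.1 hlt)) (not_le.2 hn.2)
    have hpn := hnext p hp
    rw [hnp] at hpn
    rcases hαp.eq_or_lt with rfl | hαp
    · exact hpn
    rcases cof_eq_or_lt (hlim p hp (pos_of_gt hαp).ne') with hpc | hpc
    · rw [ty_Ico_add hαp.le hpβ.le, hpn, ih p hpβ hp hpc α hα hαp, hadd α hα _ (hS p hp hpc)]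
    · obtain ⟨D, hDJ, hD, hDt, c, hc, hαc, hcc, e⟩ := hcol p hp hpc α hαp
      have hcp := hD.1 hc
      have hcβ : ty n (Ico c β) Y = h c := by
        rw [ty_Ico_add (le_of_lt hcp) hpβ.le, hpn, ty_Ico_club hD hpc.le hc, ← e]
        congr 1
        refine lsum_congr fun x hx => ?_
        obtain ⟨y, hy, hxy, hyp⟩ := hD.exists_gt hpc.le (hD.1 hx.1)
        have hn := next_mem ⟨y, hy, hxy⟩
        exact ih _ (((next_le hy hxy).trans_lt hyp).trans hpβ) (hDJ hn.1)
          (next_cof hDt ⟨y, hy, hxy⟩) x (hDJ hx.1) hn.2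
      rw [ty_Ico_add hαc.le (lt_trans hcp hpβ).le, hcβ,
        ih c (lt_trans hcp hpβ) (hDJ hc) hcc α hα hαc, hadd α hα _ (hS c (hDJ hc) hcc)]

lemma rt_eq_of_next [Finite ι] (hlam : Reg lam) (hJ : IsClubIn J lam) (hthin : Thin J)
    (hlim : ∀ β ∈ J, β ≠ 0 → ℵ₀ ≤ β.cof)
    (hnext : ∀ α ∈ J, ty n (Ico α (next J α)) Y = h α)
    (hS : ∀ k ∈ J, k.cof = ℵ₀ → h k ∈ S)
    (hadd : ∀ i ∈ J, ∀ t ∈ S, add (h i) t = h i)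
    (hsum : ∀ f : ℕ → Ty n ι, (∃ i ∈ J, f 0 = h i) → (∀ k, f (k + 1) ∈ S) → lsum n univ f = f 0)
    (hcol : ∀ δ ∈ J, ℵ₀ < δ.cof → ∀ α < δ, ∃ D ⊆ J, IsClubIn D δ ∧ Thin D ∧
      ∃ c ∈ D, α < c ∧ c.cof = ℵ₀ ∧ add (lsum n (D ∩ Ici c) h) (h δ) = h c) :
    ∀ α ∈ J, h α = rt lam n Y α := fun α hα =>
  eq_rt hlam hJ (hJ.1 hα) fun β hβ hc hαβ =>
    homogeneous_of_next hlam.1 hJ hthin hlim hnext hS hadd hsum hcol β hβ hc α hα hαβ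

end Propagation

section Similar

open Cardinal Set

variable {ι κ κ' : Type} {A X Y Z : ι → Set Ordinal.{0}} {α β γ δ lam : Ordinal.{0}} {n N : ℕ}
  {b J J' K K' : Set Ordinal.{0}} {c c' : Ordinal.{0} → κ}

lemma col_congr (h : ∀ x ∈ b, c x = c' x) : col c b = col c' b := by
  funext k
  ext x
  exact and_congr_right fun hx => by rw [h x hx]

/-- The colourings `c` and `c'` have the same type along `b`, up to restriction to clubs. -/
def Sim (lam : Ordinal.{0}) (N : ℕ) (b : Set Ordinal.{0}) (c c' : Ordinal.{0} → κ) : Prop :=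
  ∃ J J', IsClubIn J lam ∧ IsClubIn J' lam ∧
    ty N (Iio lam) (col c (b ∩ J)) = ty N (Iio lam) (col c' (b ∩ J'))

lemma Sim.symm (h : Sim lam N b c c') : Sim lam N b c' c :=
  let ⟨J, J', hJ, hJ', e⟩ := h
  ⟨J', J, hJ', hJ, e.symm⟩

lemma Sim.of_le {M : ℕ} (hM : N ≤ M) (h : Sim lam M b c c') : Sim lam N b c c' :=
  let ⟨J, J', hJ, hJ', e⟩ := h
  ⟨J, J', hJ, hJ', ty_of_le hM e⟩

lemma Sim.restrict (h : Sim lam (N + 4) b c c') (hlam : ℵ₀ < lam.cof) (hK : IsClubIn K lam) :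
    ∃ K₁ ⊆ K, ∃ K₂, IsClubIn K₁ lam ∧ IsClubIn K₂ lam ∧
      ty N (Iio lam) (col c (b ∩ K₁)) = ty N (Iio lam) (col c' (b ∩ K₂)) := by
  obtain ⟨J, J', hJ, hJ', e⟩ := h
  have hJK := hJ.inter hK hlam
  obtain ⟨K', hK', e'⟩ := exists_set e (J ∩ K)
  have hc := club_transfer (i := none) e' (by
    rwa [extend_none, inter_eq_left.2 hJK.1])
  rw [extend_none, inter_eq_left.2 hK'] at hc
  refine ⟨J ∩ K, inter_subset_right, J' ∩ K', hJK, hJ'.inter hc hlam, ?_⟩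
  have := ty_pull (fun k : κ => {s | none ∈ s ∧ some k ∈ s}) (ty_of_le (Nat.le_add_right N 3) e')
  convert this using 2
  · ext k x
    change (x ∈ b ∩ (J ∩ K)) ∧ _ ↔ x ∈ J ∩ K ∧ (x ∈ b ∩ J) ∧ _
    simp only [mem_inter_iff]
    tauto
  · ext k x
    change (x ∈ b ∩ (J' ∩ K')) ∧ _ ↔ x ∈ K' ∧ (x ∈ b ∩ J') ∧ _
    simp only [mem_inter_iff]
    tauto

section Facts

variable {g : Ordinal.{0} → Ty n ι}

lemma mem_types_of_col (h : ty (N + 6) (Iio lam) (col (rt lam n Z) (b ∩ K)) =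
      ty (N + 6) (Iio lam) (col g (b ∩ K'))) (hα : α ∈ b ∩ K') (hαl : α < lam)
    (hc : α.cof = ℵ₀) : g α ∈ types n K (rt lam n Z) := by
  obtain ⟨x, hx, e⟩ := exists_point h.symm hαl
  have p := (mem_iff_of_prof (prof_eq_of_point e (i := none) hαl rfl rfl) (some (g α))).1 ⟨hα, rfl⟩
  exact ⟨x, p.1.2, cof_transfer (ty_Iio_cut (i := none) e hαl hx rfl rfl) hc, p.2⟩

lemma add_lsum_eq_of_col (hK : Nice lam n Z K)
    (hN : ∀ (E E' : Set Ordinal.{0}) (f f' : Ordinal.{0} → Ty n ι),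
      ty N E (col f univ) = ty N E' (col f' univ) → lsum n E f = lsum n E' f')
    (hlam : ℵ₀ < lam.cof) (h : ty (N + 10) (Iio lam) (col (rt lam n Z) (b ∩ K)) =
      ty (N + 10) (Iio lam) (col g (b ∩ K'))) (hδ : δ ∈ b ∩ K') (hδl : δ < lam) (hδc : ℵ₀ < δ.cof)
    {D : Set Ordinal.{0}} (hD : D ⊆ b ∩ K') (hDc : IsClubIn D δ) (hDt : Thin D)
    {c : Ordinal.{0}} (hc : c ∈ D) :
    add (lsum n (D ∩ Ici c) g) (g δ) = g c := by
  have hcδ := hDc.1 hc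
  obtain ⟨D₀, -, e₁⟩ := exists_set h.symm D
  obtain ⟨δ₀, hδ₀, e₂⟩ := exists_point e₁ (x := δ) hδl
  have hpδ := prof_eq_of_point e₂ (i := none) hδl rfl rfl
  obtain ⟨c₀, hc₀, e₃⟩ := exists_point e₂ (x := c) (hcδ.trans hδl)
  have hpc := prof_eq_of_point e₃ (i := none) (hcδ.trans hδl) rfl rfl
  have hlt : c₀ < δ₀ := lt_of_points e₃ (i := none) (j := some none) (hcδ.trans hδl) hδl rfl rfl
    rfl rfl hcδ
  have e₄ := ty_Iio_cut (i := some none) e₃ hδl hδ₀ rfl rfl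
  have hD' : D ∩ Iio δ = D := inter_eq_left.2 hDc.1
  have hDc₀ : IsClubIn (D₀ ∩ Iio δ₀) δ₀ := club_transfer (n := N + 3) (i := some (some none)) e₄ (by
    change IsClubIn (D ∩ Iio δ) δ
    rwa [hD'])
  have hDt₀ : Thin (D₀ ∩ Iio δ₀) := thin_transfer (i := some (some none)) e₄ (by
    change Thin (D ∩ Iio δ)
    rwa [hD'])
  have hmδ := (mem_iff_of_prof hpδ (some (some (g δ)))).1 ⟨hδ, rfl⟩
  have hmc := (mem_iff_of_prof hpc (some (some (some (g c))))).1 ⟨hD hc, rfl⟩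
  have hmD := (mem_iff_of_prof hpc (some (some none))).1 hc
  have hsub : D₀ ∩ Iio δ₀ ⊆ b ∩ K := fun x hx => by
    obtain ⟨y, hy, p⟩ := exists_prof_eq e₄.symm hx.2
    have hyD : y ∈ D := (mem_iff_of_prof p (some (some none))).1 hx.1
    exact ((mem_iff_of_prof p (some (some (some (g y))))).2 ⟨hD hyD, rfl⟩).1
  have hδ₀c : ℵ₀ < δ₀.cof := (cof_eq_or_lt (hK.limit _ hmδ.1.2)).resolve_left fun h =>
    hδc.ne' (cof_transfer (n := N + 2) e₄.symm h)
  have key := hK.add_lsum_eq hlam hδ₀ hδ₀c (hsub.trans inter_subset_right) hDc₀ hDt₀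
    (c := c₀) ⟨hmD, hlt⟩
  rw [hmδ.2, hmc.2] at key
  rw [← key]
  congr 1
  refine hN _ _ _ _ ?_
  have e₅ := (ty_cut e₄ (i := none) (x' := c₀) hlt rfl rfl).2
  have e₆ := ty_pull (fun k : Ty n ι => {s | some (some (some k)) ∈ s})
    (ty_restrict {s | some (some none) ∈ s} e₅)
  refine (Eq.trans ?_ (ty_of_le (Nat.le_add_right N 5) e₆)).trans ?_
  · have : {x ∈ Iio δ ∩ Ici c | x ∈ D} = D ∩ Ici c := by
      ext x
      exact ⟨fun h => ⟨h.2, h.1.2⟩, fun h => ⟨⟨hDc.1 h.1, h.2⟩, h.1⟩⟩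
    change _ = ty N {x ∈ Iio δ ∩ Ici c | x ∈ D} (col g (b ∩ K'))
    rw [this]
    exact ty_congr fun i x hx => and_congr_left fun _ => ⟨fun _ => hD hx.1, fun _ => trivial⟩
  · have : {x ∈ Iio δ₀ ∩ Ici c₀ | x ∈ D₀} = (D₀ ∩ Iio δ₀) ∩ Ici c₀ := by
      ext x
      exact ⟨fun h => ⟨⟨h.2, h.1.1⟩, h.1.2⟩, fun h => ⟨⟨h.1.2, h.2⟩, h.1.1⟩⟩
    change ty N {x ∈ Iio δ₀ ∩ Ici c₀ | x ∈ D₀} (col (rt lam n Z) (b ∩ K)) = _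
    rw [this]
    exact ty_congr fun i x hx => and_congr_left fun _ => ⟨fun _ => trivial, fun _ => hsub hx.1⟩

end Facts

lemma rt_extend_mem [Finite ι] (hlam : Reg lam) (hα : α < lam) (Q : Set Ordinal.{0}) :
    rt lam n (extend X Q) α ∈ (show Set (Ty n (Option ι)) from rt lam (n + 1) X α) := by
  obtain ⟨J, hJ, h⟩ := exists_homogeneous_rt hlam n (extend X Q)
  obtain ⟨J', hJ', h'⟩ := exists_homogeneous_rt hlam (n + 1) X
  obtain ⟨β, hβ, h1, h2, h3⟩ := (hJ.inter hJ' hlam.1).exists_cof_eq hlam.1 hα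
  rw [← h β hβ.1 h3 α h1, ← h' β hβ.2 h3 α h1]
  exact ⟨Q, rfl⟩

lemma exists_glue (R : Ordinal.{0} → Set Ordinal.{0}) :
    ∃ Q : Set Ordinal.{0}, ∀ α ∈ J, ∀ x ∈ Ico α (next J α), x ∈ Q ↔ x ∈ R α := by
  refine ⟨{x | ∃ α ∈ J, x ∈ Ico α (next J α) ∧ x ∈ R α}, fun α hα x hx =>
    ⟨fun ⟨β, hβ, hxβ, h⟩ => ?_, fun h => ⟨α, hα, hx, h⟩⟩⟩
  have key : ∀ {α β}, α ∈ J → β ∈ J → x ∈ Ico α (next J α) → x ∈ Ico β (next J β) → ¬ α < β :=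
    fun _ hβ hx hx' hlt => absurd ((next_le hβ hlt).trans hx'.1) (not_le.2 hx.2)
  rcases lt_trichotomy α β with hlt | rfl | hlt
  · exact absurd hlt (key hα hβ hx hxβ)
  · exact h
  · exact absurd hlt (key hβ hα hxβ hx)

lemma ty_zero_Iio [Finite ι] (hlam : Reg lam) (X : ι → Set Ordinal.{0}) :
    ty 0 (Iio lam) X = rt lam 0 X 0 := by
  obtain ⟨J, hJ, h⟩ := exists_homogeneous_rt hlam 0 X
  have hpos : 0 < lam := pos_of_ne_zero (limit_iff.1 hlam.1.le).1
  have key : ∀ x < lam, ∃ β, x < β ∧ β < lam ∧ ty 0 (Ico 0 β) X = rt lam 0 X 0 := fun x hx =>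
    let ⟨β, hβ, h1, h2, h3⟩ := hJ.exists_cof_eq hlam.1 hx
    ⟨β, h1, h2, h β hβ h3 0 (pos_of_gt h1)⟩
  obtain ⟨β, -, hβ, e⟩ := key 0 hpos
  refine Prod.ext (Subset.antisymm ?_ ?_) (Subset.antisymm ?_ ?_)
  · rintro _ ⟨x, hx, rfl⟩
    obtain ⟨γ, h1, -, e⟩ := key x hx
    rw [← e]
    exact ⟨x, ⟨zero_le, h1⟩, rfl⟩
  · rw [← e]
    rintro _ ⟨x, hx, rfl⟩
    exact ⟨x, hx.2.trans hβ, rfl⟩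
  · rintro _ ⟨x, hx, y, hy, hxy, rfl⟩
    obtain ⟨γ, h1, -, e⟩ := key y hy
    rw [← e]
    exact ⟨x, ⟨zero_le, hxy.trans h1⟩, y, ⟨zero_le, h1⟩, hxy, rfl⟩
  · rw [← e]
    rintro _ ⟨x, hx, y, hy, hxy, rfl⟩
    exact ⟨x, hx.2.trans hβ, y, hy.2.trans hβ, hxy, rfl⟩

end Similar

section Main

open Cardinal Set

variable {ι κ κ' : Type} {X Y : ι → Set Ordinal.{0}} {α lam : Ordinal.{0}} {n N : ℕ}
  {a b J K : Set Ordinal.{0}}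

/-- Every point of uncountable cofinality has a club contained in `a` or in its complement, as
the point itself. -/
def SemiClosed (a : Set Ordinal.{0}) (lam : Ordinal.{0}) : Prop :=
  ∀ δ < lam, ℵ₀ < δ.cof → ∃ c, IsClubIn c δ ∧ ∀ x ∈ c, x ∈ a ↔ δ ∈ a

lemma exists_response [Finite κ'] {r r' : Ordinal.{0} → κ}
    (h : Sim lam (N + Nat.card κ' + 4) b r r') (hlam : ℵ₀ < lam.cof) (hK : IsClubIn K lam)
    (c : Ordinal.{0} → κ') :
    ∃ K₁ ⊆ K, ∃ K₂, ∃ g : Ordinal.{0} → κ', IsClubIn K₁ lam ∧ IsClubIn K₂ lam ∧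
      ty N (Iio lam) (col (fun x => (r x, c x)) (b ∩ K₁)) =
        ty N (Iio lam) (col (fun x => (r' x, g x)) (b ∩ K₂)) := by
  obtain ⟨K₁, hK₁, K₂, h1, h2, e⟩ := h.restrict hlam hK
  obtain ⟨g, e'⟩ := exists_col e c
  exact ⟨K₁, hK₁, K₂, g, h1, h2, e'⟩

lemma exists_extend_eq (hlam : ℵ₀ < lam.cof) (hJ : IsClubIn J lam) (hJt : Thin J)
    (hom : ∀ β ∈ J, β.cof = ℵ₀ → ∀ α < β, ty (n + 1) (Ico α β) Y = rt lam (n + 1) Y α)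
    {g : Ordinal.{0} → Ty n (Option ι)}
    (hg : ∀ α ∈ J, g α ∈ (show Set (Ty n (Option ι)) from rt lam (n + 1) Y α)) :
    ∃ R, ∀ α ∈ J, ty n (Ico α (next J α)) (extend Y R) = g α := by
  have : ∀ α ∈ J, ∃ B : Set Ordinal.{0}, g α = ty n (Ico α (next J α)) (extend Y B) := by
    intro α hα
    obtain ⟨y, hy, hαy, -⟩ := hJ.exists_gt hlam.le (hJ.1 hα)
    have hn := next_mem ⟨y, hy, hαy⟩
    have := hg α hα
    rw [← hom _ hn.1 (next_cof hJt ⟨y, hy, hαy⟩) α hn.2] at this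
    exact this
  choose! B hB using this
  obtain ⟨R, hR⟩ := exists_glue (J := J) B
  refine ⟨R, fun α hα => ?_⟩
  rw [hB α hα]
  refine ty_congr fun i x hx => ?_
  cases i with
  | none => exact hR α hα x hx
  | some i => exact Iff.rfl

lemma ty_extend_of_sim [Finite ι] {N₁ N₂ : ℕ}
    (ih : ∀ {lam : Ordinal.{0}}, Reg lam → ∀ {a : Set Ordinal.{0}}, SemiClosed a lam →
      ∀ X Y : Option ι → Set Ordinal.{0}, rt lam n X 0 = rt lam n Y 0 →
        Sim lam N₁ a (rt lam n X) (rt lam n Y) → Sim lam N₁ aᶜ (rt lam n X) (rt lam n Y) →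
          ty n (Iio lam) X = ty n (Iio lam) Y)
    (hN₂ : ∀ (E E' : Set Ordinal.{0}) (f f' : Ordinal.{0} → Ty n (Option ι)),
      ty N₂ E (col f univ) = ty N₂ E' (col f' univ) → lsum n E f = lsum n E' f')
    (hlam : Reg lam) (ha : SemiClosed a lam) (h0 : rt lam (n + 1) X 0 = rt lam (n + 1) Y 0)
    (h : Sim lam (N₁ + N₂ + 10 + Nat.card (Ty n (Option ι)) + 4) a
      (rt lam (n + 1) X) (rt lam (n + 1) Y))
    (h' : Sim lam (N₁ + N₂ + 10 + Nat.card (Ty n (Option ι)) + 4) aᶜ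
      (rt lam (n + 1) X) (rt lam (n + 1) Y)) (Q : Set Ordinal.{0}) :
    ∃ R, ty n (Iio lam) (extend X Q) = ty n (Iio lam) (extend Y R) := by
  classical
  have hpos : 0 < lam := pos_of_ne_zero (limit_iff.1 hlam.1.le).1
  set Z := extend X Q with hZ
  obtain ⟨K, hK⟩ := exists_nice hlam n Z
  obtain ⟨KY, hKY⟩ := exists_nice hlam (n + 1) Y
  have hB : ∀ p : Bool, Sim lam (N₁ + N₂ + 10 + Nat.card (Ty n (Option ι)) + 4)
      {x | x ∈ a ↔ p = true} (rt lam (n + 1) X) (rt lam (n + 1) Y) := by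
    rintro (_ | _)
    · convert h' using 1
      ext x
      simp
    · convert h using 1
      ext x
      simp
  choose K₁ hK₁ K₂ g hK₁c hK₂c e using fun p =>
    exists_response (hB p) hlam.1 hK.club (rt lam n Z)
  have e' := fun p => ty_col_map Prod.snd (e p)
  have hN := fun p => hK.mono (hK₁c p) (hK₁ p)
  obtain ⟨L₀, hL₀c, hL₀⟩ := exists_club_subset hlam.1 hK₂c
  obtain ⟨L, hL, hLc, hLt, hLl⟩ := exists_thin (hL₀c.inter hKY.club hlam.1) hlam.1
  have hLb : ∀ α ∈ L, α ∈ {x | x ∈ a ↔ decide (α ∈ a) = true} ∩ K₂ (decide (α ∈ a)) := fun α hα =>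
    ⟨by simp, hL₀ _ (hL hα).1⟩
  have hL0 : ∀ α ∈ L, α ≠ 0 := fun α hα => (limit_iff.1 (hLl α hα)).1
  let G : Ordinal.{0} → Ty n (Option ι) := fun α =>
    if α = 0 then rt lam n Z 0 else g (decide (α ∈ a)) α
  have hG : ∀ α ∈ L, G α = g (decide (α ∈ a)) α := fun α hα => if_neg (hL0 α hα)
  have hG0 : G 0 = rt lam n Z 0 := if_pos rfl
  have hpre : ∀ α ∈ insert 0 L, ∃ i < lam, rt lam (n + 1) X i = rt lam (n + 1) Y α ∧
      rt lam n Z i = G α := by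
    rintro α (rfl | hα)
    · exact ⟨0, hpos, h0, hG0.symm⟩
    · obtain ⟨i, hi, -, hie⟩ := exists_same_col (e _).symm (hLc.1 hα) (hLb α hα)
      rw [hG α hα]
      exact ⟨i, hi, congrArg Prod.fst hie, congrArg Prod.snd hie⟩
  have hJc := hLc.insert_zero hpos
  obtain ⟨R, hR⟩ := exists_extend_eq (Y := Y) (g := G) hlam.1 hJc hLt.insert_zero (by
      rintro β (rfl | hβ) hc α hα
      · exact absurd hα not_lt_zero
      · exact hKY.hom β (hL hβ).2 hc α hα)
    (by
      intro α hα
      obtain ⟨i, hi, h1, h2⟩ := hpre α hα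
      rw [← h2, ← h1]
      exact rt_extend_mem hlam hi Q)
  have key := rt_eq_of_next (S := types n K (rt lam n Z)) hlam hJc hLt.insert_zero
    (by
      rintro β (rfl | hβ) hne
      · exact absurd rfl hne
      · exact hLl β hβ) hR
    (by
      rintro k (rfl | hk) hc
      · exact absurd rfl (limit_iff.1 hc.ge).1
      · rw [hG k hk]
        obtain ⟨x, hx, hx'⟩ := mem_types_of_col (N := N₁ + N₂ + 4) (e' _) (hLb k hk) (hLc.1 hk) hc
        exact ⟨x, hK₁ _ hx, hx'⟩)
    (by
      intro i hi t ht
      obtain ⟨j, hj, -, hje⟩ := hpre i hi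
      rw [← hje]
      exact hK.add_eq hlam.1 hj ht)
    (by
      rintro f ⟨i, hi, hf⟩ hS
      obtain ⟨j, hj, -, hje⟩ := hpre i hi
      exact hK.lsum_nat_eq hlam.1 hj (hf.trans hje.symm) hS)
    (by
      intro δ hδ hδc α hα
      rcases hδ with rfl | hδ
      · exact absurd hα not_lt_zero
      obtain ⟨c, hc, hca⟩ := ha δ (hLc.1 hδ) hδc
      have hLδ : IsClubIn (L ∩ Iio δ) δ :=
        ⟨inter_subset_right, fun x hx =>
          let ⟨γ, hγ, h1, h2⟩ := hLt δ hδ hδc.ne' x hx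
          ⟨γ, ⟨hγ, h2⟩, h1.le⟩, fun x hx hx0 hacc =>
          ⟨hLc.mem_of_acc (hx.trans (hLc.1 hδ)) (Acc.mono ⟨hx0, hacc⟩ inter_subset_left), hx⟩⟩
      obtain ⟨D, hD, hDc, hDt, -⟩ := exists_thin (hc.inter hLδ hδc) hδc
      have hDL : D ⊆ L := fun x hx => (hD hx).2.1
      obtain ⟨x, hx, h1, h2, h3⟩ := hDc.exists_cof_eq hδc hα
      refine ⟨D, hDL.trans (subset_insert _ _), hDc, hDt, x, hx, h1, h3, ?_⟩
      have hdec : ∀ y ∈ D, decide (y ∈ a) = decide (δ ∈ a) := fun y hy =>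
        decide_eq_decide.2 (hca y (hD hy).1)
      have hGD : ∀ y ∈ D, G y = g (decide (δ ∈ a)) y := fun y hy => by
        rw [hG y (hDL hy), hdec y hy]
      rw [hG δ hδ, hGD x hx, lsum_congr fun y hy => hGD y hy.1]
      refine add_lsum_eq_of_col (N := N₂) (hN _) hN₂ hlam.1 (ty_of_le (by omega) (e' _)) (hLb δ hδ)
        (hLc.1 hδ) hδc (fun y hy => ?_) hDc hDt hx
      have := hLb y (hDL hy)
      rw [hdec y hy] at this
      exact this)
  refine ⟨R, ih hlam ha _ _ ?_ ?_ ?_⟩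
  · rw [← hG0, key 0 (mem_insert _ _)]
  all_goals
    have hsim : ∀ p : Bool, Sim lam N₁ {x | x ∈ a ↔ p = true} (rt lam n Z)
        (rt lam n (extend Y R)) := by
      intro p
      have : Sim lam (N₁ + 4) {x | x ∈ a ↔ p = true} (rt lam n Z) (g p) :=
        Sim.of_le (by omega) ⟨K₁ p, K₂ p, hK₁c p, hK₂c p, e' p⟩
      obtain ⟨L₁, hL₁, L₂, hL₁c, hL₂c, eq⟩ := this.symm.restrict hlam.1 hLc
      refine ⟨L₂, L₁, hL₂c, hL₁c, eq.symm.trans (congrArg _ (col_congr fun x hx => ?_))⟩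
      rw [← key x (Or.inr (hL₁ hx.2)), hG x (hL₁ hx.2)]
      congr
      rw [Bool.eq_iff_iff, decide_eq_true_iff]
      exact hx.1.symm
  · simpa using hsim true
  · simpa [compl_def] using hsim false

/-- The type of a tuple on `lam` is determined by its eventual type at `0` and by the types, along
a semi-club and its complement, of the colourings given by the eventual types. -/
theorem exists_ty_eq_of_sim (n : ℕ) : ∀ (ι : Type) [Finite ι], ∃ N : ℕ,
    ∀ {lam : Ordinal.{0}}, Reg lam → ∀ {a : Set Ordinal.{0}}, SemiClosed a lam →
      ∀ X Y : ι → Set Ordinal.{0}, rt lam n X 0 = rt lam n Y 0 →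
        Sim lam N a (rt lam n X) (rt lam n Y) → Sim lam N aᶜ (rt lam n X) (rt lam n Y) →
          ty n (Iio lam) X = ty n (Iio lam) Y := by
  induction n with
  | zero =>
    refine fun ι _ => ⟨0, fun hlam a _ X Y h _ _ => ?_⟩
    rw [ty_zero_Iio hlam X, h, ty_zero_Iio hlam Y]
  | succ n ih =>
    intro ι _
    obtain ⟨N₁, ih⟩ := ih (Option ι)
    obtain ⟨N₂, hN₂⟩ := exists_lsum_eq n (Option ι)
    refine ⟨_, fun hlam a ha X Y h0 h h' => ty_succ_eq_iff.2
      ⟨ty_extend_of_sim ih hN₂ hlam ha h0 h h',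
        ty_extend_of_sim ih hN₂ hlam ha h0.symm h.symm h'.symm⟩⟩

end Main

section Definable

open Cardinal Set

variable {ι : Type} {P P' : ι → Set Ordinal.{0}} {lam : Ordinal.{0}} {n N : ℕ}
  {a a' J J' : Set Ordinal.{0}}

/-- The tuple consisting of `P`, `a`, the sets defined by the eventual types of `P`, and `J`. -/
noncomputable def expand (lam : Ordinal.{0}) (n : ℕ) (P : ι → Set Ordinal.{0})
    (a J : Set Ordinal.{0}) : Option (Option ι ⊕ Ty n ι) → Set Ordinal.{0} :=
  extend (Sum.elim (extend P a) (col (rt lam n P) univ)) J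

/-- The eventual types are definable from a club on which they are attained. -/
lemma exists_expand_eq [Finite ι] (hlam : Reg lam)
    (h : ty (N + n + 9 + Nat.card (Ty n ι)) (Iio lam) (extend P a) =
      ty (N + n + 9 + Nat.card (Ty n ι)) (Iio lam) (extend P' a'))
    (hJ : IsClubIn J lam) (hom : Homogeneous n P J (rt lam n P)) :
    ∃ J', IsClubIn J' lam ∧
      ty N (Iio lam) (expand lam n P a J) = ty N (Iio lam) (expand lam n P' a' J') := by
  obtain ⟨c, e⟩ := exists_coloring h (rt lam n P)
  obtain ⟨J', hJ's, e⟩ := exists_set (n := N + n + 8) e J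
  have hJ' : IsClubIn J' lam := by
    have := club_transfer (n := N + n + 5) (i := none) e
      (by rwa [extend_none, inter_eq_left.2 hJ.1])
    rwa [extend_none, inter_eq_left.2 hJ's] at this
  refine ⟨J', hJ', (ty_of_le (by omega) e).trans (ty_congr fun i x hx => ?_)⟩
  have hc : ∀ x < lam, c x = rt lam n P' x := by
    intro x hx
    refine eq_rt hlam hJ' hx fun y hy hyc hxy => ?_
    have hyl := hJ'.1 hy
    obtain ⟨z, hz, e₁⟩ := exists_point (n := N + n + 7) e.symm hx
    obtain ⟨w, hw, e₂⟩ := exists_point (n := N + n + 6) e₁ hyl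
    have hzw : z < w := lt_of_points e₂ (i := some none) (j := none) hx hyl rfl rfl rfl rfl hxy
    have p := prof_eq_of_point e₁ (i := none) hx rfl rfl
    have hxz : rt lam n P z = c x :=
      ((mem_iff_of_prof p (some (some (Sum.inr (c x))))).1 ⟨trivial, rfl⟩).2
    have p' := prof_eq_of_point e₂ (i := none) hyl rfl rfl
    have hwJ : w ∈ J := (mem_iff_of_prof p' (some (some none))).1 hy
    have e₃ := ty_Iio_cut (n := N + n + 5) (i := none) e₂ hyl hw rfl rfl
    have hwc := cof_transfer (n := N + n + 1) e₃ hyc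
    have e₄ := (ty_cut (n := N + n + 4) (i := some none) e₃ hzw rfl rfl).2
    have e₅ := ty_reindex (fun i : ι => some (some (some (Sum.inl (some i)))))
      (ty_of_le (n := n) (by omega) e₄)
    have hI : ∀ u v : Ordinal.{0}, Iio v ∩ Ici u = Ico u v := fun u v => by
      rw [inter_comm, Ici_inter_Iio]
    rw [hI, hI] at e₅
    exact (e₅.trans (hom w hwJ hwc z hzw)).trans hxz
  rcases i with _ | _ | k
  · exact Iff.rfl
  · exact Iff.rfl
  · change x ∈ Set.univ ∧ c x = k ↔ x ∈ Set.univ ∧ rt lam n P' x = k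
    rw [hc x hx]

lemma pull_expand_compl : pull (fun k : Ty n ι =>
      {s | (some (Sum.inl none) ∉ s ∧ none ∈ s) ∧ some (Sum.inr k) ∈ s}) (expand lam n P a J) =
    col (rt lam n P) (aᶜ ∩ J) := by
  ext k x
  change (x ∉ a ∧ x ∈ J) ∧ x ∈ Set.univ ∧ rt lam n P x = k ↔ (x ∉ a ∧ x ∈ J) ∧ rt lam n P x = k
  simp

lemma sim_compl_of_expand_eq
    (e : ty N (Iio lam) (expand lam n P a J) = ty N (Iio lam) (expand lam n P' a J'))
    (hJ : IsClubIn J lam) (hJ' : IsClubIn J' lam) :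
    Sim lam N aᶜ (rt lam n P) (rt lam n P') := by
  refine ⟨J, J', hJ, hJ', ?_⟩
  rw [← pull_expand_compl, ← pull_expand_compl]
  exact ty_pull _ e

lemma rt_eq_of_prof {x y : Ordinal.{0}}
    {B B' : Set Ordinal.{0}}
    (p : prof (extend (expand lam n P a J) B) x = prof (extend (expand lam n P' a' J') B') y) :
    rt lam n P x = rt lam n P' y :=
  ((mem_iff_of_prof p (some (some (Sum.inr (rt lam n P x))))).1 ⟨trivial, rfl⟩).2.symm

lemma rt_zero_of_expand_eq
    (e : ty (N + 2) (Iio lam) (expand lam n P a J) = ty (N + 2) (Iio lam) (expand lam n P' a' J'))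
    (hlam : 0 ∈ Iio lam) : rt lam n P 0 = rt lam n P' 0 := by
  obtain ⟨y, hy, e₁⟩ := exists_point e hlam
  obtain rfl := zero_transfer (ty_Iio_cut (i := none) e₁ hlam hy rfl rfl)
  exact rt_eq_of_prof (prof_eq_of_point e₁ (i := none) hlam rfl rfl)

lemma types_subset_of_expand_eq
    (e : ty (N + 6) (Iio lam) (expand lam n P a J) = ty (N + 6) (Iio lam) (expand lam n P' a' J'))
    (hJ : J ⊆ Iio lam) : types n J (rt lam n P) ⊆ types n J' (rt lam n P') := by
  rintro t ⟨x, hx, hxc, rfl⟩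
  obtain ⟨y, hy, e₁⟩ := exists_point e (hJ hx)
  have p := prof_eq_of_point e₁ (i := none) (hJ hx) rfl rfl
  exact ⟨y, (mem_iff_of_prof p (some none)).1 hx,
    cof_transfer (ty_Iio_cut (i := none) e₁ (hJ hx) hy rfl rfl) hxc, (rt_eq_of_prof p).symm⟩

end Definable

section Shuffle

open Cardinal Set Ordinal

variable {ι : Type} {lam i j α β : Ordinal.{0}} {n : ℕ} {a c e J K : Set Ordinal.{0}}

lemma enumOrd_le' (hβ : β ∈ J) (h : ∀ j < i, enumOrd J j < β) : enumOrd J i ≤ β := by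
  rw [enumOrd]
  exact csInf_le' ⟨hβ, h⟩

lemma enumOrd_mem_and_lt (hlam : Reg lam) (hJ : IsClubIn J lam) :
    ∀ i, i < lam → enumOrd J i ∈ J ∧ ∀ j < i, enumOrd J j < enumOrd J i := by
  intro i
  induction i using WellFoundedLT.induction with
  | ind i ih =>
    intro hi
    obtain ⟨β, hβ, hb⟩ := hlam.exists_bound hi (f := enumOrd J)
      fun j hj => hJ.1 (ih j hj (hj.trans hi)).1
    obtain ⟨γ, hγ, h⟩ := hJ.2.1 β hβ
    have := csInf_mem (s := J ∩ {b | ∀ j, j < i → enumOrd J j < b})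
      ⟨γ, hγ, fun j hj => (hb j hj).trans_le h⟩
    rw [← enumOrd] at this
    exact this

lemma enumOrd_mem' (hlam : Reg lam) (hJ : IsClubIn J lam)
    (hi : i < lam) : enumOrd J i ∈ J := (enumOrd_mem_and_lt hlam hJ i hi).1

lemma enumOrd_lt_iff (hlam : Reg lam) (hJ : IsClubIn J lam)
    (hi : i < lam) (hj : j < lam) : enumOrd J i < enumOrd J j ↔ i < j := by
  refine ⟨fun h => ?_, fun h => (enumOrd_mem_and_lt hlam hJ j hj).2 i h⟩
  by_contra hij
  rcases (not_lt.1 hij).eq_or_lt with rfl | hij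
  · exact h.false
  · exact h.asymm ((enumOrd_mem_and_lt hlam hJ i hi).2 j hij)

lemma enumOrd_inj' (hlam : Reg lam) (hJ : IsClubIn J lam)
    (hi : i < lam) (hj : j < lam) (h : enumOrd J i = enumOrd J j) : i = j := by
  rcases lt_trichotomy i j with hij | hij | hij
  · exact absurd h ((enumOrd_lt_iff hlam hJ hi hj).2 hij).ne
  · exact hij
  · exact absurd h ((enumOrd_lt_iff hlam hJ hj hi).2 hij).ne'

lemma le_enumOrd' (hlam : Reg lam) (hJ : IsClubIn J lam) :
    ∀ i, i < lam → i ≤ enumOrd J i := by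
  intro i
  induction i using WellFoundedLT.induction with
  | ind i ih =>
    intro hi
    by_contra! h
    exact (ih _ h (h.trans hi)).not_gt ((enumOrd_mem_and_lt hlam hJ i hi).2 _ h)

lemma exists_enumOrd_eq (hlam : Reg lam) (hJ : IsClubIn J lam)
    (hβ : β ∈ J) : ∃ i < lam, enumOrd J i = β := by
  have hex : ∃ i, i ≤ β ∧ β ≤ enumOrd J i := ⟨β, le_rfl, le_enumOrd' hlam hJ β (hJ.1 hβ)⟩
  obtain ⟨i, ⟨h1, h2⟩, hmin⟩ := WellFounded.has_min (wellFounded_lt (α := Ordinal.{0}))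
    {i | i ≤ β ∧ β ≤ enumOrd J i} hex
  exact ⟨i, h1.trans_lt (hJ.1 hβ), (enumOrd_le' hβ fun j hj =>
    not_le.1 fun h => hmin j ⟨hj.le.trans h1, h⟩ hj).antisymm h2⟩

lemma next_enumOrd (hlam : Reg lam) (hJ : IsClubIn J lam)
    (hi : i < lam) : next J (enumOrd J i) = enumOrd J (i + 1) := by
  have hi' := (limit_iff.1 hlam.1.le).2 i hi
  have hlt := (enumOrd_lt_iff hlam hJ hi hi').2 (Order.lt_add_one_iff.2 le_rfl)
  have hm := enumOrd_mem' hlam hJ hi'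
  refine (next_le hm hlt).antisymm (enumOrd_le' (next_mem ⟨_, hm, hlt⟩).1 fun j hj => ?_)
  refine lt_of_le_of_lt (not_lt.1 fun h => ?_) (next_mem ⟨_, hm, hlt⟩).2
  exact ((enumOrd_lt_iff hlam hJ hi (hj.trans hi')).1 h).not_ge (Order.lt_add_one_iff.1 hj)

lemma exists_lt_enumOrd (hlam : Reg lam) (hJ : IsClubIn J lam)
    (hi : i < lam) (hc : ℵ₀ ≤ i.cof) (hα : α < enumOrd J i) :
    ∃ j < i, α < enumOrd J j := by
  have hl := limit_iff.1 hc
  have h0 : 0 < i := pos_of_ne_zero hl.1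
  by_contra! h
  obtain ⟨γ, hγ, -, hγα, hmax⟩ := exists_greatest (δ := lam) (fun β hβ => hJ.mem_of_acc hβ)
    (enumOrd_mem' hlam hJ (h0.trans hi)) (h 0 h0) (hα.trans (hJ.1 (enumOrd_mem' hlam hJ hi)))
  obtain ⟨k, hk, rfl⟩ := exists_enumOrd_eq hlam hJ hγ
  have hki := hl.2 k ((enumOrd_lt_iff hlam hJ hk hi).1 (hγα.trans_lt hα))
  have := hmax _ (enumOrd_mem' hlam hJ (hki.trans hi)) (h _ hki)
  exact this.not_gt ((enumOrd_lt_iff hlam hJ hk (hki.trans hi)).2 (Order.lt_add_one_iff.2 le_rfl))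

lemma isClubIn_image_enumOrd (hlam : Reg lam) (hJ : IsClubIn J lam)
    (hi : i < lam) (hcof : ℵ₀ ≤ i.cof) (hc : IsClubIn c i) :
    IsClubIn (enumOrd J '' c) (enumOrd J i) := by
  refine ⟨?_, fun α hα => ?_, fun α hα h0 hacc => ?_⟩
  · rintro _ ⟨j, hj, rfl⟩
    exact (enumOrd_lt_iff hlam hJ ((hc.1 hj).trans hi) hi).2 (hc.1 hj)
  · obtain ⟨j, hj, h⟩ := exists_lt_enumOrd hlam hJ hi hcof hα
    obtain ⟨k, hk, hjk⟩ := hc.2.1 j hj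
    refine ⟨_, ⟨k, hk, rfl⟩, h.le.trans (not_lt.1 fun h' => ?_)⟩
    exact hjk.not_gt ((enumOrd_lt_iff hlam hJ ((hc.1 hk).trans hi) (hj.trans hi)).1 h')
  · have hαl := hα.trans (hJ.1 (enumOrd_mem' hlam hJ hi))
    have hαJ : α ∈ J := hJ.2.2 α hαl h0 fun β hβ => by
      obtain ⟨_, ⟨k, hk, rfl⟩, h⟩ := hacc β hβ
      exact ⟨_, enumOrd_mem' hlam hJ ((hc.1 hk).trans hi), h⟩
    obtain ⟨k, hk, rfl⟩ := exists_enumOrd_eq hlam hJ hαJ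
    have hki := (enumOrd_lt_iff hlam hJ hk hi).1 hα
    refine ⟨k, hc.2.2 k hki ?_ fun m hm => ?_, rfl⟩
    · rintro rfl
      obtain ⟨_, ⟨m, hm, rfl⟩, -, h⟩ := hacc 0 (pos_of_ne_zero h0)
      exact absurd ((enumOrd_lt_iff hlam hJ ((hc.1 hm).trans hi) hk).1 h) not_lt_zero
    · obtain ⟨_, ⟨x, hx, rfl⟩, h1, h2⟩ := hacc _ ((enumOrd_lt_iff hlam hJ (hm.trans hk) hk).2 hm)
      have hxl := (hc.1 hx).trans hi
      exact ⟨x, hx, (enumOrd_lt_iff hlam hJ (hm.trans hk) hxl).1 h1,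
        (enumOrd_lt_iff hlam hJ hxl hk).1 h2⟩

lemma aleph0_lt_cof_of_enumOrd (hlam : Reg lam) (hJ : IsClubIn J lam)
    (hthin : Thin J) (h0 : 0 ∈ J) (hi : i < lam)
    (hcof : ℵ₀ < (enumOrd J i).cof) : ℵ₀ < i.cof := by
  have hl : ℵ₀ ≤ i.cof := by
    refine limit_iff.2 ⟨?_, fun j hj => (Order.add_one_le_of_lt hj).lt_of_ne ?_⟩
    · rintro rfl
      have : enumOrd J 0 = 0 := le_zero_iff.1 (enumOrd_le' h0 fun j hj => absurd hj not_lt_zero)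
      rw [this] at hcof
      exact (limit_iff.1 hcof.le).1 rfl
    · rintro rfl
      rw [← next_enumOrd hlam hJ (hj.trans hi)] at hcof
      exact hcof.ne' (next_cof hthin ⟨_, enumOrd_mem' hlam hJ hi,
        (enumOrd_lt_iff hlam hJ (hj.trans hi) hi).2 hj⟩)
  refine (cof_eq_or_lt hl).resolve_left fun hω => hcof.ne' ?_
  obtain ⟨s, -, hs, -⟩ := exists_approaches_of_cof_eq hω (R := fun _ _ => True)
    (fun α hα b hb => ⟨max α b + 1, (le_max_left α b).trans_lt (Order.lt_add_one_iff.2 le_rfl),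
      (le_max_right α b).trans (Order.lt_add_one_iff.2 le_rfl).le,
      (limit_iff.1 hl).2 _ (max_lt hα hb), trivial⟩) (pos_of_ne_zero (limit_iff.1 hl).1)
  have hsl := fun k => (hs.2.1 k).trans hi
  refine Approaches.cof_eq (s := fun k => enumOrd J (s k))
    ⟨fun k m hkm => (enumOrd_lt_iff hlam hJ (hsl k) (hsl m)).2 (hs.1 hkm),
      fun k => (enumOrd_lt_iff hlam hJ (hsl k) hi).2 (hs.2.1 k), fun x hx => ?_⟩
  obtain ⟨j, hj, hxj⟩ := exists_lt_enumOrd hlam hJ hi hl hx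
  obtain ⟨k, hk⟩ := hs.2.2 j hj
  exact ⟨k, hxj.trans ((enumOrd_lt_iff hlam hJ (hj.trans hi) (hsl k)).2 hk)⟩

lemma exists_enumOrd_fixed (hlam : Reg lam) (hJ : IsClubIn J lam) :
    ∃ F ⊆ J, IsClubIn F lam ∧ ∀ i ∈ F, enumOrd J i = i := by
  obtain ⟨F, hF, h⟩ := hlam.exists_closure (f := fun x _ => enumOrd J x)
    fun x hx _ _ => hJ.1 (enumOrd_mem' hlam hJ hx)
  exact ⟨J ∩ F, inter_subset_left, hJ.inter hF hlam.1, fun i hi =>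
    (enumOrd_le' hi.1 fun j hj => h i hi.2 j hj j hj).antisymm (le_enumOrd' hlam hJ i (hJ.1 hi.1))⟩

lemma mem_shuffleSet_iff (hlam : Reg lam) (hJ : IsClubIn J lam)
    (ha : a ⊆ Iio lam) (hi : i < lam) {P Q : Set Ordinal.{0}}
    (hα : α ∈ Ico (enumOrd J i) (next J (enumOrd J i))) :
    α ∈ shuffleSet lam J a P Q ↔ (i ∈ a ∧ α ∈ P) ∨ (i ∉ a ∧ α ∈ Q) := by
  have huniq : ∀ j < lam, α ∈ Ico (enumOrd J j) (enumOrd J (j + 1)) → j = i := by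
    intro j hj hα'
    rw [next_enumOrd hlam hJ hi] at hα
    have hl := (limit_iff.1 hlam.1.le).2
    refine le_antisymm ?_ ?_
    · exact Order.lt_add_one_iff.1
        ((enumOrd_lt_iff hlam hJ hj (hl i hi)).1 (hα'.1.trans_lt hα.2))
    · exact Order.lt_add_one_iff.1
        ((enumOrd_lt_iff hlam hJ hi (hl j hj)).1 (hα.1.trans_lt hα'.2))
  rw [next_enumOrd hlam hJ hi] at hα
  simp only [shuffleSet, mem_union, mem_iUnion, exists_prop, mem_inter_iff]
  constructor
  · rintro (⟨j, hj, h, hα'⟩ | ⟨j, hj, h, hα'⟩)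
    · obtain rfl := huniq j (ha hj) hα'
      exact Or.inl ⟨hj, h⟩
    · obtain rfl := huniq j hj.1 hα'
      exact Or.inr ⟨hj.2, h⟩
  · rintro (⟨hj, h⟩ | ⟨hj, h⟩)
    · exact Or.inl ⟨i, hj, h, hα⟩
    · exact Or.inr ⟨i, ⟨hi, hj⟩, h, hα⟩

end Shuffle

section Preservation

open Cardinal Set Ordinal

variable {ι : Type} {P : Bool → ι → Set Ordinal.{0}} {P₀ P₁ X : ι → Set Ordinal.{0}}
  {lam i j α β : Ordinal.{0}} {n N : ℕ} {a e c J K : Set Ordinal.{0}}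

open scoped Classical in
/-- If `X` agrees with `P true` or `P false` on each interval of a nice club, the choice being
constant on a club of every point of uncountable cofinality, then the eventual types of `X` are
those of the chosen tuples. -/
lemma rt_eq_of_glue [Finite ι] (hlam : Reg lam) (hK : ∀ p, Nice lam n (P p) K) (hKt : Thin K)
    (htypes : types n K (rt lam n (P true)) = types n K (rt lam n (P false)))
    (he : ∀ δ ∈ K, ℵ₀ < δ.cof → ∃ c ⊆ insert 0 K, IsClubIn c δ ∧ ∀ x ∈ c, x ∈ e ↔ δ ∈ e)
    (hX : ∀ α ∈ insert 0 K, ∀ i, ∀ x ∈ Ico α (next (insert 0 K) α),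
      x ∈ X i ↔ x ∈ P (decide (α ∈ e)) i) :
    (∀ β ∈ insert 0 K, β.cof = ℵ₀ → ∀ α ∈ insert 0 K, α < β →
      ty n (Ico α β) X = rt lam n (P (decide (α ∈ e))) α) ∧
    ∀ α ∈ insert 0 K, rt lam n (P (decide (α ∈ e))) α = rt lam n X α := by
  have hKc := (hK true).club
  have hpos : 0 < lam := pos_of_ne_zero (limit_iff.1 hlam.1.le).1
  have hJ := hKc.insert_zero hpos
  have hlim : ∀ β ∈ insert 0 K, β ≠ 0 → ℵ₀ ≤ β.cof := by
    rintro β (rfl | hβ) h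
    · exact absurd rfl h
    · exact (hK true).limit β hβ
  have hnext : ∀ α ∈ insert 0 K, ty n (Ico α (next (insert 0 K) α)) X =
      rt lam n (P (decide (α ∈ e))) α := by
    intro α hα
    obtain ⟨y, hy, hαy, -⟩ := hJ.exists_gt hlam.1.le (hJ.1 hα)
    have hn := next_mem ⟨y, hy, hαy⟩
    rw [ty_congr (hX α hα)]
    refine (hK _).hom _ (hn.1.resolve_left (pos_of_gt hn.2).ne') ?_ _ hn.2
    exact next_cof hKt.insert_zero ⟨y, hy, hαy⟩
  have hS : ∀ k ∈ insert 0 K, k.cof = ℵ₀ →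
      rt lam n (P (decide (k ∈ e))) k ∈ types n K (rt lam n (P true)) := by
    rintro k (rfl | hk) hc
    · exact absurd rfl (limit_iff.1 hc.ge).1
    · cases decide (k ∈ e)
      · exact htypes ▸ ⟨k, hk, hc, rfl⟩
      · exact ⟨k, hk, hc, rfl⟩
  have hSe : ∀ p, types n K (rt lam n (P true)) = types n K (rt lam n (P p)) := by
    rintro (_ | _)
    · exact htypes
    · rfl
  have hadd : ∀ i ∈ insert 0 K, ∀ t ∈ types n K (rt lam n (P true)),
      add (rt lam n (P (decide (i ∈ e))) i) t = rt lam n (P (decide (i ∈ e))) i := by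
    intro i hi t ht
    exact (hK _).add_eq hlam.1 (hJ.1 hi) (hSe _ ▸ ht)
  have hsum : ∀ f : ℕ → Ty n ι, (∃ i ∈ insert 0 K, f 0 = rt lam n (P (decide (i ∈ e))) i) →
      (∀ k, f (k + 1) ∈ types n K (rt lam n (P true))) → lsum n univ f = f 0 := by
    rintro f ⟨i, hi, hf⟩ h
    exact (hK _).lsum_nat_eq hlam.1 (hJ.1 hi) hf fun k => hSe _ ▸ h k
  have hcol : ∀ δ ∈ insert 0 K, ℵ₀ < δ.cof → ∀ α < δ, ∃ D ⊆ insert 0 K, IsClubIn D δ ∧ Thin D ∧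
      ∃ c ∈ D, α < c ∧ c.cof = ℵ₀ ∧ add (lsum n (D ∩ Ici c) fun x =>
        rt lam n (P (decide (x ∈ e))) x) (rt lam n (P (decide (δ ∈ e))) δ) =
          rt lam n (P (decide (c ∈ e))) c := by
    intro δ hδ hδc α hα
    rcases hδ with rfl | hδ
    · exact absurd hα not_lt_zero
    obtain ⟨c, hc, hcc, hce⟩ := he δ hδ hδc
    obtain ⟨D, hD, hDc, hDt, hDl⟩ := exists_thin hcc hδc
    have hDK : D ⊆ K := fun x hx => (hc (hD hx)).resolve_left (limit_iff.1 (hDl x hx)).1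
    obtain ⟨x, hx, h1, -, h3⟩ := hDc.exists_cof_eq hδc hα
    have hdec : ∀ y ∈ D, decide (y ∈ e) = decide (δ ∈ e) := fun y hy =>
      decide_eq_decide.2 (hce y (hD hy))
    refine ⟨D, hDK.trans (subset_insert _ _), hDc, hDt, x, hx, h1, h3, ?_⟩
    rw [lsum_congr fun y hy => by rw [hdec y hy.1], hdec x hx]
    exact (hK _).add_lsum_eq hlam.1 (hKc.1 hδ) hδc hDK hDc hDt hx
  exact ⟨homogeneous_of_next hlam.1 hJ hKt.insert_zero hlim hnext hS hadd hsum hcol,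
    rt_eq_of_next hlam hJ hKt.insert_zero hlim hnext hS hadd hsum hcol⟩

lemma _root_.IsSemiClub.semiClosed (ha : IsSemiClub a lam) : SemiClosed a lam := by
  intro δ hδ hc
  by_cases h : δ ∈ a
  · obtain ⟨c, hc, hca⟩ := (ha.2 δ hδ hc).1 h
    exact ⟨c, hc, fun x hx => iff_of_true (hca hx) h⟩
  · obtain ⟨c, hc, hca⟩ := (ha.2 δ hδ hc).2 h
    exact ⟨c, hc, fun x hx => iff_of_false (disjoint_left.1 hca hx) h⟩

open scoped Classical in
lemma rt_shuffleSet [Finite ι] (hlam : Reg lam) (ha : IsSemiClub a lam)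
    (h₀ : Nice lam n P₀ K) (h₁ : Nice lam n P₁ K) (hKt : Thin K)
    (htypes : types n K (rt lam n P₀) = types n K (rt lam n P₁)) :
    (∀ β ∈ insert 0 K, β.cof = ℵ₀ → ∀ i < lam, enumOrd (insert 0 K) i < β →
      ty n (Ico (enumOrd (insert 0 K) i) β)
        (fun k => shuffleSet lam (insert 0 K) a (P₀ k) (P₁ k)) =
          rt lam n (if i ∈ a then P₀ else P₁) (enumOrd (insert 0 K) i)) ∧
    ∀ i < lam, rt lam n (fun k => shuffleSet lam (insert 0 K) a (P₀ k) (P₁ k))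
        (enumOrd (insert 0 K) i) =
      rt lam n (if i ∈ a then P₀ else P₁) (enumOrd (insert 0 K) i) := by
  have hJ := h₀.club.insert_zero (pos_of_ne_zero (limit_iff.1 hlam.1.le).1)
  have hmem : ∀ i < lam, enumOrd (insert 0 K) i ∈ enumOrd (insert 0 K) '' a ↔ i ∈ a :=
    fun i hi => ⟨fun ⟨j, hj, h⟩ => enumOrd_inj' hlam hJ (ha.1 hj) hi h ▸ hj, mem_image_of_mem _⟩
  have hP : ∀ i < lam, cond (decide (enumOrd (insert 0 K) i ∈ enumOrd (insert 0 K) '' a)) P₀ P₁ =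
      if i ∈ a then P₀ else P₁ := by
    intro i hi
    by_cases h : i ∈ a <;> simp [hmem i hi, h]
  obtain ⟨key, key'⟩ := rt_eq_of_glue (P := fun p => cond p P₀ P₁)
    (X := fun k => shuffleSet lam (insert 0 K) a (P₀ k) (P₁ k))
    (e := enumOrd (insert 0 K) '' a) hlam (by rintro (_ | _); exacts [h₁, h₀]) hKt htypes
    (by
      intro δ hδ hδc
      obtain ⟨i, hi, rfl⟩ := exists_enumOrd_eq hlam hJ (Or.inr hδ)
      have hic := aleph0_lt_cof_of_enumOrd hlam hJ hKt.insert_zero (Or.inl rfl) hi hδc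
      obtain ⟨c, hc, hca⟩ := ha.semiClosed i hi hic
      refine ⟨_, ?_, isClubIn_image_enumOrd hlam hJ hi hic.le hc, ?_⟩
      · rintro _ ⟨j, hj, rfl⟩
        exact enumOrd_mem' hlam hJ ((hc.1 hj).trans hi)
      · rintro _ ⟨j, hj, rfl⟩
        rw [hmem i hi, hmem j ((hc.1 hj).trans hi)]
        exact hca j hj)
    (by
      intro α hα k x hx
      obtain ⟨i, hi, rfl⟩ := exists_enumOrd_eq hlam hJ hα
      rw [mem_shuffleSet_iff hlam hJ ha.1 hi hx]
      rw [hP i hi]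
      by_cases h : i ∈ a <;> simp [h])
  refine ⟨fun β hβ hc i hi h => ?_, fun i hi => ?_⟩
  · rw [key β hβ hc _ (enumOrd_mem' hlam hJ hi) h, hP i hi]
  · rw [← key' _ (enumOrd_mem' hlam hJ hi), hP i hi]

theorem exists_preservation (n : ℕ) (ι : Type) [Finite ι] : ∃ M : ℕ, ∀ {lam : Ordinal.{0}},
    Reg lam → ∀ P₀ P₁ : ι → Set Ordinal.{0}, ∃ J, IsClubIn J lam ∧ ∃ t : Ordinal.{0},
      ∀ a, IsSemiClub a lam →
        ty M (Iio lam) (extend P₀ a) = ty M (Iio lam) (extend P₁ a) →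
          ty n (Iio lam) P₀ = ty n (Iio lam) P₁ ∧
          ty n (Iio lam) P₀ =
            ty n (Iio lam) (fun k => shuffleSet lam J a (P₀ k) (P₁ k)) ∧
          ∀ γ ∈ J, γ.cof = ℵ₀ →
            ty n (Ico 0 γ) P₀ = ty n (Ico 0 t) P₀ ∧ ty n (Ico 0 γ) P₁ = ty n (Ico 0 t) P₀ ∧
            ty n (Ico 0 γ) (fun k => shuffleSet lam J a (P₀ k) (P₁ k)) = ty n (Ico 0 t) P₀ := by
  classical
  obtain ⟨N, hN⟩ := exists_ty_eq_of_sim n ι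
  refine ⟨N + 6 + n + 9 + Nat.card (Ty n ι), fun {lam} hlam P₀ P₁ => ?_⟩
  have hpos : 0 < lam := pos_of_ne_zero (limit_iff.1 hlam.1.le).1
  obtain ⟨K₀, hK₀⟩ := exists_nice hlam n P₀
  obtain ⟨K₁, hK₁⟩ := exists_nice hlam n P₁
  obtain ⟨K, hK, hKc, hKt, -⟩ := exists_thin (hK₀.club.inter hK₁.club hlam.1) hlam.1
  have h₀ := hK₀.mono hKc fun x hx => (hK hx).1
  have h₁ := hK₁.mono hKc fun x hx => (hK hx).2
  have hJ := hKc.insert_zero hpos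
  obtain ⟨t, ht, -, -, htc⟩ := hKc.exists_cof_eq hlam.1 hpos
  refine ⟨insert 0 K, hJ, t, fun a ha h => ?_⟩
  have hlt : ∀ {γ : Ordinal.{0}}, γ.cof = ℵ₀ → 0 < γ := fun hc =>
    pos_of_ne_zero (limit_iff.1 hc.ge).1
  have hmemK : ∀ {γ : Ordinal.{0}}, γ ∈ insert 0 K → γ.cof = ℵ₀ → γ ∈ K := fun hγ hc =>
    hγ.resolve_left (hlt hc).ne'
  obtain ⟨J₀, hJ₀, e₁⟩ := exists_expand_eq (N := N + 6) hlam h.symm hKc h₁.hom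
  obtain ⟨J₁, hJ₁, e₀⟩ := exists_expand_eq (N := N + 6) hlam h hKc h₀.hom
  have htypes : types n K (rt lam n P₀) = types n K (rt lam n P₁) := by
    refine Subset.antisymm (fun t ht => ?_) fun t ht => ?_
    · exact types_subset_of_expand_eq e₁.symm hJ₀.1 (h₀.stat t ht _ hJ₀)
    · exact types_subset_of_expand_eq e₀.symm hJ₁.1 (h₁.stat t ht _ hJ₁)
  have h0 : rt lam n P₁ 0 = rt lam n P₀ 0 :=
    rt_zero_of_expand_eq (N := N + 4) e₁ hpos
  obtain ⟨key, key'⟩ := rt_shuffleSet hlam ha h₀ h₁ hKt htypes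
  have hz : enumOrd (insert 0 K) 0 = 0 :=
    le_zero_iff.1 (enumOrd_le' (Or.inl rfl) fun j hj => absurd hj not_lt_zero)
  have hrt0 : rt lam n (if (0 : Ordinal.{0}) ∈ a then P₀ else P₁) 0 = rt lam n P₀ 0 := by
    split_ifs
    exacts [rfl, h0]
  obtain ⟨F, -, hFc, hF⟩ := exists_enumOrd_fixed hlam hJ
  have hFrt : ∀ i ∈ F, rt lam n (fun k => shuffleSet lam (insert 0 K) a (P₀ k) (P₁ k)) i =
      rt lam n (if i ∈ a then P₀ else P₁) i := by
    intro i hi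
    have := key' i (hFc.1 hi)
    rwa [hF i hi] at this
  refine ⟨?_, ?_, fun γ hγ hc => ⟨?_, ?_, ?_⟩⟩
  · exact ty_reindex some (ty_of_le (by omega) h)
  · refine (hN hlam ha.semiClosed _ P₀ ?_ ?_ ?_).symm
    · have := key' 0 hpos
      rwa [hz, hrt0] at this
    · refine ⟨F, F, hFc, hFc, congrArg _ (col_congr fun x hx => ?_)⟩
      rw [hFrt x hx.2, if_pos hx.1]
    · obtain ⟨L, hL, L', hLc, hLc', eq⟩ :=
        (sim_compl_of_expand_eq (N := N + 4) (ty_of_le (by omega) e₁) hKc hJ₀).restrict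
          hlam.1 hFc
      refine ⟨L, L', hLc, hLc', Eq.trans (congrArg _ (col_congr fun x hx => ?_)) eq⟩
      rw [hFrt x (hL hx.2), if_neg hx.1]
  all_goals rw [h₀.hom t ht htc 0 (hlt htc)]
  · exact h₀.hom γ (hmemK hγ hc) hc 0 (hlt hc)
  · rw [h₁.hom γ (hmemK hγ hc) hc 0 (hlt hc), h0]
  · have := key γ hγ hc 0 hpos (hz.symm ▸ hlt hc)
    rwa [hz, hrt0] at this

lemma reg_ord {κ : Cardinal.{0}} (hκ : κ.IsRegular) (h : ℵ₀ < κ) : Reg κ.ord := by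
  rw [Reg, hκ.cof_ord]
  exact ⟨h, fun γ hγ => lt_ord.1 hγ⟩

lemma snoc_eq_extend_comp {l : ℕ} (P : Fin l → Set Ordinal.{0}) (a : Set Ordinal.{0}) :
    (Fin.snoc P a : Fin (l + 1) → Set Ordinal.{0}) ∘
      (fun o : Option (Fin l) => o.elim (Fin.last l) Fin.castSucc) = extend P a := by
  funext o
  cases o with
  | none => exact Fin.snoc_last (α := fun _ => Set Ordinal.{0}) a P
  | some k => exact Fin.snoc_castSucc (α := fun _ => Set Ordinal.{0}) a P k

end Preservation

end MonadicShuffle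

/-- **Preservation theorem**: for every `n, l` there is `m = m(n,l)`, and for every
regular `λ > ℵ₀` and length-`l` tuples `P̄₀, P̄₁` of subsets of `λ` there are a club
`J ⊆ λ` and `t* ∈ T_{n,l}` such that for every semi-club `a ⊆ λ`, with
`X̄ := [P̄₀,P̄₁]^J_a`: if `a-Th^m(λ;P̄₀) = a-Th^m(λ;P̄₁)` then
`Th^n(λ;P̄₀) = Th^n(λ;P̄₁) = Th^n(λ;X̄)`, and moreover for every `γ ∈ J` with
`cf(γ) = ℵ₀`, all three theories restricted to `[0,γ)` equal `t*`. -/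
theorem preservation_theorem (n l : ℕ) : ∃ m : ℕ,
    ∀ κ : Cardinal.{0}, κ.IsRegular → Cardinal.aleph0 < κ →
      ∀ P0 P1 : Fin l → Set Ordinal.{0},
        (∀ k, P0 k ⊆ Set.Iio κ.ord) → (∀ k, P1 k ⊆ Set.Iio κ.ord) →
        ∃ J : Set Ordinal.{0}, IsClubIn J κ.ord ∧
          ∃ tstar ∈ FormallyPossible.{1} n (Fin l),
            ∀ a : Set Ordinal.{0}, IsSemiClub a κ.ord →
              ThOn m (Set.Iio κ.ord) (Fin.snoc P0 a) =
                  ThOn m (Set.Iio κ.ord) (Fin.snoc P1 a) →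
                (ThOn n (Set.Iio κ.ord) P0 = ThOn n (Set.Iio κ.ord) P1 ∧
                 ThOn n (Set.Iio κ.ord) P0 =
                   ThOn n (Set.Iio κ.ord) (fun k => shuffleSet κ.ord J a (P0 k) (P1 k)) ∧
                 ∀ γ ∈ J, γ.cof = Cardinal.aleph0 →
                   (ThOn n (Set.Ico (0 : Ordinal) γ) P0 = tstar ∧
                    ThOn n (Set.Ico (0 : Ordinal) γ) P1 = tstar ∧
                    ThOn n (Set.Ico (0 : Ordinal) γ)
                      (fun k => shuffleSet κ.ord J a (P0 k) (P1 k)) = tstar)) := by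
  open MonadicShuffle in
  obtain ⟨M, hM⟩ := exists_preservation n (Fin l)
  refine ⟨M + 2, fun κ hκ hω P0 P1 _ _ => ?_⟩
  obtain ⟨J, hJ, t, ht⟩ := hM (reg_ord hκ hω) P0 P1
  refine ⟨J, hJ, ThOn n (Set.Ico 0 t) P0, ⟨_, _, _, rfl⟩, fun a ha h => ?_⟩
  have h' := ty_reindex (fun o : Option (Fin l) => o.elim (Fin.last l) Fin.castSucc)
    (ty_eq_of_ThOn_eq h)
  rw [snoc_eq_extend_comp, snoc_eq_extend_comp] at h'
  obtain ⟨h1, h2, h3⟩ := ht a ha h'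
  refine ⟨ThOn_eq_of_ty_eq h1, ThOn_eq_of_ty_eq h2, fun γ hγ hc => ?_⟩
  obtain ⟨g1, g2, g3⟩ := h3 γ hγ hc
  exact ⟨ThOn_eq_of_ty_eq g1, ThOn_eq_of_ty_eq g2, ThOn_eq_of_ty_eq g3⟩
end
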